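/- If ε₂·ε_{p₁p₂}·ε_{2p₁p₂} is not a square in K₃⁺, then the order of Cl₂(K₃) equals h₂(p₁p₂)·h₂(−p₁p₂). -/

import Mathlib

open NumberField IntermediateField

/-- `ε` is the fundamental unit of the real quadratic field `ℚ(√D)` (for `D > 1` squarefree):
elements of the ring of integers of `ℚ(√D)` are exactly the numbers `(x + y√D)/2` with
`x ≡ y·D (mod 2)`, and units are those with `x² - Dy² = ±4`.  The fundamental unit is the
least unit `> 1`; equivalently, every unit is of the form `±ε^k` with `k ∈ ℤ`. -/
def IsFundUnit (D : ℕ) (ε : ℝ) : Prop :=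
  1 < ε ∧
  (∃ x y : ℤ, ε = ((x : ℝ) + (y : ℝ) * Real.sqrt D) / 2 ∧
    (x ^ 2 - (D : ℤ) * y ^ 2 = 4 ∨ x ^ 2 - (D : ℤ) * y ^ 2 = -4)) ∧
  ∀ x y : ℤ, (x ^ 2 - (D : ℤ) * y ^ 2 = 4 ∨ x ^ 2 - (D : ℤ) * y ^ 2 = -4) →
    1 < ((x : ℝ) + (y : ℝ) * Real.sqrt D) / 2 →
    ε ≤ ((x : ℝ) + (y : ℝ) * Real.sqrt D) / 2

section EulerProduct

open Filter Topology Ideal IsDedekindDomain nonZeroDivisors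

variable (K : Type*) [Field K] [NumberField K]

theorem tendsto_sum_card_absNorm_div :
    Tendsto (fun n : ℕ ↦ (∑ k ∈ Finset.Icc 1 n,
      (Nat.card {I : Ideal (𝓞 K) // absNorm I = k} : ℝ)) / n) atTop
      (𝓝 (dedekindZeta_residue K)) := by
  refine ((NumberField.Ideal.tendsto_norm_le_div_atTop₀ K).comp
    tendsto_natCast_atTop_atTop).congr fun n ↦ ?_
  simp only [Function.comp_apply, Nat.cast_le, ← Nat.cast_sum]
  congr
  rw [← add_left_inj 1, ← card_norm_le_eq_card_norm_le_add_one,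
    show Finset.Icc 1 n = Finset.Ioc 0 n from Finset.Icc_succ_left_eq_Ioc _ _,
    show 1 = Nat.card {I : Ideal (𝓞 K) // absNorm I = 0} by simp [Ideal.absNorm_eq_zero_iff],
    Finset.sum_Ioc_add_eq_sum_Icc (n.zero_le),
    ← Finset.card_preimage_eq_sum_card_image_eq (fun k _ ↦ finite_setOfPred_absNorm_eq k)]
  simp [Set.coe_eq_subtype]

theorem summable_card_absNorm_mul_rpow {s : ℝ} (hs : 1 < s) :
    Summable fun n : ℕ ↦ (Nat.card {I : Ideal (𝓞 K) // absNorm I = n} : ℝ) * (n : ℝ) ^ (-s) := by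
  have h := LSeriesSummable_of_sum_norm_bigO_and_nonneg
    (f := fun n ↦ (Nat.card {I : Ideal (𝓞 K) // absNorm I = n} : ℝ)) (r := 1) (s := (s : ℂ))
    ?_ (fun _ ↦ Nat.cast_nonneg _) zero_le_one (by simpa using hs)
  · refine (h.norm).congr fun n ↦ ?_
    rcases eq_or_ne n 0 with rfl | hn
    · simp [Real.zero_rpow (by linarith : -s ≠ 0)]
    · rw [LSeries.term_of_ne_zero hn, norm_div, Complex.norm_natCast_cpow_of_pos
        (Nat.pos_of_ne_zero hn), Real.rpow_neg (by positivity), div_eq_mul_inv]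
      simp
  · have := (tendsto_sum_card_absNorm_div K).isBigO_one ℝ
    have h2 := this.mul (Asymptotics.isBigO_refl (fun n : ℕ ↦ (n : ℝ)) atTop)
    refine h2.congr' ?_ ?_
    · filter_upwards [eventually_gt_atTop 0] with n hn
      field_simp
    · filter_upwards with n
      simp

/-- The completely multiplicative function `I ↦ N(I)⁻ˢ` on ideals. -/
noncomputable def idealNormRpow (s : ℝ) (I : Ideal (𝓞 K)) : ℝ := (absNorm I : ℝ) ^ (-s)

variable {K}

theorem idealNormRpow_nonneg (s : ℝ) (I : Ideal (𝓞 K)) : 0 ≤ idealNormRpow K s I := by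
  unfold idealNormRpow; positivity

theorem idealNormRpow_mul (s : ℝ) (I J : Ideal (𝓞 K)) :
    idealNormRpow K s (I * J) = idealNormRpow K s I * idealNormRpow K s J := by
  simp [idealNormRpow, Real.mul_rpow]

theorem idealNormRpow_pow (s : ℝ) (I : Ideal (𝓞 K)) (n : ℕ) :
    idealNormRpow K s (I ^ n) = idealNormRpow K s I ^ n := by
  induction n with
  | zero => simp [idealNormRpow]
  | succ n ih => rw [pow_succ, idealNormRpow_mul, ih, pow_succ]

theorem hasSum_idealNormRpow {s : ℝ} (hs : 1 < s) :
    HasSum (idealNormRpow K s)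
      (∑' n : ℕ, (Nat.card {I : Ideal (𝓞 K) // absNorm I = n} : ℝ) * (n : ℝ) ^ (-s)) := by
  have hfib (n : ℕ) : HasSum (fun I : {I : Ideal (𝓞 K) // absNorm I = n} ↦
      idealNormRpow K s I.1)
      ((Nat.card {I : Ideal (𝓞 K) // absNorm I = n} : ℝ) * (n : ℝ) ^ (-s)) := by
    rcases eq_or_ne n 0 with rfl | hn
    · have : ∀ I : {I : Ideal (𝓞 K) // absNorm I = 0}, idealNormRpow K s I.1 = 0 := by
        rintro ⟨I, hI⟩
        simp [idealNormRpow, hI, Real.zero_rpow (by linarith : -s ≠ 0)]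
      simp only [this]
      simp [Real.zero_rpow (by linarith : -s ≠ 0), hasSum_zero]
    · have : Finite {I : Ideal (𝓞 K) // absNorm I = n} := finite_setOfPred_absNorm_eq n
      have := Fintype.ofFinite {I : Ideal (𝓞 K) // absNorm I = n}
      convert! hasSum_fintype (fun I : {I : Ideal (𝓞 K) // absNorm I = n} ↦
        idealNormRpow K s I.1)
      rw [Finset.sum_congr rfl (g := fun _ ↦ (n : ℝ) ^ (-s))
        (by rintro ⟨I, hI⟩ -; simp [idealNormRpow, hI])]
      simp [Nat.card_eq_fintype_card]
  have hsum : Summable (fun x : Σ n : ℕ, {I : Ideal (𝓞 K) // absNorm I = n} ↦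
      idealNormRpow K s x.2.1) := by
    rw [summable_sigma_of_nonneg (fun x ↦ idealNormRpow_nonneg s _)]
    exact ⟨fun n ↦ (hfib n).summable, by
      simpa only [(hfib _).tsum_eq] using summable_card_absNorm_mul_rpow K hs⟩
  have h1 := HasSum.sigma hsum.hasSum hfib
  rw [h1.tsum_eq]
  exact (Equiv.sigmaFiberEquiv (absNorm : Ideal (𝓞 K) → ℕ)).hasSum_iff.mp hsum.hasSum

theorem ofReal_tsum_idealNormRpow {s : ℝ} (hs : 1 < s) :
    dedekindZeta K s = ((∑' I, idealNormRpow K s I : ℝ) : ℂ) := by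
  rw [(hasSum_idealNormRpow hs).tsum_eq, dedekindZeta, LSeries, Complex.ofReal_tsum]
  refine tsum_congr fun n ↦ ?_
  rcases eq_or_ne n 0 with rfl | hn
  · simp [Real.zero_rpow (by linarith : -s ≠ 0)]
  · rw [LSeries.term_of_ne_zero hn]
    push_cast
    rw [Complex.ofReal_cpow (by positivity), div_eq_mul_inv, ← Complex.cpow_neg]
    simp

end EulerProduct

section EulerProduct

open Filter Topology Ideal IsDedekindDomain nonZeroDivisors

variable {K : Type*} [Field K] [NumberField K]

/-- Nonzero ideals all of whose prime factors lie in `S`. -/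
def idealsSupportedOn (S : Finset (HeightOneSpectrum (𝓞 K))) : Set (Ideal (𝓞 K)) :=
  {I | I ≠ 0 ∧ ∀ v : HeightOneSpectrum (𝓞 K), v.asIdeal ∣ I → v ∈ S}

theorem absNorm_heightOneSpectrum_gt_one (v : HeightOneSpectrum (𝓞 K)) :
    1 < absNorm v.asIdeal := by
  have h0 : absNorm v.asIdeal ≠ 0 := by
    rw [Ne, absNorm_eq_zero_iff]; exact v.ne_bot
  have h1 : absNorm v.asIdeal ≠ 1 := by
    rw [Ne, absNorm_eq_one_iff]; exact v.isPrime.ne_top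
  omega

theorem idealNormRpow_lt_one {s : ℝ} (hs : 1 < s) (v : HeightOneSpectrum (𝓞 K)) :
    idealNormRpow K s v.asIdeal < 1 := by
  have h : (1 : ℝ) < absNorm v.asIdeal := by exact_mod_cast absNorm_heightOneSpectrum_gt_one v
  exact Real.rpow_lt_one_of_one_lt_of_neg h (by linarith)

theorem hasSum_idealsSupportedOn {s : ℝ} (hs : 1 < s)
    (S : Finset (HeightOneSpectrum (𝓞 K))) :
    HasSum (fun I : idealsSupportedOn S ↦ idealNormRpow K s I.1)
      (∏ v ∈ S, (1 - idealNormRpow K s v.asIdeal)⁻¹) := by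
  classical
  induction S using Finset.induction_on with
  | empty =>
    have hmem : (⊤ : Ideal (𝓞 K)) ∈ idealsSupportedOn (∅ : Finset (HeightOneSpectrum (𝓞 K))) := by
      refine ⟨top_ne_bot, fun v hv ↦ ?_⟩
      exact absurd (top_le_iff.mp (le_of_dvd hv)) v.isPrime.ne_top
    have huniq (I : idealsSupportedOn (∅ : Finset (HeightOneSpectrum (𝓞 K)))) : I = ⟨⊤, hmem⟩ := by
      obtain ⟨I, hI0, hI⟩ := I
      ext1
      by_contra hne
      obtain ⟨M, hM, hIM⟩ := exists_le_maximal I hne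
      have hM0 : M ≠ ⊥ := fun h ↦ hI0 (by rw [h] at hIM; exact le_bot_iff.mp hIM)
      exact absurd (hI ⟨M, hM.isPrime, hM0⟩ (dvd_iff_le.mpr hIM)) (Finset.notMem_empty _)
    have := hasSum_single (f := fun I : idealsSupportedOn
      (∅ : Finset (HeightOneSpectrum (𝓞 K))) ↦ idealNormRpow K s I.1) ⟨⊤, hmem⟩
      (fun I hI ↦ absurd (huniq I) hI)
    simpa [idealNormRpow] using this
  | insert v S hv ih =>
    have hvp : Prime v.asIdeal := v.prime
    let f : ℕ × idealsSupportedOn S → idealsSupportedOn (insert v S) := fun x ↦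
      ⟨v.asIdeal ^ x.1 * x.2.1, mul_ne_zero (pow_ne_zero _ v.ne_bot) x.2.2.1, fun w hw ↦ by
        rcases w.prime.dvd_or_dvd hw with h | h
        · have h1 := w.prime.dvd_of_dvd_pow h
          have h2 : v.asIdeal = w.asIdeal :=
            (v.isPrime.isMaximal v.ne_bot).eq_of_le w.isPrime.ne_top (le_of_dvd h1)
          rw [Finset.mem_insert]; left; ext1; exact h2.symm
        · exact Finset.mem_insert_of_mem (x.2.2.2 w h)⟩
    have hnd (x : idealsSupportedOn S) : ¬ v.asIdeal ∣ x.1 := fun h ↦ hv (x.2.2 v h)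
    have hf : Function.Bijective f := by
      constructor
      · rintro ⟨k, I⟩ ⟨l, J⟩ h
        have h : v.asIdeal ^ k * I.1 = v.asIdeal ^ l * J.1 := congrArg Subtype.val h
        have hkl : k = l := by
          have e1 := emultiplicity_mul hvp (a := v.asIdeal ^ k) (b := I.1)
          have e2 := emultiplicity_mul hvp (a := v.asIdeal ^ l) (b := J.1)
          rw [emultiplicity_pow_self_of_prime hvp, emultiplicity_eq_zero.mpr (hnd _), add_zero]
            at e1 e2
          rw [h, e2] at e1
          exact_mod_cast e1.symm
        subst hkl
        have := mul_left_cancel₀ (pow_ne_zero k v.ne_bot) h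
        exact Prod.ext rfl (Subtype.ext this)
      · rintro ⟨I, hI0, hI⟩
        obtain ⟨J, hJ, hJv⟩ := (FiniteMultiplicity.of_prime_left hvp
          hI0).exists_eq_pow_mul_and_not_dvd
        refine ⟨(multiplicity v.asIdeal I, ⟨J, ?_, fun w hw ↦ ?_⟩), Subtype.ext hJ.symm⟩
        · rintro rfl
          exact hI0 (by rw [hJ, mul_zero])
        · have := hI w (hw.trans (hJ ▸ dvd_mul_left _ _))
          rcases Finset.mem_insert.mp this with rfl | h
          · exact absurd hw hJv
          · exact h
    rw [Finset.prod_insert hv]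
    have hgeo := hasSum_geometric_of_lt_one (idealNormRpow_nonneg s v.asIdeal)
      (idealNormRpow_lt_one hs v)
    have hs2 := hgeo.summable.mul_of_nonneg ih.summable
      (fun k ↦ pow_nonneg (idealNormRpow_nonneg s _) k) (fun I ↦ idealNormRpow_nonneg s _)
    have := hgeo.mul ih hs2
    rw [← (Equiv.ofBijective f hf).hasSum_iff]
    convert! this using 2 with x
    simp [f, idealNormRpow_mul, idealNormRpow_pow]

theorem hasProd_idealNormRpow {s : ℝ} (hs : 1 < s) :
    HasProd (fun v : HeightOneSpectrum (𝓞 K) ↦ (1 - idealNormRpow K s v.asIdeal)⁻¹)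
      (∑' I, idealNormRpow K s I) := by
  classical
  have hsum := (hasSum_idealNormRpow (K := K) hs).summable
  have h := tendsto_tsum_of_dominated_convergence (𝓕 := atTop)
    (f := fun (S : Finset (HeightOneSpectrum (𝓞 K))) I ↦
      (idealsSupportedOn S).indicator (idealNormRpow K s) I)
    (g := idealNormRpow K s) hsum ?_ ?_
  · simp_rw [← tsum_subtype, fun S ↦ (hasSum_idealsSupportedOn hs S).tsum_eq] at h
    exact h
  · intro I
    rcases eq_or_ne I 0 with rfl | hI
    · have h0 : idealNormRpow K s 0 = 0 := by
        simp [idealNormRpow, Real.zero_rpow (by linarith : -s ≠ 0)]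
      rw [h0]
      refine tendsto_const_nhds.congr fun S ↦ ?_
      rw [Set.indicator_apply]
      split_ifs
      exacts [h0.symm, rfl]
    · have hfin : {v : HeightOneSpectrum (𝓞 K) | v.asIdeal ∣ I}.Finite := I.finite_factors hI
      refine tendsto_const_nhds.congr' ?_
      filter_upwards [eventually_ge_atTop hfin.toFinset] with S hS
      rw [Set.indicator_of_mem]
      exact ⟨hI, fun v hv ↦ hS (by simpa using hv)⟩
  · refine .of_forall fun S I ↦ ?_
    rw [Set.indicator]
    split_ifs
    · rw [Real.norm_of_nonneg (idealNormRpow_nonneg s I)]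
    · simpa using idealNormRpow_nonneg s I

/-- The rational prime below a maximal ideal. -/
noncomputable def primeBelow (v : HeightOneSpectrum (𝓞 K)) : Nat.Primes :=
  ⟨absNorm (under ℤ v.asIdeal),
    have : NeZero v.asIdeal := ⟨v.ne_bot⟩
    Nat.absNorm_under_prime v.asIdeal⟩

omit [NumberField K] in
theorem span_primeBelow (v : HeightOneSpectrum (𝓞 K)) :
    span {((primeBelow v : ℕ) : ℤ)} = under ℤ v.asIdeal :=
  Int.ideal_span_absNorm_eq_self _

theorem hasProd_of_splitting {s : ℝ} (hs : 1 < s) (f g : Nat.Primes → ℕ)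
    (hg : ∀ p : Nat.Primes, (primesOver (span {((p : ℕ) : ℤ)}) (𝓞 K)).ncard = g p)
    (hf : ∀ p : Nat.Primes, ∀ P ∈ primesOver (span {((p : ℕ) : ℤ)}) (𝓞 K),
      absNorm P = (p : ℕ) ^ f p) :
    HasProd (fun p : Nat.Primes ↦ ((1 - (((p : ℕ) : ℝ) ^ (-s)) ^ f p)⁻¹) ^ g p)
      (∑' I, idealNormRpow K s I) := by
  have h := (Equiv.sigmaFiberEquiv (primeBelow (K := K))).hasProd_iff.mpr
    (hasProd_idealNormRpow (K := K) hs)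
  refine h.sigma fun p ↦ ?_
  have hmem (v : HeightOneSpectrum (𝓞 K)) :
      primeBelow v = p ↔ v.asIdeal ∈ primesOver (span {((p : ℕ) : ℤ)}) (𝓞 K) := by
    constructor
    · rintro rfl
      exact ⟨v.isPrime, ⟨span_primeBelow v⟩⟩
    · rintro ⟨-, ⟨h⟩⟩
      rw [← span_primeBelow, span_singleton_eq_span_singleton, Int.associated_iff_natAbs] at h
      exact Subtype.ext (by simpa using h.symm)
  have hp0 : span {((p : ℕ) : ℤ)} ≠ ⊥ := by simpa using p.2.ne_zero
  let e : {v : HeightOneSpectrum (𝓞 K) // primeBelow v = p} ≃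
      primesOver (span {((p : ℕ) : ℤ)}) (𝓞 K) :=
    { toFun := fun v ↦ ⟨v.1.asIdeal, (hmem v.1).mp v.2⟩
      invFun := fun P ↦ ⟨⟨P.1, P.2.1, ne_bot_of_mem_primesOver hp0 P.2⟩, (hmem _).mpr P.2⟩
      left_inv := fun v ↦ rfl
      right_inv := fun P ↦ rfl }
  have : Fact (p : ℕ).Prime := ⟨p.2⟩
  have hfin : Finite {v : HeightOneSpectrum (𝓞 K) // primeBelow v = p} := by
    have hm : (span {((p : ℕ) : ℤ)}).IsMaximal :=
      Int.ideal_span_isMaximal_of_prime _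
    have := (IsDedekindDomain.primesOver_finite (span {((p : ℕ) : ℤ)}) (𝓞 K)).to_subtype
    exact .of_equiv _ e.symm
  have := Fintype.ofFinite {v : HeightOneSpectrum (𝓞 K) // primeBelow v = p}
  convert! hasProd_fintype (fun v : {v : HeightOneSpectrum (𝓞 K) // primeBelow v = p} ↦
    (1 - idealNormRpow K s v.1.asIdeal)⁻¹) using 1
  rw [Finset.prod_congr rfl (g := fun _ ↦ (1 - (((p : ℕ) : ℝ) ^ (-s)) ^ f p)⁻¹)]
  · rw [Finset.prod_const, Finset.card_univ, ← Nat.card_eq_fintype_card, Nat.card_congr e,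
      ← hg p]
    rfl
  · rintro ⟨v, hv⟩ -
    rw [idealNormRpow, hf p _ ((hmem v).mp hv), Nat.cast_pow, ← Real.rpow_natCast,
      ← Real.rpow_mul (by positivity), mul_comm, Real.rpow_mul (by positivity), Real.rpow_natCast]

end EulerProduct

section EulerProduct

open Filter Topology Ideal IsDedekindDomain nonZeroDivisors

/-- The rational prime `p` has exactly `g` primes above it in `K`, all of norm `p ^ f`. -/
def SplitsAs (K : Type*) [Field K] [NumberField K] (p f g : ℕ) : Prop :=
  (primesOver (span {(p : ℤ)}) (𝓞 K)).ncard = g ∧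
    ∀ P ∈ primesOver (span {(p : ℤ)}) (𝓞 K), absNorm P = p ^ f

theorem hasProd_dedekindZeta {K : Type*} [Field K] [NumberField K] {s : ℝ} (hs : 1 < s)
    {f g : Nat.Primes → ℕ} (h : ∀ p : Nat.Primes, SplitsAs K p (f p) (g p)) :
    HasProd (fun p : Nat.Primes ↦ ((1 - (((p : ℕ) : ℂ) ^ (-s : ℂ)) ^ f p)⁻¹) ^ g p)
      (dedekindZeta K s) := by
  rw [ofReal_tsum_idealNormRpow hs]
  convert! (hasProd_of_splitting hs f g (fun p ↦ (h p).1) (fun p ↦ (h p).2)).map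
    Complex.ofRealHom Complex.continuous_ofReal using 2 with p
  simp [Complex.ofReal_cpow (Nat.cast_nonneg _)]

theorem dedekindZeta_residue_eq_prod {K : Type*} [Field K] [NumberField K] {ι : Type*} [Fintype ι]
    (k : ι → Type*) [∀ i, Field (k i)] [∀ i, NumberField (k i)] (n : ℕ)
    (hn : Fintype.card ι = n + 1) {f g : Nat.Primes → ℕ} {F G : ι → Nat.Primes → ℕ}
    (hK : ∀ p : Nat.Primes, SplitsAs K p (f p) (g p))
    (hk : ∀ i, ∀ p : Nat.Primes, SplitsAs (k i) p (F i p) (G i p))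
    (hfg : ∀ p : Nat.Primes, ∀ x : ℂ,
      (1 - x ^ f p) ^ g p * (1 - x) ^ n = ∏ i, (1 - x ^ F i p) ^ G i p) :
    dedekindZeta_residue K = ∏ i, dedekindZeta_residue (k i) := by
  have key (s : ℝ) (hs : 1 < s) :
      dedekindZeta K s * riemannZeta s ^ n = ∏ i, dedekindZeta (k i) s := by
    have h1 := hasProd_dedekindZeta hs hK
    have h2 := (riemannZeta_eulerProduct_hasProd (s := s) (by simpa using hs))
    have h3 := hasProd_prod (s := Finset.univ) fun i _ ↦ hasProd_dedekindZeta hs (hk i)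
    have h4 := hasProd_prod (s := Finset.range n) fun i _ ↦ h2
    simp only [Finset.prod_const, Finset.card_range] at h4
    refine (h1.mul h4).unique ?_
    convert! h3 using 2 with p
    have := hfg p (((p : ℕ) : ℂ) ^ (-s : ℂ))
    simp only [inv_pow, ← mul_inv, Finset.prod_inv_distrib,
      this]
  have hz : Tendsto (fun s : ℝ ↦ ((s : ℂ) - 1) * riemannZeta s) (𝓝[>] 1) (𝓝 1) := by
    refine riemannZeta_residue_one.comp ?_
    refine tendsto_nhdsWithin_iff.mpr ⟨?_, ?_⟩
    · exact (Complex.continuous_ofReal.tendsto' 1 1 (by simp)).mono_left nhdsWithin_le_nhds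
    · filter_upwards [self_mem_nhdsWithin] with s hs
      simpa using (ne_of_gt hs : s ≠ 1)
  have h1 := (tendsto_sub_one_mul_dedekindZeta_nhdsGT K).mul (hz.pow n)
  have h2 := tendsto_finsetProd Finset.univ
    fun i _ ↦ tendsto_sub_one_mul_dedekindZeta_nhdsGT (k i)
  have h3 : ((dedekindZeta_residue K : ℝ) : ℂ) * 1 ^ n =
      ∏ i, ((dedekindZeta_residue (k i) : ℝ) : ℂ) := by
    refine tendsto_nhds_unique h1 (h2.congr' ?_)
    filter_upwards [self_mem_nhdsWithin] with s hs
    rw [Finset.prod_mul_distrib, ← key s hs, Finset.prod_const, Finset.card_univ, hn,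
      mul_pow]
    ring
  rw [one_pow, mul_one] at h3
  exact_mod_cast h3

end EulerProduct

section Splitting

open Ideal
open scoped Pointwise

variable {K : Type*} [Field K] [NumberField K]

theorem exists_splitsAs [IsGalois ℚ K] {p : ℕ} (hp : p.Prime) :
    ∃ P ∈ primesOver (span {(p : ℤ)}) (𝓞 K), ∃ e f g : ℕ, SplitsAs K p f g ∧
      e * f = Nat.card (MulAction.stabilizer Gal(K/ℚ) P) ∧ g * (e * f) = Module.finrank ℚ K ∧
      ∀ k, (p : 𝓞 K) ∈ P ^ k → k ≤ e := by
  have hp0 : span {(p : ℤ)} ≠ ⊥ := by simpa using hp.ne_zero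
  have : Fact p.Prime := ⟨hp⟩
  have hm : (span {(p : ℤ)}).IsMaximal := Int.ideal_span_isMaximal_of_prime p
  obtain ⟨P, hP⟩ : (primesOver (span {(p : ℤ)}) (𝓞 K)).Nonempty := by
    have : Nonempty (primesOver (span {(p : ℤ)}) (𝓞 K)) := inferInstance
    exact Set.nonempty_coe_sort.mp this
  have hP1 := hP.1
  have hP2 := hP.2
  have : PerfectField (span {(p : ℤ)}).ResidueField := by
    have : Finite (ℤ ⧸ span {(p : ℤ)}) := inferInstance
    have : Finite (span {(p : ℤ)}).ResidueField :=
      .of_surjective _ (span {(p : ℤ)}).bijective_algebraMap_quotient_residueField.2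
    infer_instance
  refine ⟨P, hP, (span {(p : ℤ)}).ramificationIdxIn (𝓞 K), (span {(p : ℤ)}).inertiaDegIn (𝓞 K),
    (primesOver (span {(p : ℤ)}) (𝓞 K)).ncard, ⟨rfl, fun Q hQ ↦ ?_⟩, ?_, ?_, fun k hk ↦ ?_⟩
  · have := hQ.1
    have := hQ.2
    have := hQ.1.isMaximal (ne_bot_of_mem_primesOver hp0 hQ)
    rw [absNorm_eq_pow_inertiaDeg' Q hp, inertiaDegIn_eq_inertiaDeg (span {(p : ℤ)}) Q Gal(K/ℚ),
      inertiaDeg'_eq_inertiaDeg]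
  · exact (card_stabilizer_eq (G := Gal(K/ℚ)) (span {(p : ℤ)}) P).symm
  · rw [ncard_primesOver_mul_ramificationIdxIn_mul_inertiaDegIn (span {(p : ℤ)}) (𝓞 K) Gal(K/ℚ),
      IsGalois.card_aut_eq_finrank]
  · rw [ramificationIdxIn_eq_ramificationIdx (span {(p : ℤ)}) P Gal(K/ℚ),
      ← ramificationIdx'_eq_ramificationIdx (span {(p : ℤ)}) P hp0]
    have hmap : map (algebraMap ℤ (𝓞 K)) (span {(p : ℤ)}) = span {(p : 𝓞 K)} := by
      simp [map_span]
    have hmap0 : map (algebraMap ℤ (𝓞 K)) (span {(p : ℤ)}) ≠ ⊥ := by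
      rw [hmap]; simpa using hp.ne_zero
    rw [IsDedekindDomain.ramificationIdx'_eq_multiplicity hmap0 hP1]
    refine (FiniteMultiplicity.of_prime_left
      (prime_of_isPrime (ne_bot_of_mem_primesOver hp0 hP) hP1) hmap0).le_multiplicity_of_pow_dvd ?_
    rw [hmap, dvd_span_singleton]
    exact hk

omit [NumberField K] in
theorem natCast_mem_of_mem_primesOver {p : ℕ} {P : Ideal (𝓞 K)}
    (hP : P ∈ primesOver (span {(p : ℤ)}) (𝓞 K)) : (p : 𝓞 K) ∈ P := by
  have := hP.2
  have h : (p : ℤ) ∈ under ℤ P := by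
    rw [← over_def P (span {(p : ℤ)})]; exact mem_span_singleton_self _
  simpa using h

omit [NumberField K] in
theorem intCast_mem_iff_dvd {p : ℕ} {P : Ideal (𝓞 K)}
    (hP : P ∈ primesOver (span {(p : ℤ)}) (𝓞 K)) (n : ℤ) : (n : 𝓞 K) ∈ P ↔ (p : ℤ) ∣ n := by
  have := hP.2
  have h : n ∈ under ℤ P ↔ (p : ℤ) ∣ n := by
    rw [← over_def P (span {(p : ℤ)}), mem_span_singleton]
  simpa using h

theorem exists_int_sub_mem {p : ℕ} (hp : p.Prime) {P : Ideal (𝓞 K)}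
    (hP : P ∈ primesOver (span {(p : ℤ)}) (𝓞 K)) (hN : absNorm P = p) (r : 𝓞 K) :
    ∃ n : ℤ, r - n ∈ P := by
  have : Fact p.Prime := ⟨hp⟩
  have hcard : Nat.card (𝓞 K ⧸ P) = p := by
    rw [← hN, absNorm_apply, Submodule.cardQuot_apply]
  have : Finite (𝓞 K ⧸ P) := Nat.finite_of_card_ne_zero (by rw [hcard]; exact hp.ne_zero)
  have hinj : Function.Injective (fun x : Fin p ↦ (Ideal.Quotient.mk P ((x : ℕ) : 𝓞 K))) := by
    intro x y h
    rw [Ideal.Quotient.eq] at h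
    have h2 : (((x : ℕ) - (y : ℕ) : ℤ) : 𝓞 K) ∈ P := by push_cast; exact h
    rw [intCast_mem_iff_dvd hP] at h2
    have h3 := Int.eq_zero_of_abs_lt_dvd h2 (by rw [abs_lt]; omega)
    ext; omega
  have hsurj := ((Nat.bijective_iff_injective_and_card _).mpr ⟨hinj, by simp [hcard]⟩).2
  obtain ⟨x, hx⟩ := hsurj (Ideal.Quotient.mk P r)
  refine ⟨(x : ℕ), ?_⟩
  rw [← Ideal.Quotient.eq]
  simpa using hx.symm

section Squares

variable {p : ℕ} {P : Ideal (𝓞 K)} {m : ℤ} {r : 𝓞 K}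

theorem absNorm_ne_of_not_isSquare (hp : p.Prime)
    (hP : P ∈ primesOver (span {(p : ℤ)}) (𝓞 K)) (hr : r ^ 2 = m)
    (hm : ¬ IsSquare (m : ZMod p)) : absNorm P ≠ p := by
  intro hN
  obtain ⟨n, hn⟩ := exists_int_sub_mem hp hP hN r
  refine hm ⟨n, ?_⟩
  have h : ((m - n * n : ℤ) : 𝓞 K) ∈ P := by
    have := P.mul_mem_left (r + n) hn
    convert this using 1
    push_cast
    rw [← hr]; ring
  rw [intCast_mem_iff_dvd hP, ← ZMod.intCast_zmod_eq_zero_iff_dvd] at h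
  push_cast at h
  linear_combination h

theorem galois_smul_eq_of_isSquare (hp : p.Prime)
    (hP : P ∈ primesOver (span {(p : ℤ)}) (𝓞 K)) (hr : r ^ 2 = m)
    (hm : IsSquare (m : ZMod p)) (hpm : ¬ (p : ℤ) ∣ 2 * m) {σ : Gal(K/ℚ)} (hσ : σ • P = P) :
    σ • r = r := by
  have hP1 := hP.1
  obtain ⟨n, hn⟩ := hm
  obtain ⟨n, rfl⟩ := ZMod.intCast_surjective n
  have h1 : (p : ℤ) ∣ m - n * n := by
    rw [← ZMod.intCast_zmod_eq_zero_iff_dvd]; push_cast; rw [hn, sub_self]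
  have h2 : ∃ n' : ℤ, (p : ℤ) ∣ m - n' * n' ∧ r - n' ∈ P := by
    rw [← intCast_mem_iff_dvd hP] at h1
    have : (r - n) * (r + n) ∈ P := by
      convert h1 using 1
      push_cast
      rw [← hr]; ring
    rw [intCast_mem_iff_dvd hP] at h1
    rcases hP1.mem_or_mem this with h | h
    · exact ⟨n, h1, h⟩
    · exact ⟨-n, by simpa using h1, by simpa using h⟩
  obtain ⟨n', h1', h2⟩ := h2
  have h3 : σ • r - n' ∈ P := by
    have h : σ • (r - n') ∈ σ • P := smul_mem_pointwise_smul σ _ P h2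
    rw [hσ, smul_sub] at h
    convert h using 2
    exact (map_intCast (MulSemiringAction.toRingHom Gal(K/ℚ) (𝓞 K) σ) n').symm
  have h4 : (σ • r) ^ 2 = r ^ 2 := by
    rw [← smul_pow', hr]
    exact map_intCast (MulSemiringAction.toRingHom Gal(K/ℚ) (𝓞 K) σ) m
  rcases sq_eq_sq_iff_eq_or_eq_neg.mp h4 with h | h
  · exact h
  · exfalso
    rw [h] at h3
    have h5 : ((2 * n' : ℤ) : 𝓞 K) ∈ P := by
      convert P.neg_mem (P.add_mem h2 h3) using 1
      push_cast; ring
    rw [intCast_mem_iff_dvd hP] at h5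
    apply hpm
    have hp' : Prime (p : ℤ) := Nat.prime_iff_prime_int.mp hp
    rcases hp'.dvd_or_dvd h5 with h | h
    · exact h.mul_right m
    · have := dvd_add h1' (h.mul_right n')
      rw [sub_add_cancel] at this
      exact this.mul_left 2

theorem galois_smul_eq_of_two (hP : P ∈ primesOver (span {((2 : ℕ) : ℤ)}) (𝓞 K)) (hr : r ^ 2 = m)
    (hm : m % 8 = 1) {σ : Gal(K/ℚ)} (hσ : σ • P = P) : σ • r = r := by
  have hP1 := hP.1
  obtain ⟨k, rfl⟩ : ∃ k, m = 8 * k + 1 := ⟨m / 8, by omega⟩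
  obtain ⟨w, hw⟩ : ∃ w : 𝓞 K, 2 * w = 1 + r := by
    have hi : IsIntegral ℤ ((1 + r : K) / 2) := by
      refine ⟨Polynomial.X ^ 2 - Polynomial.X - Polynomial.C (2 * k), ?_, ?_⟩
      · monicity!
      · simp only [Polynomial.eval₂_sub, Polynomial.eval₂_pow, Polynomial.eval₂_X,
          Polynomial.eval₂_C]
        have : (r : K) ^ 2 = 8 * k + 1 := by
          have := congrArg (algebraMap (𝓞 K) K) hr
          rw [map_pow, map_intCast] at this
          push_cast at this
          exact this
        simp only [eq_intCast, Int.cast_mul, Int.cast_ofNat]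
        linear_combination this / 4
    obtain ⟨w, hw⟩ : ∃ w : 𝓞 K, algebraMap (𝓞 K) K w =
        (1 + algebraMap (𝓞 K) K r) / 2 := ⟨⟨_, hi⟩, rfl⟩
    refine ⟨w, ?_⟩
    apply RingOfIntegers.coe_injective
    rw [two_mul, map_add, map_add, map_one, hw]
    ring
  have hww : w * (w - 1) = 2 * k := by
    have h4 : (4 : 𝓞 K) ≠ 0 := by norm_num
    apply mul_left_cancel₀ h4
    push_cast at hr
    linear_combination (2 * w - 1 + r) * hw + hr
  have h4 : (σ • r) ^ 2 = r ^ 2 := by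
    rw [← smul_pow', hr]
    exact map_intCast (MulSemiringAction.toRingHom Gal(K/ℚ) (𝓞 K) σ) _
  rcases sq_eq_sq_iff_eq_or_eq_neg.mp h4 with h | h
  · exact h
  · exfalso
    have hσw : σ • w = 1 - w := by
      have := congrArg (fun x ↦ σ • x) hw
      simp only [smul_mul', smul_add, h, smul_one] at this
      have h22 : σ • (2 : 𝓞 K) = 2 :=
        map_ofNat (MulSemiringAction.toRingHom Gal(K/ℚ) (𝓞 K) σ) 2
      rw [h22] at this
      apply mul_left_cancel₀ (two_ne_zero (α := 𝓞 K))
      linear_combination this + hw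
    have h2 : (2 * k : 𝓞 K) ∈ P := by
      refine P.mul_mem_right _ ?_
      exact_mod_cast natCast_mem_of_mem_primesOver hP
    rw [← hww] at h2
    have h1 : (1 : 𝓞 K) ∈ P := by
      rcases hP1.mem_or_mem h2 with h | h
      · have h' : σ • w ∈ σ • P := smul_mem_pointwise_smul σ _ P h
        rw [hσ, hσw] at h'
        simpa using P.add_mem h h'
      · have h' : σ • (w - 1) ∈ σ • P := smul_mem_pointwise_smul σ _ P h
        rw [hσ, smul_sub, hσw, smul_one] at h'
        convert P.neg_mem (P.add_mem h h') using 1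
        ring
    exact hP1.ne_top ((eq_top_iff_one P).mpr h1)

omit [NumberField K] in
theorem natCast_mem_sq_of_dvd (hp : p.Prime) (hP : P ∈ primesOver (span {(p : ℤ)}) (𝓞 K))
    (hr : r ^ 2 = m) (hpm : (p : ℤ) ∣ m) (hpm2 : ¬ (p : ℤ) ^ 2 ∣ m) : (p : 𝓞 K) ∈ P ^ 2 := by
  have hP1 := hP.1
  have hrP : r ∈ P := by
    have : (m : 𝓞 K) ∈ P := (intCast_mem_iff_dvd hP m).mpr hpm
    rw [← hr] at this
    exact hP1.mem_of_pow_mem 2 this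
  have hmP : (m : 𝓞 K) ∈ P ^ 2 := hr ▸ pow_mem_pow hrP 2
  have hpP : (p : 𝓞 K) ^ 2 ∈ P ^ 2 := pow_mem_pow (natCast_mem_of_mem_primesOver hP) 2
  obtain ⟨m', rfl⟩ := hpm
  have hc : IsCoprime (p : ℤ) m' := by
    rw [(Nat.prime_iff_prime_int.mp hp).coprime_iff_not_dvd]
    rintro ⟨x, rfl⟩
    exact hpm2 ⟨x, by ring⟩
  obtain ⟨a, b, hab⟩ := hc
  have : (p : 𝓞 K) = a * (p : 𝓞 K) ^ 2 + b * ((p * m' : ℤ) : 𝓞 K) := by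
    have := congrArg (fun x : ℤ ↦ (x : 𝓞 K)) hab
    push_cast at this ⊢
    linear_combination -(p : 𝓞 K) * this
  rw [this]
  exact add_mem (mul_mem_left _ _ hpP) (mul_mem_left _ _ hmP)

omit [NumberField K] in
theorem two_mem_sq (hP : P ∈ primesOver (span {((2 : ℕ) : ℤ)}) (𝓞 K))
    (hr : r ^ 2 = m) (hm : m % 4 = 3) : (2 : 𝓞 K) ∈ P ^ 2 := by
  have hP1 := hP.1
  obtain ⟨k, rfl⟩ : ∃ k, m = 4 * k + 3 := ⟨m / 4, by omega⟩
  have h2 : (2 : 𝓞 K) ∈ P := by exact_mod_cast natCast_mem_of_mem_primesOver hP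
  push_cast at hr
  have h1 : 1 + r ∈ P := by
    refine hP1.mem_of_pow_mem 2 ?_
    rw [show (1 + r) ^ 2 = 2 * (2 * k + 2 + r) by linear_combination hr]
    exact P.mul_mem_right _ h2
  have h3 : (1 + r) ^ 2 ∈ P ^ 2 := pow_mem_pow h1 2
  have h4 : (2 : 𝓞 K) ^ 2 ∈ P ^ 2 := pow_mem_pow h2 2
  rw [show (2 : 𝓞 K) = (2 * k + 2) * 2 ^ 2 - r * (1 + r) ^ 2 + r * (k + 1) * 2 ^ 2 by
    linear_combination (2 + r) * hr]
  exact add_mem (sub_mem (mul_mem_left _ _ h4) (mul_mem_left _ _ h3)) (mul_mem_left _ _ h4)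

end Squares

end Splitting

section Splitting

open Ideal
open scoped Pointwise

variable {K : Type*} [Field K] [NumberField K]

omit [NumberField K] in
theorem galois_eq_one_of_adjoin_eq_top [CharZero K] {S : Set K} (hS : adjoin ℚ S = ⊤) (σ : Gal(K/ℚ))
    (h : ∀ x ∈ S, σ x = x) : σ = 1 := by
  have hle : adjoin ℚ S ≤ fixedField (Subgroup.zpowers σ) := by
    rw [adjoin_le_iff]
    intro x hx
    rw [SetLike.mem_coe, mem_fixedField_iff]
    intro τ hτ
    have : Subgroup.zpowers σ ≤ MulAction.stabilizer Gal(K/ℚ) x := by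
      rw [Subgroup.zpowers_le]; exact h x hx
    exact this hτ
  ext x
  have hx : x ∈ fixedField (Subgroup.zpowers σ) := hle (hS ▸ mem_top)
  rw [mem_fixedField_iff] at hx
  exact hx σ (Subgroup.mem_zpowers σ)

/-- `K = ℚ(x)` with `x² = m` and `m` not a square. -/
structure IsQuadraticGenerator (x : K) (m : ℤ) : Prop where
  sq_eq : x ^ 2 = m
  adjoin_eq : ℚ⟮x⟯ = ⊤
  not_isSquare : ¬ IsSquare m

namespace IsQuadraticGenerator

variable {x : K} {m : ℤ} (h : IsQuadraticGenerator x m)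

include h

theorem isIntegral : IsIntegral ℤ x :=
  .of_pow two_pos (h.sq_eq ▸ isIntegral_algebraMap (R := ℤ) (x := m))

theorem minpoly_eq : minpoly ℚ x = Polynomial.X ^ 2 - Polynomial.C (m : ℚ) := by
  refine (minpoly.eq_of_irreducible_of_monic ?_ ?_ (by monicity!)).symm
  · refine X_pow_sub_C_irreducible_of_prime Nat.prime_two fun b hb ↦ ?_
    exact h.not_isSquare (Rat.isSquare_intCast_iff.mp ⟨b, by rw [← hb, sq]⟩)
  · simp [h.sq_eq]

theorem finrank_eq : Module.finrank ℚ K = 2 := by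
  rw [← finrank_top', ← h.adjoin_eq, adjoin.finrank (h.isIntegral.tower_top), h.minpoly_eq]
  exact Polynomial.natDegree_X_pow_sub_C

theorem isGalois : IsGalois ℚ K := by
  have : Algebra.IsQuadraticExtension ℚ K := ⟨h.finrank_eq⟩
  infer_instance

theorem exists_integer : ∃ r : 𝓞 K, (r : K) = x ∧ r ^ 2 = m := by
  obtain ⟨r, hr⟩ : ∃ r : 𝓞 K, algebraMap (𝓞 K) K r = x := ⟨⟨x, h.isIntegral⟩, rfl⟩
  refine ⟨r, hr, ?_⟩
  apply RingOfIntegers.coe_injective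
  rw [map_pow, map_intCast, hr]
  exact h.sq_eq

theorem splitsAs_of_stabilizer {p : ℕ} (hp : p.Prime)
    (hfix : ∀ r : 𝓞 K, r ^ 2 = m → ∀ P ∈ primesOver (span {(p : ℤ)}) (𝓞 K), ∀ σ : Gal(K/ℚ),
      σ • P = P → σ • r = r) : SplitsAs K p 1 2 := by
  have := h.isGalois
  obtain ⟨P, hP, e, f, g, hs, hef, hgef, -⟩ := exists_splitsAs (K := K) hp
  obtain ⟨r, hr, hr2⟩ := h.exists_integer
  have : MulAction.stabilizer Gal(K/ℚ) P = ⊥ := by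
    rw [Subgroup.eq_bot_iff_forall]
    intro σ hσ
    refine galois_eq_one_of_adjoin_eq_top h.adjoin_eq σ ?_
    rintro _ rfl
    rw [← hr]
    exact congrArg (fun y : 𝓞 K ↦ (y : K)) (hfix r hr2 P hP σ hσ)
  rw [this, Subgroup.card_bot] at hef
  rw [hef, h.finrank_eq] at hgef
  obtain rfl : g = 2 := by omega
  obtain rfl : f = 1 := Nat.eq_one_of_mul_eq_one_left hef
  exact hs

theorem splitsAs_of_isSquare {p : ℕ} (hp : p.Prime) (hm : IsSquare (m : ZMod p))
    (hpm : ¬ (p : ℤ) ∣ 2 * m) : SplitsAs K p 1 2 :=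
  h.splitsAs_of_stabilizer hp fun _ hr _ hP _ hσ ↦ galois_smul_eq_of_isSquare hp hP hr hm hpm hσ

theorem splitsAs_two (hm : m % 8 = 1) : SplitsAs K 2 1 2 :=
  h.splitsAs_of_stabilizer Nat.prime_two fun _ hr _ hP _ hσ ↦ galois_smul_eq_of_two hP hr hm hσ

theorem splitsAs_of_not_isSquare {p : ℕ} (hp : p.Prime) (hm : ¬ IsSquare (m : ZMod p)) :
    SplitsAs K p 2 1 := by
  have := h.isGalois
  obtain ⟨P, hP, e, f, g, hs, hef, hgef, -⟩ := exists_splitsAs (K := K) hp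
  obtain ⟨r, hr, hr2⟩ := h.exists_integer
  have hf : f ≠ 1 := by
    rintro rfl
    exact absNorm_ne_of_not_isSquare hp hP hr2 hm (by rw [hs.2 P hP, pow_one])
  rw [h.finrank_eq] at hgef
  have hf2 : f ∣ 2 := ⟨g * e, by rw [← hgef]; ring⟩
  obtain rfl : f = 2 := ((Nat.dvd_prime Nat.prime_two).mp hf2).resolve_left hf
  have : g * e = 1 := by nlinarith
  obtain rfl : g = 1 := Nat.eq_one_of_mul_eq_one_right this
  exact hs

theorem splitsAs_of_mem_sq {p : ℕ} (hp : p.Prime)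
    (hr : ∀ r : 𝓞 K, r ^ 2 = m → ∀ P ∈ primesOver (span {(p : ℤ)}) (𝓞 K), (p : 𝓞 K) ∈ P ^ 2) :
    SplitsAs K p 1 1 := by
  have := h.isGalois
  obtain ⟨P, hP, e, f, g, hs, hef, hgef, hk⟩ := exists_splitsAs (K := K) hp
  obtain ⟨r, -, hr2⟩ := h.exists_integer
  have h2 := hk 2 (hr r hr2 P hP)
  rw [h.finrank_eq] at hgef
  have hgf : e * (g * f) = 2 := by rw [← hgef]; ring
  have : e ≤ 2 := Nat.le_of_dvd two_pos ⟨_, hgf.symm⟩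
  obtain rfl : e = 2 := by omega
  have : g * f = 1 := by omega
  obtain rfl : g = 1 := Nat.eq_one_of_mul_eq_one_right this
  obtain rfl : f = 1 := by omega
  exact hs

theorem splitsAs_of_dvd {p : ℕ} (hp : p.Prime) (hpm : (p : ℤ) ∣ m) (hpm2 : ¬ (p : ℤ) ^ 2 ∣ m) :
    SplitsAs K p 1 1 :=
  h.splitsAs_of_mem_sq hp fun _ hr _ hP ↦ natCast_mem_sq_of_dvd hp hP hr hpm hpm2

theorem splitsAs_two_of_mod_four (hm : m % 4 = 3) : SplitsAs K 2 1 1 :=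
  h.splitsAs_of_mem_sq Nat.prime_two fun _ hr _ hP ↦ by simpa using two_mem_sq hP hr hm

end IsQuadraticGenerator

end Splitting

section Quadratic

variable {K : Type*} [Field K] [NumberField K]

namespace IsQuadraticGenerator

variable {x : K} {m : ℤ} (h : IsQuadraticGenerator x m)

include h

theorem exists_conj : ∃ σ : Gal(K/ℚ), σ x = -x ∧ ∀ τ : Gal(K/ℚ), τ = 1 ∨ τ = σ := by
  have := h.isGalois
  have hsq (τ : Gal(K/ℚ)) : τ x = x ∨ τ x = -x := by
    rw [← sq_eq_sq_iff_eq_or_eq_neg, ← map_pow, h.sq_eq, map_intCast]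
  have hone (τ : Gal(K/ℚ)) (hτ : τ x = x) : τ = 1 :=
    galois_eq_one_of_adjoin_eq_top h.adjoin_eq τ (by rintro _ rfl; exact hτ)
  have hcard : Nat.card Gal(K/ℚ) = 2 := by rw [IsGalois.card_aut_eq_finrank, h.finrank_eq]
  have : Nontrivial Gal(K/ℚ) := Finite.one_lt_card_iff_nontrivial.mp (by omega)
  obtain ⟨σ, hσ⟩ := exists_ne (1 : Gal(K/ℚ))
  have hσx := (hsq σ).resolve_left fun h ↦ hσ (hone σ h)
  refine ⟨σ, hσx, fun τ ↦ ?_⟩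
  by_cases hτ : τ = 1
  · exact .inl hτ
  · right
    have hτx := (hsq τ).resolve_left fun h ↦ hτ (hone τ h)
    have : τ⁻¹ * σ = 1 := hone _ (by
      rw [AlgEquiv.mul_apply, hσx, map_neg, AlgEquiv.aut_inv, neg_eq_iff_eq_neg,
        AlgEquiv.symm_apply_eq, map_neg, hτx, neg_neg])
    exact (inv_mul_eq_one.mp this)

theorem exists_rat (y : K) : ∃ a b : ℚ, y = a + b * x := by
  have hli : LinearIndependent ℚ ![(1 : K), x] := by
    rw [LinearIndependent.pair_iff]
    intro a b hab
    have hb : b = 0 := by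
      by_contra hb
      apply h.not_isSquare
      rw [← Rat.isSquare_intCast_iff]
      refine ⟨-a / b, ?_⟩
      have hx : x = ((-a / b : ℚ) : K) := by
        push_cast
        rw [eq_div_iff (by exact_mod_cast hb)]
        rw [Rat.smul_def, Rat.smul_def] at hab
        linear_combination hab
      have := h.sq_eq
      rw [hx] at this
      have h2 : (((-a / b) ^ 2 : ℚ) : K) = ((m : ℚ) : K) := by
        push_cast at this ⊢
        exact this
      rw [← sq]
      exact (Rat.cast_injective h2).symm
    subst hb
    simpa using hab
  have hspan := hli.span_eq_top_of_card_eq_finrank' (by simp [h.finrank_eq])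
  have hy : y ∈ Submodule.span ℚ (Set.range ![(1 : K), x]) := hspan ▸ Submodule.mem_top
  rw [Matrix.range_cons_cons_empty, Submodule.mem_span_pair] at hy
  obtain ⟨a, b, rfl⟩ := hy
  exact ⟨a, b, by simp [Rat.smul_def]⟩

theorem trace_gen : Algebra.trace ℚ K x = 0 := by
  obtain ⟨σ, hσ, -⟩ := h.exists_conj
  have := Algebra.trace_eq_of_algEquiv σ x
  rw [hσ, map_neg] at this
  linarith

theorem trace_apply (a b : ℚ) : Algebra.trace ℚ K (a + b * x) = 2 * a := by
  have h1 : (a : K) + b * x = algebraMap ℚ K a + b • x := by simp [Rat.smul_def]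
  rw [h1, map_add, map_smul, h.trace_gen, Algebra.trace_algebraMap, h.finrank_eq]
  simp

theorem norm_apply (a b : ℚ) : Algebra.norm ℚ (a + b * x) = a ^ 2 - m * b ^ 2 := by
  classical
  have := h.isGalois
  obtain ⟨σ, hσ, hall⟩ := h.exists_conj
  have hσ1 : (1 : Gal(K/ℚ)) ≠ σ := by
    rintro rfl
    have hx : x = 0 := by
      rw [AlgEquiv.one_apply] at hσ
      exact self_eq_neg.mp hσ
    have := h.sq_eq
    rw [hx] at this
    apply h.not_isSquare
    have hm : m = 0 := by exact_mod_cast (by simpa using this.symm : (m : K) = 0)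
    exact ⟨0, by simp [hm]⟩
  have huniv : (Finset.univ : Finset Gal(K/ℚ)) = {1, σ} := by
    ext τ; simpa using hall τ
  apply (algebraMap ℚ K).injective
  rw [Algebra.norm_eq_prod_automorphisms, huniv, Finset.prod_pair hσ1]
  simp only [AlgEquiv.one_apply, map_add, map_mul, map_ratCast, hσ, eq_ratCast]
  push_cast
  linear_combination - (b : K) ^ 2 * h.sq_eq

theorem exists_int_of_isIntegral (hm : Squarefree m) {y : K} (hy : IsIntegral ℤ y) :
    ∃ A B : ℤ, 2 * y = A + B * x ∧ (4 : ℤ) ∣ A ^ 2 - m * B ^ 2 := by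
  obtain ⟨a, b, rfl⟩ := h.exists_rat y
  have ht := Algebra.isIntegral_trace (L := ℚ) hy
  have hn := Algebra.isIntegral_norm (R := ℤ) ℚ hy
  rw [h.trace_apply, IsIntegrallyClosed.isIntegral_iff] at ht
  rw [h.norm_apply, IsIntegrallyClosed.isIntegral_iff] at hn
  obtain ⟨A, hA⟩ := ht
  obtain ⟨N, hN⟩ := hn
  simp only [eq_intCast] at hA hN
  have hB : ∃ B : ℤ, (B : ℚ) = 2 * b := by
    have h1 : (m : ℚ) * (2 * b) ^ 2 = ((A ^ 2 - 4 * N : ℤ) : ℚ) := by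
      push_cast
      rw [hA, hN]; ring
    have h2 : IsIntegral ℤ ((m : ℚ) * (2 * b)) := by
      refine .of_pow two_pos ?_
      rw [mul_pow, sq (m : ℚ), mul_assoc, h1]
      have := isIntegral_algebraMap (R := ℤ) (A := ℚ) (x := m * (A ^ 2 - 4 * N))
      rwa [eq_intCast, Int.cast_mul] at this
    obtain ⟨C, hC⟩ := IsIntegrallyClosed.isIntegral_iff.mp h2
    rw [eq_intCast] at hC
    have hC2 : C ^ 2 = m * (A ^ 2 - 4 * N) := by
      have : ((C ^ 2 : ℤ) : ℚ) = ((m * (A ^ 2 - 4 * N) : ℤ) : ℚ) := by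
        rw [Int.cast_mul, ← h1]; push_cast; rw [hC]; ring
      exact_mod_cast this
    obtain ⟨B, rfl⟩ := (hm.dvd_pow_iff_dvd two_ne_zero).mp (Dvd.intro _ hC2.symm)
    refine ⟨B, mul_left_cancel₀ (Int.cast_ne_zero.mpr hm.ne_zero : (m : ℚ) ≠ 0) ?_⟩
    rw [← hC]; push_cast; ring
  obtain ⟨B, hB⟩ := hB
  refine ⟨A, B, ?_, N, ?_⟩
  · have hA' : ((A : ℚ) : K) = ((2 * a : ℚ) : K) := by rw [hA]
    have hB' : ((B : ℚ) : K) = ((2 * b : ℚ) : K) := by rw [hB]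
    push_cast at hA' hB'
    rw [hA', hB']; ring
  · have : ((A ^ 2 - m * B ^ 2 : ℤ) : ℚ) = ((4 * N : ℤ) : ℚ) := by
      push_cast
      rw [hA, hB, hN]; ring
    exact_mod_cast this

end IsQuadraticGenerator

theorem discr_eq_of_forall_exists_int (hK : Module.finrank ℚ K = 2) (w : 𝓞 K)
    (hw : ∀ y : 𝓞 K, ∃ a b : ℤ, y = a + b * w) :
    (discr K : ℚ) = 2 * Algebra.trace ℚ K ((w : K) ^ 2) - Algebra.trace ℚ K (w : K) ^ 2 := by
  have hspan : ⊤ ≤ Submodule.span ℤ (Set.range ![(1 : 𝓞 K), w]) := by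
    intro y _
    obtain ⟨a, b, rfl⟩ := hw y
    rw [Matrix.range_cons_cons_empty, Submodule.mem_span_pair]
    exact ⟨a, b, by simp⟩
  have hli := linearIndependent_of_top_le_span_of_card_eq_finrank hspan
    (by rw [RingOfIntegers.rank, hK]; simp)
  have := discr_eq_discr K (Module.Basis.mk hli hspan)
  rw [← this, Module.Basis.coe_mk, Algebra.discr_def, Matrix.det_fin_two]
  simp only [Algebra.traceMatrix_apply, Algebra.traceForm_apply, Matrix.cons_val_zero,
    Matrix.cons_val_one, mul_one, one_mul]
  push_cast
  have h1 : ((Algebra.trace ℤ (𝓞 K) 1 : ℤ) : ℚ) = 2 := by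
    have := Algebra.trace_algebraMap (R := ℤ) (S := 𝓞 K) 1
    rw [map_one, RingOfIntegers.rank, hK] at this
    rw [this]; simp
  rw [h1, Algebra.coe_trace_int, Algebra.coe_trace_int, sq (w : K),
    sq (Algebra.trace ℚ K (w : K))]
  rfl

namespace IsQuadraticGenerator

variable {x : K} {m : ℤ} (h : IsQuadraticGenerator x m)

include h

theorem discr_of_mod_four_ne_one (hm : Squarefree m) (h4 : m % 4 ≠ 1) : discr K = 4 * m := by
  obtain ⟨w, hwx, hw2⟩ := h.exists_integer
  have hwx' : algebraMap (𝓞 K) K w = x := hwx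
  have key := discr_eq_of_forall_exists_int h.finrank_eq w fun y ↦ by
    obtain ⟨A, B, hy, h4d⟩ := h.exists_int_of_isIntegral hm (RingOfIntegers.isIntegral_coe y)
    have h4m : m % 4 = 2 ∨ m % 4 = 3 := by
      have : ¬ (4 : ℤ) ∣ m := fun hd ↦ by
        have := hm 2 (by simpa using hd)
        norm_num [Int.isUnit_iff] at this
      omega
    have hAB : A % 2 = 0 ∧ B % 2 = 0 := by
      have e1 : (A ^ 2 - m * B ^ 2) % 4 = 0 := by omega
      have hA : A % 4 = 0 ∨ A % 4 = 1 ∨ A % 4 = 2 ∨ A % 4 = 3 := by omega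
      have hB : B % 4 = 0 ∨ B % 4 = 1 ∨ B % 4 = 2 ∨ B % 4 = 3 := by omega
      rcases h4m with h | h <;> rcases hA with hA | hA | hA | hA <;>
        rcases hB with hB | hB | hB | hB <;>
        simp [Int.sub_emod, Int.mul_emod, pow_two, h, hA, hB] at e1 <;> omega
    obtain ⟨a, rfl⟩ : ∃ a, A = 2 * a := ⟨A / 2, by omega⟩
    obtain ⟨b, rfl⟩ : ∃ b, B = 2 * b := ⟨B / 2, by omega⟩
    refine ⟨a, b, RingOfIntegers.coe_injective ?_⟩
    rw [map_add, map_mul, map_intCast, map_intCast, hwx']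
    apply mul_left_cancel₀ (two_ne_zero (α := K))
    push_cast at hy
    rw [hy]; ring
  rw [hwx, h.sq_eq, h.trace_gen] at key
  have h1 := h.trace_apply m 0
  simp only [Rat.cast_intCast, Rat.cast_zero, zero_mul, add_zero] at h1
  rw [h1] at key
  have : (discr K : ℚ) = ((4 * m : ℤ) : ℚ) := by rw [key]; push_cast; ring
  exact_mod_cast this

theorem discr_of_mod_four_eq_one (hm : Squarefree m) (h4 : m % 4 = 1) : discr K = m := by
  obtain ⟨k, hk⟩ : ∃ k, m = 4 * k + 1 := ⟨m / 4, by omega⟩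
  have hx2 := h.sq_eq
  have hmK : (m : K) = 4 * k + 1 := by rw [hk]; push_cast; ring
  obtain ⟨w, hwx⟩ : ∃ w : 𝓞 K, algebraMap (𝓞 K) K w = (1 + x) / 2 := by
    refine ⟨⟨(1 + x) / 2, Polynomial.X ^ 2 - Polynomial.X - Polynomial.C k, by monicity!, ?_⟩, rfl⟩
    rw [Polynomial.eval₂_sub, Polynomial.eval₂_sub, Polynomial.eval₂_pow, Polynomial.eval₂_X,
      Polynomial.eval₂_C, eq_intCast]
    linear_combination (hx2 + hmK) / 4
  have key := discr_eq_of_forall_exists_int h.finrank_eq w fun y ↦ by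
    obtain ⟨A, B, hy, h4d⟩ := h.exists_int_of_isIntegral hm (RingOfIntegers.isIntegral_coe y)
    have hAB : A % 2 = B % 2 := by
      have e1 : (A ^ 2 - m * B ^ 2) % 2 = 0 := by omega
      have hm2 : m % 2 = 1 := by omega
      rcases Int.emod_two_eq_zero_or_one A with hA | hA <;>
        rcases Int.emod_two_eq_zero_or_one B with hB | hB <;>
        simp [Int.sub_emod, Int.mul_emod, pow_two, hm2, hA, hB] at e1 <;> omega
    obtain ⟨a, rfl⟩ : ∃ a, A = 2 * a + B := ⟨(A - B) / 2, by omega⟩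
    refine ⟨a, B, RingOfIntegers.coe_injective ?_⟩
    rw [map_add, map_mul, map_intCast, map_intCast, hwx]
    apply mul_left_cancel₀ (two_ne_zero (α := K))
    push_cast at hy
    rw [hy]; ring
  have e1 : (w : K) = ((1 / 2 : ℚ) : K) + ((1 / 2 : ℚ) : K) * x := by
    rw [show (w : K) = (1 + x) / 2 from hwx]; push_cast; ring
  have e2 : (w : K) ^ 2 = (((1 + m) / 4 : ℚ) : K) + ((1 / 2 : ℚ) : K) * x := by
    rw [show (w : K) = (1 + x) / 2 from hwx]; push_cast
    linear_combination hx2 / 4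
  rw [e2, e1, h.trace_apply, h.trace_apply] at key
  have : (discr K : ℚ) = (m : ℚ) := by rw [key]; ring
  exact_mod_cast this

end IsQuadraticGenerator

end Quadratic

theorem isQuadraticGenerator_adjoinSimple {L : Type*} [Field L] [CharZero L] {x : L} {m : ℤ}
    [NumberField ℚ⟮x⟯]
    (hx : x ^ 2 = m) (hm : ¬ IsSquare m) : IsQuadraticGenerator (AdjoinSimple.gen ℚ x) m where
  sq_eq := Subtype.ext (by simpa using hx)
  adjoin_eq := by
    have key : @adjoin ℚ _ ℚ⟮x⟯ _ (IntermediateField.algebra' _) {AdjoinSimple.gen ℚ x} = ⊤ := by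
      apply IntermediateField.lift_injective
      rw [lift_adjoin_simple, AdjoinSimple.coe_gen, lift_top]
    convert key <;> exact Subsingleton.elim _ _
  not_isSquare := hm

/-- `r, s, t` generate `K` and are square roots of `2`, `d`, `-1`, where `d ≡ 1 (mod 8)` is
squarefree and not a square. -/
structure IsTriquadraticGenerator {K : Type*} [Field K] [NumberField K] (r s t : K) (d : ℤ) :
    Prop where
  r_sq : r ^ 2 = 2
  s_sq : s ^ 2 = d
  t_sq : t ^ 2 = -1
  adjoin_eq : adjoin ℚ {r, s, t} = ⊤
  squarefree : Squarefree d
  mod_eight : d % 8 = 1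
  not_isSquare : ¬ IsSquare d

namespace IsTriquadraticGenerator

variable {K : Type*} [Field K] [NumberField K] {r s t : K} {d : ℤ}
  (h : IsTriquadraticGenerator r s t d)

include h

theorem r_ne_zero : r ≠ 0 := by
  rintro rfl
  simpa using h.r_sq

theorem isPrimitiveRoot : IsPrimitiveRoot ((1 + t) / r) 8 := by
  have h4 : ((1 + t) / r) ^ 4 = -1 := by
    have hr4 : r ^ 4 = 4 := by linear_combination (r ^ 2 + 2) * h.r_sq
    rw [div_pow, hr4, div_eq_iff (by norm_num)]
    linear_combination (t ^ 2 + 4 * t + 5) * h.t_sq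
  have := orderOf_eq_prime_pow (x := (1 + t) / r) (n := 2) (p := 2)
    (by norm_num [h4])
    (by
      norm_num
      linear_combination ((((1 + t) / r) ^ 4) - 1) * h4)
  exact IsPrimitiveRoot.iff_orderOf.mpr (by simpa using this)

theorem sup_eq_top : ℚ⟮(1 + t) / r⟯ ⊔ ℚ⟮s⟯ = ⊤ := by
  rw [← top_le_iff, ← h.adjoin_eq, adjoin_le_iff]
  have hz : (1 + t) / r ∈ ℚ⟮(1 + t) / r⟯ ⊔ ℚ⟮s⟯ := le_sup_left (α := IntermediateField ℚ K)
    (mem_adjoin_simple_self ℚ _)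
  have hs : s ∈ ℚ⟮(1 + t) / r⟯ ⊔ ℚ⟮s⟯ := le_sup_right (α := IntermediateField ℚ K)
    (mem_adjoin_simple_self ℚ _)
  have hr0 := h.r_ne_zero
  have ht : t ∈ ℚ⟮(1 + t) / r⟯ ⊔ ℚ⟮s⟯ := by
    have e : ((1 + t) / r) ^ 2 = t := by
      rw [div_pow, h.r_sq]
      linear_combination h.t_sq / 2
    have := pow_mem hz 2
    rwa [e] at this
  have hr : r ∈ ℚ⟮(1 + t) / r⟯ ⊔ ℚ⟮s⟯ := by
    have e : ((1 + t) / r) * (1 - t) = r := by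
      field_simp
      linear_combination -h.r_sq - h.t_sq
    have := mul_mem hz (sub_mem (one_mem _) ht)
    rwa [e] at this
  rintro x (rfl | rfl | rfl) <;> assumption

theorem isQuadraticGenerator : IsQuadraticGenerator (AdjoinSimple.gen ℚ s) d :=
  isQuadraticGenerator_adjoinSimple h.s_sq h.not_isSquare

theorem isGalois_finrank_discr :
    IsGalois ℚ K ∧ Module.finrank ℚ K = 8 ∧ (discr K).natAbs = 2 ^ 16 * d.natAbs ^ 4 := by
  have hcyc : IsCyclotomicExtension {8} ℚ ℚ⟮(1 + t) / r⟯ :=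
    h.isPrimitiveRoot.intermediateField_adjoin_isCyclotomicExtension ℚ
  have hq := h.isQuadraticGenerator
  have hG1 : IsGalois ℚ ℚ⟮(1 + t) / r⟯ := IsCyclotomicExtension.isGalois {8} ℚ _
  have hG2 : IsGalois ℚ ℚ⟮s⟯ := hq.isGalois
  have hd1 : discr ℚ⟮(1 + t) / r⟯ = 256 := by
    have : IsCyclotomicExtension {2 ^ 3} ℚ ℚ⟮(1 + t) / r⟯ := hcyc
    rw [IsCyclotomicExtension.Rat.discr_prime_pow 2 3,
      Nat.totient_prime_pow Nat.prime_two three_pos]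
    norm_num
  have hf1 : Module.finrank ℚ ℚ⟮(1 + t) / r⟯ = 4 := by
    rw [IsCyclotomicExtension.Rat.finrank 8]
    decide
  have hd2 : discr ℚ⟮s⟯ = d :=
    hq.discr_of_mod_four_eq_one h.squarefree (by have := h.mod_eight; omega)
  have hcop : IsCoprime (discr ℚ⟮(1 + t) / r⟯) (discr ℚ⟮s⟯) := by
    rw [hd1, hd2, show (256 : ℤ) = 2 ^ 8 by norm_num]
    refine IsCoprime.pow_left ⟨-(d / 2), 1, ?_⟩
    have := h.mod_eight
    omega
  have hdis := linearDisjoint_of_isGalois_isCoprime_discr _ _ _ hcop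
  refine ⟨?_, ?_, ?_⟩
  · have hG1' : @IsGalois ℚ _ ℚ⟮(1 + t) / r⟯ _ (IntermediateField.algebra' _) := by
      convert hG1 using 1
      exact Subsingleton.elim _ _
    have hG2' : @IsGalois ℚ _ ℚ⟮s⟯ _ (IntermediateField.algebra' _) := by
      convert hG2 using 1
      exact Subsingleton.elim _ _
    have hN : @IsGalois ℚ _ ↥(ℚ⟮(1 + t) / r⟯ ⊔ ℚ⟮s⟯) _ (IntermediateField.algebra' _) :=
      @IsGalois.mk ℚ _ _ _ _ _ (normal_sup _ _ _ _)
    exact IsGalois.of_algEquiv ((equivOfEq h.sup_eq_top).trans topEquiv)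
  · rw [← finrank_top', ← h.sup_eq_top, hdis.finrank_sup, hf1, hq.finrank_eq]
  · rw [natAbs_discr_eq_natAbs_discr_pow_mul_natAbs_discr_pow K _ _ hdis h.sup_eq_top
      (isCoprime_differentIdeal_of_isCoprime_discr _ hcop), hf1, hq.finrank_eq, hd1, hd2]
    norm_num

theorem galois_apply_r (σ : Gal(K/ℚ)) : σ r = r ∨ σ r = -r := by
  rw [← sq_eq_sq_iff_eq_or_eq_neg, ← map_pow, h.r_sq, map_ofNat]

theorem galois_apply_s (σ : Gal(K/ℚ)) : σ s = s ∨ σ s = -s := by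
  rw [← sq_eq_sq_iff_eq_or_eq_neg, ← map_pow, h.s_sq, map_intCast]

theorem galois_apply_t (σ : Gal(K/ℚ)) : σ t = t ∨ σ t = -t := by
  rw [← sq_eq_sq_iff_eq_or_eq_neg, ← map_pow, h.t_sq, map_neg, map_one]

theorem galois_ext {σ τ : Gal(K/ℚ)} (hr : σ r = τ r) (hs : σ s = τ s) (ht : σ t = τ t) :
    σ = τ := by
  have : τ⁻¹ * σ = 1 := galois_eq_one_of_adjoin_eq_top h.adjoin_eq _ (by
    rintro x (rfl | rfl | rfl) <;>
    simp [AlgEquiv.aut_inv, hr, hs, ht])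
  exact (inv_mul_eq_one.mp this).symm

theorem s_ne_zero : s ≠ 0 := by
  rintro rfl
  have := h.s_sq
  apply h.squarefree.ne_zero
  exact_mod_cast (by simpa using this.symm : (d : K) = 0)

theorem t_ne_zero : t ≠ 0 := by
  rintro rfl
  simpa using h.t_sq

open Classical in
theorem exists_galois (a b c : Bool) : ∃ σ : Gal(K/ℚ), σ r = (if a then r else -r) ∧
    σ s = (if b then s else -s) ∧ σ t = (if c then t else -t) := by
  obtain ⟨hG, hf, -⟩ := h.isGalois_finrank_discr
  let φ : Gal(K/ℚ) → Bool × Bool × Bool := fun σ ↦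
    (decide (σ r = r), decide (σ s = s), decide (σ t = t))
  have hinj : Function.Injective φ := fun σ τ hστ ↦ by
    simp only [φ, Prod.mk.injEq, decide_eq_decide] at hστ
    obtain ⟨h1, h2, h3⟩ := hστ
    refine h.galois_ext ?_ ?_ ?_
    · grind [h.galois_apply_r σ, h.galois_apply_r τ]
    · grind [h.galois_apply_s σ, h.galois_apply_s τ]
    · grind [h.galois_apply_t σ, h.galois_apply_t τ]
  have hbij : Function.Bijective φ := by
    rw [Nat.bijective_iff_injective_and_card]
    refine ⟨hinj, ?_⟩
    rw [IsGalois.card_aut_eq_finrank, hf]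
    simp
  obtain ⟨σ, hσ⟩ := hbij.2 (a, b, c)
  simp only [φ, Prod.mk.injEq] at hσ
  obtain ⟨rfl, rfl, rfl⟩ := hσ
  refine ⟨σ, ?_, ?_, ?_⟩
  · rcases h.galois_apply_r σ with h1 | h1 <;> simp [h1, h.r_ne_zero, neg_eq_self]
  · rcases h.galois_apply_s σ with h1 | h1 <;> simp [h1, h.s_ne_zero, neg_eq_self]
  · rcases h.galois_apply_t σ with h1 | h1 <;> simp [h1, h.t_ne_zero, neg_eq_self]

end IsTriquadraticGenerator

section TriquadraticSplitting

open Ideal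
open scoped Pointwise

theorem isSquare_mul_iff_of_ne_zero {F : Type*} [Field F] [Fintype F] {a b : F}
    (ha : a ≠ 0) (hb : b ≠ 0) : IsSquare (a * b) ↔ (IsSquare a ↔ IsSquare b) := by
  classical
  rcases eq_or_ne (ringChar F) 2 with h2 | h2
  · simp [FiniteField.isSquare_of_char_two h2]
  rw [← quadraticChar_one_iff_isSquare ha, ← quadraticChar_one_iff_isSquare hb,
    ← quadraticChar_one_iff_isSquare (mul_ne_zero ha hb), map_mul]
  rcases quadraticChar_dichotomy ha with h | h <;>
    rcases quadraticChar_dichotomy hb with h' | h' <;>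
    simp [h, h']

theorem galois_smul_eq_smul_of_not_isSquare {K : Type*} [Field K] [NumberField K] {p : ℕ}
    (hp : p.Prime) {P : Ideal (𝓞 K)} (hP : P ∈ primesOver (span {(p : ℤ)}) (𝓞 K)) {x y : 𝓞 K}
    {m n : ℤ} (hx : x ^ 2 = m) (hy : y ^ 2 = n) (hpmn : ¬ (p : ℤ) ∣ 2 * (m * n))
    (hm : ¬ IsSquare (m : ZMod p)) {σ τ : Gal(K/ℚ)} (hσ : σ • P = P) (hτ : τ • P = P)
    (h : σ • x = τ • x) : σ • y = τ • y := by
  have : Fact p.Prime := ⟨hp⟩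
  by_cases hn : IsSquare (n : ZMod p)
  · have hn2 : ¬ (p : ℤ) ∣ 2 * n := fun hd ↦ hpmn (by
      rw [mul_left_comm]; exact hd.mul_left m)
    rw [galois_smul_eq_of_isSquare hp hP hy hn hn2 hσ,
      galois_smul_eq_of_isSquare hp hP hy hn hn2 hτ]
  · have hm0 : (m : ZMod p) ≠ 0 := fun h0 ↦ hm (by simp [h0])
    have hn0 : (n : ZMod p) ≠ 0 := fun h0 ↦ hn (by simp [h0])
    have hmn : IsSquare ((m * n : ℤ) : ZMod p) := by
      rw [Int.cast_mul, isSquare_mul_iff_of_ne_zero hm0 hn0]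
      tauto
    have hxy : (x * y) ^ 2 = ((m * n : ℤ) : 𝓞 K) := by rw [mul_pow, hx, hy]; push_cast; rfl
    have h1 := galois_smul_eq_of_isSquare hp hP hxy hmn hpmn hσ
    have h2 := galois_smul_eq_of_isSquare hp hP hxy hmn hpmn hτ
    rw [smul_mul'] at h1 h2
    rw [← h2, h] at h1
    have hx0 : τ • x ≠ 0 := by
      intro h0
      rw [smul_eq_zero_iff_eq] at h0
      rw [h0] at hx
      apply hm0
      have : m = 0 := by exact_mod_cast (by simpa using hx.symm : (m : 𝓞 K) = 0)
      simp [this]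
    exact mul_left_cancel₀ hx0 h1

namespace IsTriquadraticGenerator

variable {K : Type*} [Field K] [NumberField K] {r s t : K} {d : ℤ}
  (h : IsTriquadraticGenerator r s t d)

include h

theorem exists_integers : ∃ R S T : 𝓞 K, algebraMap (𝓞 K) K R = r ∧ algebraMap (𝓞 K) K S = s ∧
    algebraMap (𝓞 K) K T = t ∧ R ^ 2 = ((2 : ℤ) : 𝓞 K) ∧ S ^ 2 = d ∧ T ^ 2 = ((-1 : ℤ) : 𝓞 K) := by
  have key {x : K} {m : ℤ} (hx : x ^ 2 = m) : ∃ X : 𝓞 K, algebraMap (𝓞 K) K X = x ∧ X ^ 2 = m := by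
    have hi : IsIntegral ℤ x := .of_pow two_pos (hx ▸ isIntegral_algebraMap (R := ℤ) (x := m))
    obtain ⟨X, hX⟩ : ∃ X : 𝓞 K, algebraMap (𝓞 K) K X = x := ⟨⟨x, hi⟩, rfl⟩
    refine ⟨X, hX, RingOfIntegers.coe_injective ?_⟩
    rw [map_pow, map_intCast, hX, hx]
  obtain ⟨R, hR, hR2⟩ := key (m := 2) (by simpa using h.r_sq)
  obtain ⟨S, hS, hS2⟩ := key h.s_sq
  obtain ⟨T, hT, hT2⟩ := key (m := -1) (by simpa using h.t_sq)
  exact ⟨R, S, T, hR, hS, hT, hR2, hS2, hT2⟩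

theorem galois_ext_integers {R S T : 𝓞 K} (hR : algebraMap (𝓞 K) K R = r)
    (hS : algebraMap (𝓞 K) K S = s) (hT : algebraMap (𝓞 K) K T = t) {σ τ : Gal(K/ℚ)}
    (h1 : σ • R = τ • R) (h2 : σ • S = τ • S) (h3 : σ • T = τ • T) : σ = τ := by
  refine h.galois_ext ?_ ?_ ?_
  · rw [← hR]; exact congrArg (algebraMap (𝓞 K) K) h1
  · rw [← hS]; exact congrArg (algebraMap (𝓞 K) K) h2
  · rw [← hT]; exact congrArg (algebraMap (𝓞 K) K) h3

theorem splitsAs_of_isSquare {p : ℕ} (hp : p.Prime) (hpd : ¬ (p : ℤ) ∣ 2 * d)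
    (h2 : IsSquare ((2 : ℤ) : ZMod p)) (hd : IsSquare (d : ZMod p))
    (h1 : IsSquare ((-1 : ℤ) : ZMod p)) : SplitsAs K p 1 8 := by
  obtain ⟨hG, hf, -⟩ := h.isGalois_finrank_discr
  obtain ⟨R, S, T, hR, hS, hT, hR2, hS2, hT2⟩ := h.exists_integers
  obtain ⟨P, hP, e, f, g, hs, hef, hgef, -⟩ := exists_splitsAs (K := K) hp
  have hp2 : ¬ (p : ℤ) ∣ 2 := fun hd ↦ hpd (hd.mul_right d)
  have : MulAction.stabilizer Gal(K/ℚ) P = ⊥ := by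
    rw [Subgroup.eq_bot_iff_forall]
    intro σ hσ
    refine h.galois_ext_integers hR hS hT ?_ ?_ ?_ <;> rw [one_smul]
    · refine galois_smul_eq_of_isSquare hp hP hR2 h2 (fun h4 ↦ ?_) hσ
      exact hp2 ((Nat.prime_iff_prime_int.mp hp).dvd_or_dvd h4 |>.elim id id)
    · exact galois_smul_eq_of_isSquare hp hP hS2 hd hpd hσ
    · exact galois_smul_eq_of_isSquare hp hP hT2 h1 (by simpa using hp2) hσ
  rw [this, Subgroup.card_bot] at hef
  rw [hef, hf] at hgef
  obtain rfl : g = 8 := by omega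
  obtain rfl : f = 1 := Nat.eq_one_of_mul_eq_one_left hef
  exact hs

theorem splitsAs_of_not_isSquare {p : ℕ} (hp : p.Prime) (hpd : ¬ (p : ℤ) ∣ 2 * d)
    (hns : ¬ (IsSquare ((2 : ℤ) : ZMod p) ∧ IsSquare (d : ZMod p) ∧
      IsSquare ((-1 : ℤ) : ZMod p))) : SplitsAs K p 2 4 := by
  classical
  obtain ⟨hG, hf, -⟩ := h.isGalois_finrank_discr
  obtain ⟨R, S, T, hR, hS, hT, hR2, hS2, hT2⟩ := h.exists_integers
  obtain ⟨P, hP, e, f, g, hs, hef, hgef, -⟩ := exists_splitsAs (K := K) hp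
  have hpp : Prime (p : ℤ) := Nat.prime_iff_prime_int.mp hp
  have hp2 : ¬ (p : ℤ) ∣ 2 := fun hd ↦ hpd (hd.mul_right d)
  have hpd' : ¬ (p : ℤ) ∣ d := fun hd ↦ hpd (hd.mul_left 2)
  have hp1 : ¬ (p : ℤ) ∣ -1 := fun h1 ↦ hpp.not_isUnit (isUnit_of_dvd_unit h1 (by simp))
  have hmul {a b c : ℤ} (ha : ¬ (p : ℤ) ∣ a) (hb : ¬ (p : ℤ) ∣ b) : ¬ (p : ℤ) ∣ 2 * (a * b) := by
    rw [hpp.dvd_mul, hpp.dvd_mul]; tauto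
  obtain ⟨x, m, hx, hpm, hm⟩ : ∃ (x : 𝓞 K) (m : ℤ), x ^ 2 = m ∧ ¬ (p : ℤ) ∣ m ∧
      ¬ IsSquare (m : ZMod p) := by
    by_cases h2 : IsSquare ((2 : ℤ) : ZMod p)
    · by_cases hd : IsSquare (d : ZMod p)
      · exact ⟨T, -1, hT2, hp1, by tauto⟩
      · exact ⟨S, d, hS2, hpd', hd⟩
    · exact ⟨R, 2, hR2, hp2, h2⟩
  have hcard : Nat.card (MulAction.stabilizer Gal(K/ℚ) P) ≤ 2 := by
    have hinj : Function.Injective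
        (fun σ : MulAction.stabilizer Gal(K/ℚ) P ↦ decide (σ.1 • x = x)) := by
      rintro ⟨σ, hσ⟩ ⟨τ, hτ⟩ hστ
      simp only [decide_eq_decide] at hστ
      have hsx (ρ : Gal(K/ℚ)) : ρ • x = x ∨ ρ • x = -x := by
        rw [← sq_eq_sq_iff_eq_or_eq_neg, ← smul_pow', hx]
        exact map_intCast (MulSemiringAction.toRingHom _ _ ρ) m
      have hxx : σ • x = τ • x := by grind [hsx σ, hsx τ]
      have key {y : 𝓞 K} {n : ℤ} (hy : y ^ 2 = n) (hn : ¬ (p : ℤ) ∣ n) : σ • y = τ • y :=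
        galois_smul_eq_smul_of_not_isSquare hp hP hx hy (hmul (c := 0) hpm hn) hm hσ hτ hxx
      exact Subtype.ext (h.galois_ext_integers hR hS hT (key hR2 hp2) (key hS2 hpd') (key hT2 hp1))
    simpa using Nat.card_le_card_of_injective _ hinj
  have hf1 : f ≠ 1 := by
    rintro rfl
    exact absNorm_ne_of_not_isSquare hp hP hx hm (by rw [hs.2 P hP, pow_one])
  rw [hf] at hgef
  rw [← hef] at hcard
  have he0 : e ≠ 0 := by rintro rfl; simp at hgef
  have hf0 : f ≠ 0 := by rintro rfl; simp at hgef
  obtain rfl : e = 1 := by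
    by_contra he
    have : 2 * 2 ≤ e * f := Nat.mul_le_mul (by omega) (by omega)
    omega
  obtain rfl : f = 2 := by omega
  obtain rfl : g = 4 := by omega
  exact hs

omit h in
theorem card_le_four_of_forall_fixed {G : Subgroup Gal(K/ℚ)} {x y z : 𝓞 K} {m n : ℤ}
    (hx : x ^ 2 = m) (hy : y ^ 2 = n)
    (hext : ∀ σ τ : Gal(K/ℚ), σ • x = τ • x → σ • y = τ • y → σ • z = τ • z → σ = τ)
    (hz : ∀ σ ∈ G, σ • z = z) : Nat.card G ≤ 4 := by
  classical
  have hinj : Function.Injective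
      (fun σ : G ↦ (decide (σ.1 • x = x), decide (σ.1 • y = y))) := by
    rintro ⟨σ, hσ⟩ ⟨τ, hτ⟩ hστ
    simp only [Prod.mk.injEq, decide_eq_decide] at hστ
    have hs {x : 𝓞 K} {m : ℤ} (hx : x ^ 2 = m) (ρ : Gal(K/ℚ)) : ρ • x = x ∨ ρ • x = -x := by
      rw [← sq_eq_sq_iff_eq_or_eq_neg, ← smul_pow', hx]
      exact map_intCast (MulSemiringAction.toRingHom _ _ ρ) m
    refine Subtype.ext (hext σ τ ?_ ?_ (by rw [hz σ hσ, hz τ hτ]))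
    · grind [hs hx σ, hs hx τ]
    · grind [hs hy σ, hs hy τ]
  simpa using Nat.card_le_card_of_injective _ hinj

theorem splitsAs_of_dvd {p : ℕ} (hp : p.Prime) (hp8 : p % 8 = 5) (hpd : (p : ℤ) ∣ d) :
    SplitsAs K p 2 2 := by
  have : Fact p.Prime := ⟨hp⟩
  obtain ⟨hG, hf, -⟩ := h.isGalois_finrank_discr
  obtain ⟨R, S, T, hR, hS, hT, hR2, hS2, hT2⟩ := h.exists_integers
  obtain ⟨P, hP, e, f, g, hs, hef, hgef, hk⟩ := exists_splitsAs (K := K) hp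
  have hpd2 : ¬ (p : ℤ) ^ 2 ∣ d := fun h2 ↦
    (Nat.prime_iff_prime_int.mp hp).not_isUnit (h.squarefree _ (by rwa [← sq]))
  have he := hk 2 (natCast_mem_sq_of_dvd hp hP hS2 hpd hpd2)
  have h1 : IsSquare ((-1 : ℤ) : ZMod p) := by
    simpa using ZMod.exists_sq_eq_neg_one_iff.mpr (by omega)
  have h2 : ¬ IsSquare ((2 : ℤ) : ZMod p) := by
    have := (ZMod.exists_sq_eq_two_iff (p := p) (by omega)).not.mpr (by omega)
    simpa using this
  have hf1 : f ≠ 1 := by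
    rintro rfl
    exact absNorm_ne_of_not_isSquare hp hP hR2 h2 (by rw [hs.2 P hP, pow_one])
  have hcard : Nat.card (MulAction.stabilizer Gal(K/ℚ) P) ≤ 4 :=
    card_le_four_of_forall_fixed hR2 hS2 (fun σ τ ↦ h.galois_ext_integers hR hS hT)
      fun σ hσ ↦ galois_smul_eq_of_isSquare hp hP hT2 h1
        (by rw [mul_neg_one, dvd_neg]; intro h3; have := Int.le_of_dvd two_pos h3; omega) hσ
  rw [hf] at hgef
  rw [← hef] at hcard
  have hf0 : f ≠ 0 := by rintro rfl; simp at hgef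
  obtain rfl : e = 2 := by
    by_contra he'
    have : 3 * 2 ≤ e * f := Nat.mul_le_mul (by omega) (by omega)
    omega
  obtain rfl : f = 2 := by omega
  obtain rfl : g = 2 := by omega
  exact hs

theorem two_mem_pow_four {P : Ideal (𝓞 K)} (hP : P ∈ primesOver (span {((2 : ℕ) : ℤ)}) (𝓞 K)) :
    (2 : 𝓞 K) ∈ P ^ 4 := by
  have hP1 := hP.1
  have hz := h.isPrimitiveRoot
  obtain ⟨z, hz1⟩ : ∃ z : 𝓞 K, algebraMap (𝓞 K) K z = (1 + t) / r :=
    ⟨⟨_, hz.isIntegral (by norm_num)⟩, rfl⟩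
  have hz4 : z ^ 4 = -1 := by
    apply RingOfIntegers.coe_injective
    rw [map_pow, hz1, map_neg, map_one]
    have hr4 : r ^ 4 = 4 := by linear_combination (r ^ 2 + 2) * h.r_sq
    rw [div_pow, hr4, div_eq_iff (by norm_num)]
    linear_combination (t ^ 2 + 4 * t + 5) * h.t_sq
  have e2 : (2 : 𝓞 K) = (1 - z) ^ 4 * ((1 + z + z ^ 2) * (1 + z + z ^ 2 + z ^ 3 + z ^ 4) *
      (1 + z + z ^ 2 + z ^ 3 + z ^ 4 + z ^ 5 + z ^ 6)) := by
    linear_combination (1 + z + z ^ 3 - 2 * z ^ 4 - z ^ 6 + z ^ 9 + z ^ 11 - z ^ 12) * hz4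
  have h2 : (2 : 𝓞 K) ∈ P := by exact_mod_cast natCast_mem_of_mem_primesOver hP
  have h1 : (1 - z) ∈ P := by
    refine hP1.mem_of_pow_mem 4 ?_
    have : (1 - z) ^ 4 = 2 * (-2 * z + 3 * z ^ 2 - 2 * z ^ 3) := by linear_combination hz4
    rw [this]
    exact P.mul_mem_right _ h2
  rw [e2]
  exact (P ^ 4).mul_mem_right _ (pow_mem_pow h1 4)

theorem splitsAs_two : SplitsAs K 2 1 2 := by
  obtain ⟨hG, hf, -⟩ := h.isGalois_finrank_discr
  obtain ⟨R, S, T, hR, hS, hT, hR2, hS2, hT2⟩ := h.exists_integers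
  obtain ⟨P, hP, e, f, g, hs, hef, hgef, hk⟩ := exists_splitsAs (K := K) Nat.prime_two
  have he := hk 4 (by simpa using h.two_mem_pow_four hP)
  have hcard : Nat.card (MulAction.stabilizer Gal(K/ℚ) P) ≤ 4 :=
    card_le_four_of_forall_fixed hR2 hT2
      (fun σ τ h1 h2 h3 ↦ h.galois_ext_integers hR hS hT h1 h3 h2)
      fun σ hσ ↦ galois_smul_eq_of_two hP hS2 h.mod_eight hσ
  rw [hf] at hgef
  rw [← hef] at hcard
  have hf0 : f ≠ 0 := by rintro rfl; simp at hgef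
  obtain rfl : f = 1 := by
    by_contra hf'
    have : 4 * 2 ≤ e * f := Nat.mul_le_mul (by omega) (by omega)
    omega
  obtain rfl : e = 4 := by omega
  obtain rfl : g = 2 := by omega
  exact hs

end IsTriquadraticGenerator

end TriquadraticSplitting

/-- The radicands of the seven quadratic subfields of `ℚ(√2, √d, √-1)`. -/
def quadraticRadicand (d : ℤ) : Fin 7 → ℤ :=
  ![-1, 2, -2, d, 2 * d, -d, -2 * d]

namespace IsQuadraticGenerator

open Classical in
theorem splitsAs_of_not_dvd {k : Type*} [Field k] [NumberField k] {x : k} {m : ℤ}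
    (h : IsQuadraticGenerator x m) {p : ℕ} (hp : p.Prime) (hpm : ¬ (p : ℤ) ∣ 2 * m) :
    SplitsAs k p (if IsSquare (m : ZMod p) then 1 else 2)
      (if IsSquare (m : ZMod p) then 2 else 1) := by
  split_ifs with hm
  · exact h.splitsAs_of_isSquare hp hm hpm
  · exact h.splitsAs_of_not_isSquare hp hm

end IsQuadraticGenerator

namespace IsTriquadraticGenerator

variable {K : Type*} [Field K] [NumberField K] {r s t : K} {d : ℤ}
  (h : IsTriquadraticGenerator r s t d) {k : Fin 7 → Type*} [∀ i, Field (k i)]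
  [∀ i, NumberField (k i)] {x : ∀ i, k i}
  (hk : ∀ i, IsQuadraticGenerator (x i) (quadraticRadicand d i))

include h hk

open Classical in
theorem exists_splitsAs_of_not_dvd {p : ℕ} (hp : p.Prime) (hpd : ¬ (p : ℤ) ∣ 2 * d) :
    ∃ f g : ℕ, ∃ F G : Fin 7 → ℕ, SplitsAs K p f g ∧ (∀ i, SplitsAs (k i) p (F i) (G i)) ∧
      ∀ x : ℂ, (1 - x ^ f) ^ g * (1 - x) ^ 6 = ∏ i, (1 - x ^ F i) ^ G i := by
  have : Fact p.Prime := ⟨hp⟩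
  have hpp : Prime (p : ℤ) := Nat.prime_iff_prime_int.mp hp
  have hp2 : ¬ (p : ℤ) ∣ 2 := fun hd ↦ hpd (hd.mul_right d)
  have hpd' : ¬ (p : ℤ) ∣ d := fun hd ↦ hpd (hd.mul_left 2)
  have hpm (i : Fin 7) : ¬ (p : ℤ) ∣ 2 * quadraticRadicand d i := by
    rw [hpp.dvd_mul]
    have hp1 : ¬ (p : ℤ) ∣ 1 := fun h1 ↦ hpp.not_isUnit (isUnit_of_dvd_one h1)
    fin_cases i <;> simp [quadraticRadicand, hp1, hp2, hpd', hpp.dvd_mul]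
  have h2 : ((2 : ℤ) : ZMod p) ≠ 0 := by rwa [Ne, ZMod.intCast_zmod_eq_zero_iff_dvd]
  have hd : (d : ZMod p) ≠ 0 := by rwa [Ne, ZMod.intCast_zmod_eq_zero_iff_dvd]
  have h1 : ((-1 : ℤ) : ZMod p) ≠ 0 := by simp
  have e1 := isSquare_mul_iff_of_ne_zero h1 h2
  have e2 := isSquare_mul_iff_of_ne_zero h2 hd
  have e3 := isSquare_mul_iff_of_ne_zero h1 hd
  have e4 := isSquare_mul_iff_of_ne_zero h1 (mul_ne_zero h2 hd)
  rw [e2] at e4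
  push_cast at e1 e2 e3 e4
  simp only [neg_mul, one_mul] at e1 e2 e3 e4
  have hsp := fun i ↦ (hk i).splitsAs_of_not_dvd hp (hpm i)
  by_cases hall : IsSquare ((2 : ℤ) : ZMod p) ∧ IsSquare (d : ZMod p) ∧
      IsSquare ((-1 : ℤ) : ZMod p)
  · refine ⟨1, 8, _, _, h.splitsAs_of_isSquare hp hpd hall.1 hall.2.1 hall.2.2, hsp, fun x ↦ ?_⟩
    obtain ⟨ha, hb, hc⟩ := hall
    push_cast at ha hb hc
    simp only [Fin.prod_univ_seven, quadraticRadicand]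
    simp [ha, hb, hc, e1, e2, e3, e4]
    ring
  · refine ⟨2, 4, _, _, h.splitsAs_of_not_isSquare hp hpd hall, hsp, fun x ↦ ?_⟩
    push_cast at hall
    by_cases ha : IsSquare (2 : ZMod p) <;> by_cases hb : IsSquare (d : ZMod p) <;>
      by_cases hc : IsSquare (-1 : ZMod p) <;>
      simp only [ha, hb, hc, not_true, not_false_eq_true, and_true, and_self] at hall <;>
      simp only [Fin.prod_univ_seven, quadraticRadicand] <;>
      simp [ha, hb, hc, e1, e2, e3, e4] <;>
      ring

theorem exists_splitsAs_of_odd_dvd {p : ℕ} (hp : p.Prime) (hpd : (p : ℤ) ∣ d) (hp8 : p % 8 = 5) :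
    ∃ f g : ℕ, ∃ F G : Fin 7 → ℕ, SplitsAs K p f g ∧ (∀ i, SplitsAs (k i) p (F i) (G i)) ∧
      ∀ x : ℂ, (1 - x ^ f) ^ g * (1 - x) ^ 6 = ∏ i, (1 - x ^ F i) ^ G i := by
  have : Fact p.Prime := ⟨hp⟩
  have hpp : Prime (p : ℤ) := Nat.prime_iff_prime_int.mp hp
  have hp2 : ¬ (p : ℤ) ∣ 2 := fun h3 ↦ by have := Int.le_of_dvd two_pos h3; omega
  have hpd2 : ¬ (p : ℤ) ^ 2 ∣ d := fun h2 ↦ hpp.not_isUnit (h.squarefree _ (by rwa [← sq]))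
  have hcop : IsCoprime ((p : ℤ) ^ 2) 2 :=
    ((Prime.coprime_iff_not_dvd hpp).mpr hp2).pow_left
  have hp2d : ¬ (p : ℤ) ^ 2 ∣ 2 * d := fun h2 ↦ hpd2 (hcop.dvd_of_dvd_mul_left h2)
  have h1 : IsSquare (-1 : ZMod p) := ZMod.exists_sq_eq_neg_one_iff.mpr (by omega)
  have h2 : ¬ IsSquare (2 : ZMod p) :=
    (ZMod.exists_sq_eq_two_iff (p := p) (by omega)).not.mpr (by omega)
  have h20 : (2 : ZMod p) ≠ 0 := by
    have : ((2 : ℤ) : ZMod p) ≠ 0 := by rwa [Ne, ZMod.intCast_zmod_eq_zero_iff_dvd]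
    simpa using this
  have h3 : ¬ IsSquare (-2 : ZMod p) := by
    have := isSquare_mul_iff_of_ne_zero (neg_ne_zero.mpr (one_ne_zero (α := ZMod p))) h20
    rw [neg_one_mul] at this
    tauto
  refine ⟨2, 2, ![1, 2, 2, 1, 1, 1, 1], ![2, 1, 1, 1, 1, 1, 1], h.splitsAs_of_dvd hp hp8 hpd, ?_,
    fun x ↦ ?_⟩
  · simp only [Fin.forall_fin_succ]
    refine ⟨?_, ?_, ?_, ?_, ?_, ?_, ?_, ?_⟩
    · exact (hk 0).splitsAs_of_isSquare hp (by simpa [quadraticRadicand] using h1)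
        (by simpa [quadraticRadicand] using hp2)
    · exact (hk 1).splitsAs_of_not_isSquare hp (by simpa [quadraticRadicand] using h2)
    · exact (hk 2).splitsAs_of_not_isSquare hp (by simpa [quadraticRadicand] using h3)
    · exact (hk 3).splitsAs_of_dvd hp hpd hpd2
    · exact (hk 4).splitsAs_of_dvd hp (hpd.mul_left _) hp2d
    · exact (hk 5).splitsAs_of_dvd hp (by simpa [quadraticRadicand] using hpd)
        (by simpa [quadraticRadicand] using hpd2)
    · exact (hk 6).splitsAs_of_dvd hp (hpd.mul_left _) (by simpa [quadraticRadicand] using hp2d)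
    · simp
  · simp [Fin.prod_univ_seven]
    ring

theorem exists_splitsAs_two :
    ∃ f g : ℕ, ∃ F G : Fin 7 → ℕ, SplitsAs K 2 f g ∧ (∀ i, SplitsAs (k i) 2 (F i) (G i)) ∧
      ∀ x : ℂ, (1 - x ^ f) ^ g * (1 - x) ^ 6 = ∏ i, (1 - x ^ F i) ^ G i := by
  have hd := h.mod_eight
  refine ⟨1, 2, ![1, 1, 1, 1, 1, 1, 1], ![1, 1, 1, 2, 1, 1, 1], h.splitsAs_two, ?_, fun x ↦ ?_⟩
  · simp only [Fin.forall_fin_succ]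
    refine ⟨?_, ?_, ?_, ?_, ?_, ?_, ?_, ?_⟩
    · exact (hk 0).splitsAs_two_of_mod_four (by simp [quadraticRadicand])
    · exact (hk 1).splitsAs_of_dvd Nat.prime_two (by simp [quadraticRadicand])
        (by simp [quadraticRadicand])
    · exact (hk 2).splitsAs_of_dvd Nat.prime_two (by simp [quadraticRadicand])
        (by simp [quadraticRadicand])
    · exact (hk 3).splitsAs_two h.mod_eight
    · exact (hk 4).splitsAs_of_dvd Nat.prime_two (by simp [quadraticRadicand])
        (by simp [quadraticRadicand]; omega)
    · exact (hk 5).splitsAs_two_of_mod_four (by simp [quadraticRadicand]; omega)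
    · exact (hk 6).splitsAs_of_dvd Nat.prime_two (by simp [quadraticRadicand])
        (by simp [quadraticRadicand]; omega)
    · simp
  · simp [Fin.prod_univ_seven]
    ring

theorem dedekindZeta_residue_eq (hd : ∀ p : ℕ, p.Prime → (p : ℤ) ∣ d → p % 8 = 5) :
    dedekindZeta_residue K = ∏ i, dedekindZeta_residue (k i) := by
  have key (p : Nat.Primes) :
      ∃ f g : ℕ, ∃ F G : Fin 7 → ℕ, SplitsAs K p f g ∧ (∀ i, SplitsAs (k i) p (F i) (G i)) ∧
        ∀ x : ℂ, (1 - x ^ f) ^ g * (1 - x) ^ 6 = ∏ i, (1 - x ^ F i) ^ G i := by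
    by_cases hpd : ((p : ℕ) : ℤ) ∣ 2 * d
    · rcases (Nat.prime_iff_prime_int.mp p.2).dvd_or_dvd hpd with h2 | h2
      · have : (p : ℕ) = 2 := by
          rw [← Nat.prime_dvd_prime_iff_eq p.2 Nat.prime_two]
          exact_mod_cast h2
        rw [this]
        exact h.exists_splitsAs_two hk
      · exact h.exists_splitsAs_of_odd_dvd hk p.2 h2 (hd p p.2 h2)
    · exact h.exists_splitsAs_of_not_dvd hk p.2 hpd
  choose f g F G h1 h2 h3 using key
  exact dedekindZeta_residue_eq_prod k 6 (by simp) h1 (fun i p ↦ h2 p i) h3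

end IsTriquadraticGenerator

section UnitIndex

variable (K : Type*) [Field K] [NumberField K]

theorem exists_odd_mul_regulator_eq_regOfFamily (u : Fin (Units.rank K) → (𝓞 K)ˣ)
    (h0 : Units.regOfFamily u ≠ 0)
    (hu : ∀ v : (𝓞 K)ˣ, v ^ 2 ∈ Subgroup.closure (Set.range u) ⊔ Units.torsion K →
      v ∈ Subgroup.closure (Set.range u) ⊔ Units.torsion K) :
    ∃ n : ℕ, Odd n ∧ Units.regOfFamily u = n * Units.regulator K := by
  set H := Subgroup.closure (Set.range u) ⊔ Units.torsion K with hH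
  have hindex : Units.regOfFamily u = H.index * Units.regulator K := by
    rw [hH, ← Units.regOfFamily_div_regulator, div_mul_cancel₀ _ (Units.regulator_ne_zero K)]
  refine ⟨H.index, ?_, hindex⟩
  have hne : H.index ≠ 0 := fun h ↦ h0 (by rw [hindex, h]; simp)
  rw [← Nat.not_even_iff_odd, even_iff_two_dvd]
  intro h2
  have : Finite ((𝓞 K)ˣ ⧸ H) := Nat.finite_of_card_ne_zero hne
  obtain ⟨q, hq⟩ := exists_prime_orderOf_dvd_card' 2 h2
  obtain ⟨v, rfl⟩ := QuotientGroup.mk_surjective q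
  have h1 : v ^ 2 ∈ H := by
    rw [← QuotientGroup.eq_one_iff, QuotientGroup.mk_pow, ← hq, pow_orderOf_eq_one]
  have h3 := (QuotientGroup.eq_one_iff v).mpr (hu v h1)
  rw [h3, orderOf_one] at hq
  omega

theorem exists_odd_torsionOrder_eq (a : ℕ) {ζ : K} (hζ : IsPrimitiveRoot ζ (2 ^ a))
    (h : ∀ ξ : K, ¬ IsPrimitiveRoot ξ (2 ^ (a + 1))) :
    ∃ n : ℕ, Odd n ∧ Units.torsionOrder K = 2 ^ a * n := by
  obtain ⟨n, hn⟩ := Units.dvd_torsionOrder_of_isPrimitiveRoot hζ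
  refine ⟨n, ?_, hn⟩
  rw [← Nat.not_even_iff_odd, even_iff_two_dvd]
  rintro ⟨k, rfl⟩
  obtain ⟨g, hg⟩ := IsCyclic.exists_ofOrder_eq_natCard (α := Units.torsion K)
  have hg' : orderOf g = 2 ^ a * (2 * k) := by rw [hg]; exact hn
  have hk : k ≠ 0 := by
    rintro rfl
    exact Units.torsionOrder_ne_zero K (by simpa using hn)
  have h1 : orderOf (g ^ k) = 2 ^ (a + 1) := by
    rw [orderOf_pow_of_dvd hk (hg' ▸ Dvd.intro_left (2 ^ a * 2) (by ring)), hg',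
      show 2 ^ a * (2 * k) = 2 ^ (a + 1) * k by ring, Nat.mul_div_cancel _ (Nat.pos_of_ne_zero hk)]
  have h2 := IsPrimitiveRoot.orderOf (g ^ k)
  rw [h1] at h2
  refine h (((g ^ k : Units.torsion K) : (𝓞 K)ˣ) : K) ?_
  exact Units.coe_coe (((g ^ k : Units.torsion K) : (𝓞 K)ˣ)) ▸
    (h2.map_of_injective (f := (Units.torsion K).subtype) Subtype.val_injective).map_of_injective
      (f := (algebraMap (𝓞 K) K).toMonoidHom.comp (Units.coeHom (𝓞 K))) (Units.coe_injective K)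

theorem regulator_eq_one_of_rank_eq_zero (h : Units.rank K = 0) : Units.regulator K = 1 := by
  classical
  have w : InfinitePlace K := Classical.arbitrary _
  have hc : Fintype.card {v : InfinitePlace K // v ≠ w} = Fintype.card (Fin (Units.rank K)) := by
    rw [Fintype.card_subtype_compl, Fintype.card_subtype_eq, Fintype.card_fin]
    rfl
  rw [Units.regulator_eq_det K w (Fintype.equivOfCardEq hc)]
  have : IsEmpty {v : InfinitePlace K // v ≠ w} := by
    rw [← Fintype.card_eq_zero_iff, hc, Fintype.card_fin, h]
  rw [Matrix.det_isEmpty, abs_one]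

end UnitIndex

section Quadratic

variable {K : Type*} [Field K] [NumberField K]

namespace IsQuadraticGenerator

variable {x : K} {m : ℤ} (h : IsQuadraticGenerator x m)

include h

theorem isSquare_or_isSquare_mul {y : K} {n : ℤ} (hy : y ^ 2 = n) :
    IsSquare n ∨ IsSquare (n * m) := by
  obtain ⟨σ, hσ, -⟩ := h.exists_conj
  obtain ⟨a, b, hab⟩ := h.exists_rat y
  have hx : x ≠ 0 := by
    rintro rfl
    exact h.not_isSquare ⟨0, by simpa using h.sq_eq.symm⟩
  have h1 : σ y = a - b * x := by rw [hab]; simp [hσ, sub_eq_add_neg]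
  have h2 : σ y = y ∨ σ y = -y := by
    rw [← sq_eq_sq_iff_eq_or_eq_neg, ← map_pow, hy, map_intCast]
  rcases h2 with h2 | h2
  · left
    have hb : (b : K) = 0 := by
      have : (b : K) * x = 0 := by linear_combination (h1 - h2 - hab) / 2
      exact (mul_eq_zero.mp this).resolve_right hx
    rw [← Rat.isSquare_intCast_iff]
    refine ⟨a, Rat.cast_injective (α := K) ?_⟩
    push_cast
    rw [← hy, hab, hb]
    ring
  · right
    have ha : (a : K) = 0 := by linear_combination (h2 - h1 - hab) / 2
    rw [← Rat.isSquare_intCast_iff]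
    refine ⟨b * m, Rat.cast_injective (α := K) ?_⟩
    push_cast
    rw [← hy, hab, ha, ← h.sq_eq]
    ring

theorem exists_odd_torsionOrder_eq_two_mul (hm : Squarefree m) (hm1 : m ≠ -1) :
    ∃ n : ℕ, Odd n ∧ Units.torsionOrder K = 2 * n := by
  refine exists_odd_torsionOrder_eq K 1 (ζ := -1)
    (by rw [pow_one]; exact IsPrimitiveRoot.neg_one 0 (by norm_num)) fun ξ hξ ↦ ?_
  have h1 : ξ ^ 2 = ((-1 : ℤ) : K) := by
    have := (hξ.pow (a := 2) (b := 2) (by norm_num) (by norm_num)).eq_neg_one_of_two_right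
    rw [this]; simp
  rcases h.isSquare_or_isSquare_mul h1 with h2 | ⟨k, hk⟩
  · exact absurd h2.nonneg (by norm_num)
  · have hu : IsUnit k := hm k ⟨-1, by linear_combination -hk⟩
    rcases Int.isUnit_iff.mp hu with rfl | rfl <;> omega

theorem exists_odd_torsionOrder_eq_four_mul (hm : m = -1) :
    ∃ n : ℕ, Odd n ∧ Units.torsionOrder K = 4 * n := by
  subst hm
  have hx : IsPrimitiveRoot x (2 ^ 2) := by
    rw [show 2 ^ 2 = 2 ^ (1 + 1) by norm_num]
    exact IsPrimitiveRoot.iff_orderOf.mpr (orderOf_eq_prime_pow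
      (by rw [pow_one, h.sq_eq]; simp; norm_num)
      (by rw [show 2 ^ (1 + 1) = 2 * 2 by norm_num, pow_mul, h.sq_eq]; simp))
  refine exists_odd_torsionOrder_eq K 2 hx fun ξ hξ ↦ ?_
  have h1 : ξ ^ 4 = -1 :=
    (hξ.pow (a := 4) (b := 2) (by norm_num) (by norm_num)).eq_neg_one_of_two_right
  have h0 : ξ ≠ 0 := by rintro rfl; norm_num at h1
  have h2 : (ξ + ξ⁻¹) ^ 2 = ((2 : ℤ) : K) := by
    field_simp
    push_cast
    linear_combination h1
  rcases h.isSquare_or_isSquare_mul h2 with ⟨k, hk⟩ | h3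
  · have : k ≤ 1 := by nlinarith
    have : -1 ≤ k := by nlinarith
    interval_cases k <;> omega
  · exact absurd h3.nonneg (by norm_num)

end IsQuadraticGenerator
end Quadratic

section Units

variable {K : Type*} [Field K] [NumberField K]

theorem exists_unit_of_sq_sub_eq_four {x : K} {m X Y : ℤ} (hx : x ^ 2 = m)
    (h : X ^ 2 - m * Y ^ 2 = 4 ∨ X ^ 2 - m * Y ^ 2 = -4) :
    ∃ η : (𝓞 K)ˣ, algebraMap (𝓞 K) K η = (X + Y * x) / 2 := by
  obtain ⟨e, he1, he⟩ : ∃ e : ℤ, e * e = 1 ∧ X ^ 2 - m * Y ^ 2 = 4 * e := by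
    rcases h with h | h
    · exact ⟨1, by norm_num, by rw [h]; norm_num⟩
    · exact ⟨-1, by norm_num, by rw [h]; norm_num⟩
  have heK : (X : K) ^ 2 - m * Y ^ 2 = 4 * e := by exact_mod_cast he
  have he1K : (e : K) * e = 1 := by exact_mod_cast he1
  have hInt (Z : ℤ) (hZ : Z ^ 2 = Y ^ 2) : IsIntegral ℤ ((X + Z * x) / 2 : K) := by
    have hZK : (Z : K) ^ 2 = Y ^ 2 := by exact_mod_cast hZ
    refine ⟨Polynomial.X ^ 2 - Polynomial.C X * Polynomial.X + Polynomial.C e, by monicity!, ?_⟩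
    simp only [Polynomial.eval₂_add, Polynomial.eval₂_sub, Polynomial.eval₂_mul,
      Polynomial.eval₂_pow, Polynomial.eval₂_X, Polynomial.eval₂_C]
    simp only [eq_intCast]
    linear_combination (1 / 4 : K) * Z ^ 2 * hx - (1 / 4 : K) * heK + (1 / 4 : K) * m * hZK
  obtain ⟨a, ha⟩ : ∃ a : 𝓞 K, algebraMap (𝓞 K) K a = (X + Y * x) / 2 := ⟨⟨_, hInt Y rfl⟩, rfl⟩
  obtain ⟨b, hb⟩ : ∃ b : 𝓞 K, algebraMap (𝓞 K) K b = (X + (-Y : ℤ) * x) / 2 :=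
    ⟨⟨_, hInt (-Y) (by ring)⟩, rfl⟩
  have hab : a * (b * e) = 1 := RingOfIntegers.coe_injective (by
    rw [map_mul, map_mul, ha, hb, map_intCast, map_one]
    push_cast
    linear_combination (1 / 4 : K) * e * heK - (1 / 4 : K) * Y ^ 2 * e * hx + he1K)
  exact ⟨⟨a, b * e, hab, by rw [mul_comm, hab]⟩, ha⟩

end Units

section Quadratic

variable {K : Type*} [Field K] [NumberField K]

namespace IsQuadraticGenerator

variable {x : K} {m : ℤ} (h : IsQuadraticGenerator x m)

include h

theorem exists_int_of_unit (hm : Squarefree m) (v : (𝓞 K)ˣ) : ∃ A B : ℤ,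
    algebraMap (𝓞 K) K v = (A + B * x) / 2 ∧ (A ^ 2 - m * B ^ 2 = 4 ∨ A ^ 2 - m * B ^ 2 = -4) := by
  obtain ⟨A, B, hAB, -⟩ := h.exists_int_of_isIntegral hm
    (RingOfIntegers.isIntegral_coe (v : 𝓞 K))
  have hv : algebraMap (𝓞 K) K v = (A + B * x) / 2 := by linear_combination (1 / 2 : K) * hAB
  refine ⟨A, B, hv, ?_⟩
  have h1 := Units.norm K v
  have h2 : Algebra.norm ℚ (algebraMap (𝓞 K) K v) = (A / 2) ^ 2 - m * (B / 2) ^ 2 := by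
    rw [← h.norm_apply, hv]
    congr 1
    push_cast
    ring
  rw [h2] at h1
  have h3 : |((A ^ 2 - m * B ^ 2 : ℤ) : ℚ)| = 4 := by
    rw [show ((A ^ 2 - m * B ^ 2 : ℤ) : ℚ) = 4 * ((A / 2) ^ 2 - m * (B / 2) ^ 2) by
      push_cast; ring, abs_mul, h1]
    norm_num
  have h4 : |A ^ 2 - m * B ^ 2| = 4 := by exact_mod_cast h3
  exact (abs_eq (by norm_num)).mp h4

end IsQuadraticGenerator

omit [NumberField K] in
theorem isTotallyComplex_of_sq_eq {y : K} {n : ℤ} (hy : y ^ 2 = n) (hn : n < 0) :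
    IsTotallyComplex K where
  isComplex v := by
    rw [← InfinitePlace.not_isReal_iff_isComplex]
    intro hv
    have h1 : (v.embedding_of_isReal hv y) ^ 2 = n := by rw [← map_pow, hy, map_intCast]
    have h2 : (n : ℝ) < 0 := by exact_mod_cast hn
    nlinarith [sq_nonneg (v.embedding_of_isReal hv y)]

namespace IsQuadraticGenerator

variable {x : K} {m : ℤ} (h : IsQuadraticGenerator x m)

include h

theorem isTotallyReal (hm : 0 < m) : IsTotallyReal K where
  isReal v := by
    rw [InfinitePlace.isReal_iff, ComplexEmbedding.isReal_iff]
    set ψ := v.embedding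
    have h1 : ψ x ^ 2 = m := by rw [← map_pow, h.sq_eq, map_intCast]
    have h2 : (ψ x - (Real.sqrt m : ℝ)) * (ψ x + (Real.sqrt m : ℝ)) = 0 := by
      have : ((Real.sqrt m : ℝ) : ℂ) ^ 2 = m := by
        rw [← Complex.ofReal_pow, Real.sq_sqrt (by exact_mod_cast hm.le), Complex.ofReal_intCast]
      linear_combination h1 - this
    have h3 : (starRingEnd ℂ) (ψ x) = ψ x := by
      rcases mul_eq_zero.mp h2 with h2 | h2
      · rw [sub_eq_zero.mp h2, Complex.conj_ofReal]
      · rw [eq_neg_of_add_eq_zero_left h2, map_neg, Complex.conj_ofReal]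
    ext y
    obtain ⟨a, b, rfl⟩ := h.exists_rat y
    simp [ComplexEmbedding.conjugate_coe_eq, h3]

theorem dedekindZeta_residue_mul_of_neg (hm : Squarefree m) (hm0 : m < 0) (hm1 : m ≠ -1) :
    ∃ n : ℕ, Odd n ∧ dedekindZeta_residue K * n =
      Real.pi * classNumber K / √|(discr K : ℝ)| := by
  have := isTotallyComplex_of_sq_eq h.sq_eq hm0
  have h1 := IsTotallyComplex.nrRealPlaces_eq_zero K
  have h2 := IsTotallyComplex.finrank K
  have h3 : InfinitePlace.nrComplexPlaces K = 1 := by rw [h.finrank_eq] at h2; omega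
  have hr : Units.rank K = 0 := by
    rw [Units.rank, InfinitePlace.card_eq_nrRealPlaces_add_nrComplexPlaces, h1, h3]
  obtain ⟨n, hn, hw⟩ := h.exists_odd_torsionOrder_eq_two_mul hm hm1
  refine ⟨n, hn, ?_⟩
  have hn0 : (n : ℝ) ≠ 0 := by exact_mod_cast hn.pos.ne'
  rw [dedekindZeta_residue_def, h1, h3, regulator_eq_one_of_rank_eq_zero K hr, hw]
  push_cast
  field_simp

theorem dedekindZeta_residue_mul_of_eq_neg_one (hm : m = -1) :
    ∃ n : ℕ, Odd n ∧ dedekindZeta_residue K * n =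
      Real.pi * classNumber K / (2 * √|(discr K : ℝ)|) := by
  have := isTotallyComplex_of_sq_eq h.sq_eq (by omega)
  have h1 := IsTotallyComplex.nrRealPlaces_eq_zero K
  have h2 := IsTotallyComplex.finrank K
  have h3 : InfinitePlace.nrComplexPlaces K = 1 := by rw [h.finrank_eq] at h2; omega
  have hr : Units.rank K = 0 := by
    rw [Units.rank, InfinitePlace.card_eq_nrRealPlaces_add_nrComplexPlaces, h1, h3]
  obtain ⟨n, hn, hw⟩ := h.exists_odd_torsionOrder_eq_four_mul hm
  refine ⟨n, hn, ?_⟩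
  have hn0 : (n : ℝ) ≠ 0 := by exact_mod_cast hn.pos.ne'
  rw [dedekindZeta_residue_def, h1, h3, regulator_eq_one_of_rank_eq_zero K hr, hw]
  push_cast
  field_simp
  ring

end IsQuadraticGenerator
end Quadratic

section Quadratic

variable {K : Type*} [Field K] [NumberField K]

namespace IsQuadraticGenerator

variable {x : K} {D : ℕ} (h : IsQuadraticGenerator x D)

include h

theorem le_of_isFundUnit (hD : Squarefree (D : ℤ)) {φ : K →+* ℂ} (hφ : φ x = (√D : ℝ)) {ε : ℝ}
    (hε : IsFundUnit D ε) (v : (𝓞 K)ˣ) :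
    ∃ t : ℝ, φ (algebraMap (𝓞 K) K v) = t ∧ (1 < t → ε ≤ t) := by
  obtain ⟨A, B, hv, hAB⟩ := h.exists_int_of_unit hD v
  refine ⟨(A + B * √D) / 2, ?_, hε.2.2 A B hAB⟩
  rw [hv, map_div₀, map_add, map_mul, hφ, map_ofNat]
  simp

theorem not_sq_eq_of_isFundUnit (hD : Squarefree (D : ℤ)) {φ : K →+* ℂ} (hφ : φ x = (√D : ℝ))
    {ε : ℝ} (hε : IsFundUnit D ε) (v : (𝓞 K)ˣ) : φ (algebraMap (𝓞 K) K v) ^ 2 ≠ ε := by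
  intro hv
  have h1 := hε.1
  obtain ⟨t, ht, hle⟩ := h.le_of_isFundUnit hD hφ hε v
  obtain ⟨t', ht', hle'⟩ := h.le_of_isFundUnit hD hφ hε (-v)
  have htt : t' = -t := by
    have : (t' : ℂ) = ((-t : ℝ) : ℂ) := by
      rw [← ht', Units.val_neg, map_neg, map_neg, ht, Complex.ofReal_neg]
    exact_mod_cast this
  subst htt
  rw [ht] at hv
  have hv' : t ^ 2 = ε := by exact_mod_cast hv
  rcases lt_or_ge 1 t with h2 | h2
  · nlinarith [hle h2]
  · rcases lt_or_ge 1 (-t) with h3 | h3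
    · nlinarith [hle' h3]
    · nlinarith

theorem exists_odd_mul_regulator_eq_log (hD : Squarefree (D : ℤ)) {φ : K →+* ℂ}
    (hφ : φ x = (√D : ℝ)) {ε : ℝ} (hε : IsFundUnit D ε) :
    ∃ n : ℕ, Odd n ∧ Real.log ε = n * Units.regulator K := by
  classical
  have hD0 : (0 : ℤ) < D := by
    refine lt_of_le_of_ne (by positivity) fun h0 ↦ ?_
    exact h.not_isSquare (h0 ▸ ⟨0, by simp⟩)
  have h1ε := hε.1
  have := h.isTotallyReal hD0
  have hreal := IsTotallyReal.finrank (K := K)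
  have hplaces : Fintype.card (InfinitePlace K) = 2 := by
    rw [InfinitePlace.card_eq_nrRealPlaces_add_nrComplexPlaces,
      IsTotallyReal.nrComplexPlaces_eq_zero K, ← hreal, h.finrank_eq]
  have hrank : Units.rank K = 1 := by rw [Units.rank, hplaces]
  obtain ⟨X, Y, hXY, hN⟩ := hε.2.1
  obtain ⟨η, hη⟩ := exists_unit_of_sq_sub_eq_four (X := X) (Y := Y) h.sq_eq (by exact_mod_cast hN)
  have hφη : φ (algebraMap (𝓞 K) K η) = (ε : ℂ) := by
    rw [hη, map_div₀, map_add, map_mul, hφ, hXY, map_ofNat]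
    simp
  set w := InfinitePlace.mk φ with hw
  obtain ⟨w', hw'⟩ : ∃ w' : InfinitePlace K, w' ≠ w := by
    have : Nontrivial (InfinitePlace K) := Fintype.one_lt_card_iff_nontrivial.mp (by omega)
    exact exists_ne w
  have hc : Fintype.card {v : InfinitePlace K // v ≠ w'} = 1 := by
    rw [Fintype.card_subtype_compl, Fintype.card_subtype_eq, hplaces]
  obtain ⟨e⟩ : Nonempty ({v : InfinitePlace K // v ≠ w'} ≃ Fin (Units.rank K)) := by
    rw [← Fintype.card_eq, hc, Fintype.card_fin, hrank]
  have hreg : Units.regOfFamily (fun _ : Fin (Units.rank K) ↦ η) = Real.log ε := by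
    have hu : Unique {v : InfinitePlace K // v ≠ w'} :=
      { default := ⟨w, hw'.symm⟩
        uniq := fun a ↦ (Fintype.card_le_one_iff_subsingleton.mp hc.le).elim _ _ }
    have hd : (default : {v : InfinitePlace K // v ≠ w'}) = ⟨w, hw'.symm⟩ :=
      (Fintype.card_le_one_iff_subsingleton.mp hc.le).elim _ _
    rw [Units.regOfFamily_eq_det _ w' e, Matrix.det_unique, Matrix.of_apply, hd]
    have h1 : w (algebraMap (𝓞 K) K η) = ε := by
      rw [hw, InfinitePlace.apply, hφη, Complex.norm_real, Real.norm_of_nonneg (by linarith)]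
    rw [h1, InfinitePlace.mult, if_pos (IsTotallyReal.isReal w)]
    rw [Nat.cast_one, one_mul, abs_of_pos (Real.log_pos h1ε)]
  rw [← hreg]
  refine exists_odd_mul_regulator_eq_regOfFamily K _ (by rw [hreg]; exact (Real.log_pos h1ε).ne')
    fun v hv ↦ ?_
  have hne : Nonempty (Fin (Units.rank K)) := ⟨⟨0, by omega⟩⟩
  rw [Set.range_const] at hv ⊢
  rw [Subgroup.mem_sup] at hv
  obtain ⟨y, hy, ζ, hζ, hyζ⟩ := hv
  obtain ⟨k, rfl⟩ := Subgroup.mem_closure_singleton.mp hy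
  obtain ⟨t, ht, -⟩ := h.le_of_isFundUnit hD hφ hε v
  obtain ⟨z, hz, -⟩ := h.le_of_isFundUnit hD hφ hε ζ
  have hzpow (k : ℤ) : φ (algebraMap (𝓞 K) K ((η ^ k : (𝓞 K)ˣ) : 𝓞 K)) = ((ε ^ k : ℝ) : ℂ) := by
    rw [Units.coe_zpow, map_zpow₀, hφη, Complex.ofReal_zpow]
  have hz1 : |z| = 1 := by
    have h1 := (Units.mem_torsion K).mp hζ w
    rw [hw, InfinitePlace.apply] at h1
    rwa [hz, Complex.norm_real] at h1
  have htz : t ^ 2 = ε ^ k * z := by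
    have := congrArg (fun a : (𝓞 K)ˣ ↦ φ (algebraMap (𝓞 K) K a)) hyζ
    simp only [Units.val_mul, Units.val_pow_eq_pow_val, map_mul, map_pow] at this
    rw [hzpow, hz, ht] at this
    exact_mod_cast this.symm
  have hεk : 0 < ε ^ k := by positivity
  have hz' : z = 1 := by
    rcases (abs_eq zero_le_one).mp hz1 with h2 | h2
    · exact h2
    · rw [h2] at htz; nlinarith [sq_nonneg t]
  have hζ1 : ζ = 1 := by
    apply Units.ext
    apply RingOfIntegers.coe_injective
    apply φ.injective
    rw [hz, hz']; simp
  rw [hζ1, mul_one] at hyζ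
  rcases Int.even_or_odd' k with ⟨j, rfl | rfl⟩
  · refine Subgroup.mem_sup.mpr ⟨η ^ j, Subgroup.mem_closure_singleton.mpr ⟨j, rfl⟩,
      v * (η ^ j)⁻¹, ?_, by rw [mul_comm, inv_mul_cancel_right]⟩
    refine (CommGroup.mem_torsion _).mpr (isOfFinOrder_iff_pow_eq_one.mpr ⟨2, by norm_num, ?_⟩)
    rw [mul_pow, ← hyζ, inv_pow, ← zpow_natCast, ← zpow_mul, mul_comm j, Nat.cast_ofNat,
      mul_inv_cancel]
  · exfalso
    refine h.not_sq_eq_of_isFundUnit hD hφ hε (v * (η ^ j)⁻¹) ?_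
    rw [← hφη, ← map_pow, ← map_pow, ← Units.val_pow_eq_pow_val, mul_pow, ← hyζ, inv_pow,
      ← zpow_natCast, ← zpow_mul, zpow_add, mul_comm j, Nat.cast_ofNat, zpow_one,
      mul_inv_cancel_comm]

theorem dedekindZeta_residue_mul_of_isFundUnit (hD : Squarefree (D : ℤ)) {φ : K →+* ℂ}
    (hφ : φ x = (√D : ℝ)) {ε : ℝ} (hε : IsFundUnit D ε) :
    ∃ a b : ℕ, Odd a ∧ Odd b ∧ dedekindZeta_residue K * a * b =
      2 * Real.log ε * classNumber K / √|(discr K : ℝ)| := by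
  have hD0 : (0 : ℤ) < D := by
    refine lt_of_le_of_ne (by positivity) fun h0 ↦ ?_
    exact h.not_isSquare (h0 ▸ ⟨0, by simp⟩)
  have := h.isTotallyReal hD0
  have h1 := IsTotallyReal.nrComplexPlaces_eq_zero K
  have h2 : InfinitePlace.nrRealPlaces K = 2 := by
    rw [← IsTotallyReal.finrank (K := K), h.finrank_eq]
  obtain ⟨n, hn, hw⟩ := h.exists_odd_torsionOrder_eq_two_mul hD (by omega)
  obtain ⟨k, hk, hlog⟩ := h.exists_odd_mul_regulator_eq_log hD hφ hε
  refine ⟨n, k, hn, hk, ?_⟩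
  have hn0 : (n : ℝ) ≠ 0 := by exact_mod_cast hn.pos.ne'
  rw [dedekindZeta_residue_def, h1, h2, hlog, hw]
  push_cast
  field_simp

end IsQuadraticGenerator
end Quadratic

section FixedElements

variable {K : Type*} [Field K] [NumberField K]

theorem exists_add_mul_of_mem_adjoin_insert {S : Set K} {t : K} (ht : t ^ 2 ∈ adjoin ℚ S) {y : K}
    (hy : y ∈ adjoin ℚ (insert t S)) :
    ∃ α ∈ adjoin ℚ S, ∃ β ∈ adjoin ℚ S, y = α + β * t := by
  rw [← mem_toSubalgebra, adjoin_toSubalgebra] at hy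
  induction hy using Algebra.adjoin_induction with
  | mem z hz =>
    rcases hz with rfl | hz
    · exact ⟨0, zero_mem _, 1, one_mem _, by simp⟩
    · exact ⟨z, subset_adjoin _ _ hz, 0, zero_mem _, by simp⟩
  | algebraMap q => exact ⟨_, IntermediateField.algebraMap_mem _ q, 0, zero_mem _, by simp⟩
  | add y z _ _ h1 h2 =>
    obtain ⟨α, hα, β, hβ, rfl⟩ := h1
    obtain ⟨γ, hγ, δ, hδ, rfl⟩ := h2
    exact ⟨α + γ, add_mem hα hγ, β + δ, add_mem hβ hδ, by ring⟩
  | mul y z _ _ h1 h2 =>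
    obtain ⟨α, hα, β, hβ, rfl⟩ := h1
    obtain ⟨γ, hγ, δ, hδ, rfl⟩ := h2
    exact ⟨α * γ + β * δ * t ^ 2, add_mem (mul_mem hα hγ) (mul_mem (mul_mem hβ hδ) ht),
      α * δ + β * γ, add_mem (mul_mem hα hδ) (mul_mem hβ hγ), by ring⟩

theorem galois_apply_eq_of_mem_adjoin {S : Set K} {σ : Gal(K/ℚ)} (hσ : ∀ z ∈ S, σ z = z) {y : K}
    (hy : y ∈ adjoin ℚ S) : σ y = y := by
  induction hy using adjoin_induction with
  | mem z hz => exact hσ z hz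
  | algebraMap q => exact σ.commutes q
  | add y z _ _ h1 h2 => rw [map_add, h1, h2]
  | inv y _ h1 => rw [map_inv₀, h1]
  | mul y z _ _ h1 h2 => rw [map_mul, h1, h2]

theorem mem_adjoin_of_galois_apply_eq {S : Set K} {t : K} (ht : t ^ 2 ∈ adjoin ℚ S)
    {σ : Gal(K/ℚ)} (hσ : ∀ z ∈ S, σ z = z) (hσt : σ t = -t) {y : K}
    (hy : y ∈ adjoin ℚ (insert t S)) (hσy : σ y = y) : y ∈ adjoin ℚ S := by
  obtain ⟨α, hα, β, hβ, rfl⟩ := exists_add_mul_of_mem_adjoin_insert ht hy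
  rw [map_add, map_mul, hσt, galois_apply_eq_of_mem_adjoin hσ hα,
    galois_apply_eq_of_mem_adjoin hσ hβ] at hσy
  have : β * t = 0 := by linear_combination (-1 / 2 : K) * hσy
  rwa [this, add_zero]

end FixedElements

/-- `e` has the form `(X + Y * y) / 2` with `X, Y` integers and `X ^ 2 - Y ^ 2 * y ^ 2 = 4 * N`. -/
def IsQuadraticUnit {K : Type*} [Field K] (y e : K) (N : ℤ) : Prop :=
  ∃ X Y : ℤ, e = (X + Y * y) / 2 ∧ (X : K) ^ 2 - Y ^ 2 * y ^ 2 = 4 * N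

namespace IsQuadraticUnit

variable {K : Type*} [Field K] [NumberField K] {y e : K} {N : ℤ} (h : IsQuadraticUnit y e N)

include h

theorem apply_eq_of_apply_eq {σ : Gal(K/ℚ)} (hσ : σ y = y) : σ e = e := by
  obtain ⟨X, Y, rfl, -⟩ := h
  simp only [map_div₀, map_add, map_mul, map_intCast, hσ, map_ofNat]

theorem apply_mul_self {σ : Gal(K/ℚ)} (hσ : σ y = -y) : e * σ e = N := by
  obtain ⟨X, Y, rfl, hN⟩ := h
  simp only [map_div₀, map_add, map_mul, map_intCast, hσ, map_ofNat]
  linear_combination (1 / 4 : K) * hN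

theorem exists_add_apply {σ : Gal(K/ℚ)} (hσ : σ y = -y) : ∃ X : ℤ, e + σ e = X := by
  obtain ⟨X, Y, rfl, hN⟩ := h
  refine ⟨X, ?_⟩
  simp only [map_div₀, map_add, map_mul, map_intCast, hσ, map_ofNat]
  ring

end IsQuadraticUnit

namespace IsTriquadraticGenerator

variable {K : Type*} [Field K] [NumberField K] {r s t : K} {d : ℤ}
  (h : IsTriquadraticGenerator r s t d)

include h

theorem galois_comm (σ τ : Gal(K/ℚ)) (y : K) : σ (τ y) = τ (σ y) := by
  have : σ * τ = τ * σ := by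
    apply h.galois_ext <;> simp only [AlgEquiv.mul_apply]
    · rcases h.galois_apply_r σ with h1 | h1 <;> rcases h.galois_apply_r τ with h2 | h2 <;>
        simp [h1, h2]
    · rcases h.galois_apply_s σ with h1 | h1 <;> rcases h.galois_apply_s τ with h2 | h2 <;>
        simp [h1, h2]
    · rcases h.galois_apply_t σ with h1 | h1 <;> rcases h.galois_apply_t τ with h2 | h2 <;>
        simp [h1, h2]
  exact DFunLike.congr_fun this y

theorem sq_ne_zeta_mul {e₂ e₁ e₃ : K} {N : ℤ} (h₂ : IsQuadraticUnit r e₂ (-1))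
    (h₁ : IsQuadraticUnit s e₁ N) (h₃ : IsQuadraticUnit (r * s) e₃ (-1)) (h₁0 : e₁ ≠ 0)
    (a b c : ℕ) (v : K) :
    v ^ 2 ≠ (1 + t) / r * (e₂ ^ a * e₁ ^ b * e₃ ^ c) := by
  intro hv
  obtain ⟨σ, hr, hs, ht⟩ := h.exists_galois false true true
  simp only [Bool.false_eq_true, if_false, if_true] at hr hs ht
  have hr2 := h.r_sq
  have ht2 := h.t_sq
  have hr0 := h.r_ne_zero
  have hσσ : σ (σ v) = v := by
    have : σ * σ = 1 := h.galois_ext (by simp [hr]) (by simp [hs]) (by simp [ht])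
    exact DFunLike.congr_fun this v
  have hE₂ := h₂.apply_mul_self hr
  have hE₃ := h₃.apply_mul_self (σ := σ) (by rw [map_mul, hr, hs]; ring)
  have hE₁ := h₁.apply_eq_of_apply_eq hs
  set w := v * σ v / e₁ ^ b with hw
  have hσw : σ w = w := by
    rw [hw, map_div₀, map_mul, map_pow, hσσ, hE₁, mul_comm]
  have hw2 : w ^ 2 = -t * ((-1) ^ a * (-1) ^ c) := by
    have h1 : (v * σ v) ^ 2 = -t * ((-1) ^ a * (-1) ^ c) * (e₁ ^ b) ^ 2 := by
      have h2 : (σ v) ^ 2 = (1 + t) / (-r) * (σ e₂ ^ a * e₁ ^ b * σ e₃ ^ c) := by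
        rw [← map_pow, hv]
        simp only [map_mul, map_div₀, map_add, map_one, map_pow, hr, ht, hE₁]
      have h3 : (1 + t) / r * ((1 + t) / (-r)) = -t := by
        field_simp
        linear_combination t * hr2 - ht2
      calc (v * σ v) ^ 2 = ((1 + t) / r * ((1 + t) / (-r))) *
            ((e₂ * σ e₂) ^ a * (e₃ * σ e₃) ^ c) * (e₁ ^ b) ^ 2 := by
            rw [mul_pow, hv, h2, mul_pow, mul_pow]; ring
        _ = _ := by rw [h3, hE₂, hE₃]; simp
    rw [hw, div_pow, h1, mul_div_cancel_right₀ _ (pow_ne_zero _ (pow_ne_zero _ h₁0))]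
  have hζ : ((1 + t) / r) ^ 2 = t := by
    rw [div_pow, hr2]; linear_combination (1 / 2 : K) * ht2
  have hσζ : σ ((1 + t) / r) = -((1 + t) / r) := by
    rw [map_div₀, map_add, map_one, ht, hr, div_neg]
  have hw4 : w = (1 + t) / r ∨ w = -((1 + t) / r) ∨ w = t * ((1 + t) / r) ∨
      w = -(t * ((1 + t) / r)) := by
    have : w ^ 2 = t ∨ w ^ 2 = -t := by
      rw [hw2, ← pow_add]
      rcases neg_one_pow_eq_or K (a + c) with h1 | h1 <;> simp [h1]
    rcases this with h1 | h1
    · rw [← hζ, sq_eq_sq_iff_eq_or_eq_neg] at h1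
      tauto
    · rw [show -t = (t * ((1 + t) / r)) ^ 2 by rw [mul_pow, hζ, ht2]; ring,
        sq_eq_sq_iff_eq_or_eq_neg] at h1
      tauto
  have hneg : σ w = -w := by
    rcases hw4 with h1 | h1 | h1 | h1 <;> rw [h1] <;> simp only [map_neg, map_mul, ht, hσζ] <;> ring
  have hw0 : w = 0 := by linear_combination (1 / 2 : K) * (hneg - hσw)
  rw [hw0] at hw2
  have ht0 := h.t_ne_zero
  rcases neg_one_pow_eq_or K a with h1 | h1 <;> rcases neg_one_pow_eq_or K c with h2 | h2 <;>
    simp [h1, h2, ht0, ht0.symm] at hw2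

end IsTriquadraticGenerator

theorem exists_real_of_mem_adjoin {K : Type*} [Field K] [CharZero K] {r s : K} {R S : ℝ}
    {φ : K →+* ℂ} (hr : φ r = R ∨ φ r = -R) (hs : φ s = S ∨ φ s = -S) {y : K}
    (hy : y ∈ adjoin ℚ {r, s}) : ∃ x ∈ ℚ⟮R, S⟯, φ y = (x : ℂ) := by
  have hR : R ∈ ℚ⟮R, S⟯ := subset_adjoin _ _ (by simp)
  have hS : S ∈ ℚ⟮R, S⟯ := subset_adjoin _ _ (by simp)
  induction hy using adjoin_induction with
  | mem z hz =>
    rcases hz with rfl | rfl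
    · rcases hr with h1 | h1
      · exact ⟨R, hR, h1⟩
      · exact ⟨-R, neg_mem hR, by simp [h1]⟩
    · rcases hs with h1 | h1
      · exact ⟨S, hS, h1⟩
      · exact ⟨-S, neg_mem hS, by simp [h1]⟩
  | algebraMap q => exact ⟨_, IntermediateField.algebraMap_mem _ q, by simp⟩
  | add y z _ _ h1 h2 =>
    obtain ⟨a, ha, h1⟩ := h1
    obtain ⟨b, hb, h2⟩ := h2
    exact ⟨a + b, add_mem ha hb, by simp [h1, h2]⟩
  | inv y _ h1 =>
    obtain ⟨a, ha, h1⟩ := h1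
    exact ⟨a⁻¹, inv_mem ha, by simp [h1]⟩
  | mul y z _ _ h1 h2 =>
    obtain ⟨a, ha, h1⟩ := h1
    obtain ⟨b, hb, h2⟩ := h2
    exact ⟨a * b, mul_mem ha hb, by simp [h1, h2]⟩

theorem eq_zero_of_mul_sq_add_mul_sq {A B D X e : ℤ} (hD : D % 4 = 1)
    (h1 : A ^ 2 + D * B ^ 2 = 4 * X) (h2 : A ^ 2 - D * B ^ 2 = 8 * e) (he : e = 1 ∨ e = -1) :
    False := by
  obtain ⟨k, hk⟩ : ∃ k, D = 4 * k + 1 := ⟨D / 4, by omega⟩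
  subst hk
  rcases Int.even_or_odd' A with ⟨a, rfl | rfl⟩ <;> rcases Int.even_or_odd' B with ⟨b, rfl | rfl⟩
  · have h3 : a ^ 2 - b ^ 2 - 4 * (k * b ^ 2) = 2 * e := by linarith
    generalize k * b ^ 2 = z at h3
    rcases Int.even_or_odd' a with ⟨a', rfl | rfl⟩ <;>
      rcases Int.even_or_odd' b with ⟨b', rfl | rfl⟩ <;> ring_nf at h3 <;> omega
  · ring_nf at h2; omega
  · ring_nf at h2; omega
  · ring_nf at h1; omega

namespace IsTriquadraticGenerator

variable {K : Type*} [Field K] [NumberField K] {r s t : K} {d : ℤ}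
  (h : IsTriquadraticGenerator r s t d)

include h

theorem mem_adjoin_pair_of_apply_eq {σ : Gal(K/ℚ)} (hr : σ r = r) (hs : σ s = s) (ht : σ t = -t)
    {y : K} (hy : σ y = y) : y ∈ adjoin ℚ {r, s} := by
  refine mem_adjoin_of_galois_apply_eq (t := t) (σ := σ) ?_ ?_ ht ?_ hy
  · rw [h.t_sq]; exact neg_mem (one_mem _)
  · rintro z (rfl | rfl) <;> assumption
  · have : (insert t {r, s} : Set K) = {r, s, t} := by
      ext; simp; tauto
    rw [this, h.adjoin_eq]
    trivial

theorem mem_adjoin_singleton_of_apply_eq {σ τ : Gal(K/ℚ)} (hr : σ r = r) (hs : σ s = s)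
    (ht : σ t = -t) (hr' : τ r = -r) (hs' : τ s = s) {y : K} (hy : σ y = y) (hy' : τ y = y) :
    y ∈ adjoin ℚ {s} := by
  refine mem_adjoin_of_galois_apply_eq (t := r) (σ := τ) ?_ ?_ hr' ?_ hy'
  · rw [h.r_sq]; exact ofNat_mem _ 2
  · rintro z rfl; assumption
  · exact h.mem_adjoin_pair_of_apply_eq hr hs ht hy

theorem exists_int_of_mem_adjoin {y : K} (hy : y ∈ adjoin ℚ {s}) (hi : IsIntegral ℤ y) :
    ∃ A B : ℤ, 2 * y = A + B * s ∧ 4 ∣ A ^ 2 - d * B ^ 2 := by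
  have hi' : IsIntegral ℤ (⟨y, hy⟩ : ℚ⟮s⟯) :=
    (isIntegral_algHom_iff (IntermediateField.val ℚ⟮s⟯ |>.restrictScalars ℤ)
      Subtype.val_injective).mp hi
  obtain ⟨A, B, hAB, h4⟩ := h.isQuadraticGenerator.exists_int_of_isIntegral h.squarefree hi'
  refine ⟨A, B, ?_, h4⟩
  have := congrArg (algebraMap ℚ⟮s⟯ K) hAB
  rwa [map_mul, map_add, map_mul, map_ofNat, map_intCast, map_intCast,
    AdjoinSimple.algebraMap_gen] at this

theorem sq_ne_mul {D : ℕ} (hdD : d = D) {φ : K →+* ℂ} (hφr : φ r = (√2 : ℝ))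
    (hφs : φ s = (√D : ℝ)) {e₂ e₁ e₃ : K} {N : ℤ} (h₂ : IsQuadraticUnit r e₂ (-1))
    (h₁ : IsQuadraticUnit s e₁ N) (h₃ : IsQuadraticUnit (r * s) e₃ (-1)) (hN : N = 1 ∨ N = -1)
    {ε₂ ε₁ ε₃ : ℝ} (h₂ε : φ e₂ = ε₂) (h₁ε : φ e₁ = ε₁) (h₃ε : φ e₃ = ε₃) (h₂0 : 0 < ε₂)
    (h₃0 : 0 < ε₃) (hε : IsFundUnit D ε₁)
    (hsq : ¬ ∃ t : ℝ, t ∈ ℚ⟮√2, √D⟯ ∧ t ^ 2 = ε₂ * ε₁ * ε₃) {a b c : ℕ} (ha : a < 2) (hb : b < 2)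
    (hc : c < 2) {u : K} (hu : IsIntegral ℤ u) (huE : u ^ 2 = e₂ ^ a * e₁ ^ b * e₃ ^ c) :
    a = 0 ∧ b = 0 ∧ c = 0 := by
  have h₁0 : 0 < ε₁ := by linarith [hε.1]
  obtain ⟨σ₁, hr₁, hs₁, ht₁⟩ := h.exists_galois false true true
  obtain ⟨σ₂, hr₂, hs₂, ht₂⟩ := h.exists_galois true false true
  obtain ⟨σ₃, hr₃, hs₃, ht₃⟩ := h.exists_galois true true false
  simp only [Bool.false_eq_true, if_false, if_true] at hr₁ hs₁ ht₁ hr₂ hs₂ ht₂ hr₃ hs₃ ht₃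
  have hφu : φ u ^ 2 = ((ε₂ ^ a * ε₁ ^ b * ε₃ ^ c : ℝ) : ℂ) := by
    rw [← map_pow, huE]
    simp [h₂ε, h₁ε, h₃ε]
  have hpos : 0 < ε₂ ^ a * ε₁ ^ b * ε₃ ^ c := by positivity
  have hE (σ : Gal(K/ℚ)) (hr : σ r = r) (hs : σ s = s) : σ (u ^ 2) = u ^ 2 := by
    rw [huE]
    simp only [map_mul, map_pow, h₂.apply_eq_of_apply_eq hr, h₁.apply_eq_of_apply_eq hs,
      h₃.apply_eq_of_apply_eq (show σ (r * s) = r * s by rw [map_mul, hr, hs])]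
  have hu₃ : σ₃ u = u := by
    have h1 := hE σ₃ hr₃ hs₃
    rw [map_pow, sq_eq_sq_iff_eq_or_eq_neg] at h1
    refine h1.resolve_right fun h2 ↦ ?_
    obtain ⟨x, -, hx⟩ := exists_real_of_mem_adjoin (.inl hφr) (.inl hφs)
      (h.mem_adjoin_pair_of_apply_eq hr₃ hs₃ ht₃ (y := u * t) (by rw [map_mul, h2, ht₃]; ring))
    have h3 : φ (u * t) ^ 2 = ((-(ε₂ ^ a * ε₁ ^ b * ε₃ ^ c) : ℝ) : ℂ) := by
      rw [Complex.ofReal_neg, ← hφu, ← map_pow, ← map_pow, mul_pow, h.t_sq, mul_neg_one, map_neg]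
    rw [hx] at h3
    have h4 : x ^ 2 = -(ε₂ ^ a * ε₁ ^ b * ε₃ ^ c) := by exact_mod_cast h3
    nlinarith [sq_nonneg x]
  have hmem (σ : Gal(K/ℚ)) : σ u ∈ adjoin ℚ {r, s} :=
    h.mem_adjoin_pair_of_apply_eq hr₃ hs₃ ht₃ (by rw [h.galois_comm, hu₃])
  obtain ⟨x, hx, hxu⟩ := exists_real_of_mem_adjoin (.inl hφr) (.inl hφs) (hmem 1)
  rw [AlgEquiv.one_apply] at hxu
  have hsign (σ : Gal(K/ℚ)) {y : ℝ} (hy : φ (u ^ 2 * σ (u ^ 2)) = y) : 0 ≤ y := by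
    obtain ⟨z, -, hz⟩ := exists_real_of_mem_adjoin (.inl hφr) (.inl hφs) (hmem σ)
    rw [map_mul, map_pow, map_pow, map_pow, hxu, hz] at hy
    have : x ^ 2 * z ^ 2 = y := by exact_mod_cast hy
    rw [← this]
    positivity
  have hNK : (N : ℝ) = 1 ∨ (N : ℝ) = -1 := by
    rcases hN with h1 | h1 <;> simp [h1]
  have hs1 : (0 : ℝ) ≤ (-1) ^ a * (ε₁ ^ b) ^ 2 * (-1) ^ c := by
    refine hsign σ₁ ?_
    rw [huE]
    simp only [map_mul, map_pow, h₁.apply_eq_of_apply_eq hs₁]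
    have := congrArg φ (h₂.apply_mul_self hr₁)
    have h' := congrArg φ (h₃.apply_mul_self (σ := σ₁) (by rw [map_mul, hr₁, hs₁]; ring))
    rw [map_mul, map_intCast] at this h'
    calc _ = (φ e₂ * φ (σ₁ e₂)) ^ a * (φ e₁ ^ b) ^ 2 * (φ e₃ * φ (σ₁ e₃)) ^ c := by ring
      _ = _ := by rw [this, h', h₁ε]; simp
  have hs2 : (0 : ℝ) ≤ (ε₂ ^ a) ^ 2 * N ^ b * (-1) ^ c := by
    refine hsign σ₂ ?_
    rw [huE]
    simp only [map_mul, map_pow, h₂.apply_eq_of_apply_eq hr₂]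
    have := congrArg φ (h₁.apply_mul_self hs₂)
    have h' := congrArg φ (h₃.apply_mul_self (σ := σ₂) (by rw [map_mul, hr₂, hs₂]; ring))
    rw [map_mul, map_intCast] at this h'
    calc _ = (φ e₂ ^ a) ^ 2 * (φ e₁ * φ (σ₂ e₁)) ^ b * (φ e₃ * φ (σ₂ e₃)) ^ c := by ring
      _ = _ := by rw [this, h', h₂ε]; simp
  have hac : a = c := by
    have : 0 < (ε₁ ^ b) ^ 2 := by positivity
    interval_cases a <;> interval_cases c <;> simp at hs1 ⊢ <;> nlinarith
  subst hac
  have hx2 : x ^ 2 = ε₂ ^ a * ε₁ ^ b * ε₃ ^ a := by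
    rw [hxu] at hφu; exact_mod_cast hφu
  interval_cases a
  · interval_cases b
    · simp
    exfalso
    have hN1 : N = 1 := by
      rcases hN with h1 | h1
      · exact h1
      · rw [h1] at hs2; norm_num at hs2
    subst hN1
    simp only [pow_zero, pow_one, one_mul, mul_one] at huE hx2
    have hσ₂e := h₁.apply_mul_self hs₂
    have h1 : σ₁ u = u ∨ σ₁ u = -u := by
      rw [← sq_eq_sq_iff_eq_or_eq_neg, ← map_pow, huE, h₁.apply_eq_of_apply_eq hs₁]
    rcases h1 with h1 | h1
    · obtain ⟨A, B, hAB, -⟩ := h.exists_int_of_mem_adjoin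
        (h.mem_adjoin_singleton_of_apply_eq hr₃ hs₃ ht₃ hr₁ hs₁ hu₃ h1) hu
      have hu' : u = (A + B * s) / 2 := by linear_combination (1 / 2 : K) * hAB
      have hxAB : x = (A + B * √D) / 2 := by
        have h2 : (x : ℂ) = (A + B * (√D : ℝ)) / 2 := by
          rw [← hxu, hu', map_div₀, map_add, map_mul, hφs, map_ofNat, map_intCast, map_intCast]
        exact_mod_cast h2
      have hnorm : (A ^ 2 - D * B ^ 2 = 4 ∨ A ^ 2 - D * B ^ 2 = -4) := by
        have h2 : (u * σ₂ u) ^ 2 = 1 := by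
          rw [mul_pow, ← map_pow, huE, hσ₂e]; simp
        have h3 : u * σ₂ u = (A ^ 2 - D * B ^ 2) / 4 := by
          rw [hu']
          simp only [map_div₀, map_add, map_mul, map_intCast, map_ofNat, hs₂]
          have := h.s_sq
          rw [hdD, Int.cast_natCast] at this
          linear_combination (-1 / 4 : K) * B ^ 2 * this
        rw [h3] at h2
        have h4 : ((A : K) ^ 2 - D * B ^ 2) ^ 2 = 4 ^ 2 := by linear_combination 16 * h2
        have h5 : (A ^ 2 - D * B ^ 2) ^ 2 = 4 ^ 2 := by exact_mod_cast h4
        exact sq_eq_sq_iff_eq_or_eq_neg.mp h5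
      have hx1 := hε.1
      rcases lt_or_ge 1 x with h5 | h5
      · have := hε.2.2 A B hnorm (hxAB ▸ h5)
        rw [← hxAB] at this
        nlinarith
      · have h6 : -x = ((-A : ℤ) + (-B : ℤ) * √D) / 2 := by rw [hxAB]; push_cast; ring
        have := hε.2.2 (-A) (-B) (by rwa [neg_sq, neg_sq]) (h6 ▸ (by nlinarith))
        rw [← h6] at this
        nlinarith
    · have hzi : IsIntegral ℤ (u * r) := hu.mul
        (IsIntegral.of_pow two_pos (h.r_sq ▸ map_ofNat (algebraMap ℤ K) 2 ▸ isIntegral_algebraMap))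
      obtain ⟨A, B, hAB, -⟩ := h.exists_int_of_mem_adjoin (h.mem_adjoin_singleton_of_apply_eq
        hr₃ hs₃ ht₃ hr₁ hs₁ (by rw [map_mul, hu₃, hr₃]) (by rw [map_mul, h1, hr₁]; ring)) hzi
      have hs2' := h.s_sq
      have hz2 : (u * r) ^ 2 = 2 * e₁ := by rw [mul_pow, huE, h.r_sq]; ring
      have hσz : 2 * σ₂ (u * r) = A - B * s := by
        have := congrArg σ₂ hAB
        simp only [map_mul, map_add, map_intCast, map_ofNat, hs₂] at this ⊢
        linear_combination this
      have hσz2 : σ₂ (u * r) ^ 2 = 2 * σ₂ e₁ := by rw [← map_pow, hz2, map_mul, map_ofNat]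
      obtain ⟨X, hX⟩ := h₁.exists_add_apply hs₂
      have hA : A ^ 2 + d * B ^ 2 = 4 * X := by
        have : ((A ^ 2 + d * B ^ 2 : ℤ) : K) = ((4 * X : ℤ) : K) := by
          push_cast
          rw [← hX, ← hs2']
          have h3 : 2 * (2 * (u * r)) ^ 2 + 2 * (2 * σ₂ (u * r)) ^ 2 = 16 * (e₁ + σ₂ e₁) := by
            linear_combination 8 * hz2 + 8 * hσz2
          rw [hAB, hσz] at h3
          linear_combination (1 / 4 : K) * h3
        exact_mod_cast this
      have hB : A ^ 2 - d * B ^ 2 = 8 ∨ A ^ 2 - d * B ^ 2 = -8 := by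
        have h3 : ((A ^ 2 - d * B ^ 2) ^ 2 : ℤ) = 8 ^ 2 := by
          have : (((A ^ 2 - d * B ^ 2) ^ 2 : ℤ) : K) = ((8 ^ 2 : ℤ) : K) := by
            push_cast
            rw [← hs2']
            have h3 : ((2 * (u * r)) * (2 * σ₂ (u * r))) ^ 2 = 64 * (e₁ * σ₂ e₁) := by
              calc _ = 16 * (u * r) ^ 2 * σ₂ (u * r) ^ 2 := by ring
                _ = _ := by rw [hz2, hσz2]; ring
            rw [hAB, hσz, hσ₂e] at h3
            push_cast at h3
            linear_combination h3
          exact_mod_cast this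
        exact sq_eq_sq_iff_eq_or_eq_neg.mp h3
      have hmod := h.mod_eight
      rcases hB with hB | hB
      · exact eq_zero_of_mul_sq_add_mul_sq (e := 1) (by omega) hA (by omega) (.inl rfl)
      · exact eq_zero_of_mul_sq_add_mul_sq (e := -1) (by omega) hA (by omega) (.inr rfl)
  · exfalso
    interval_cases b
    · have : 0 < ε₂ ^ 2 := by positivity
      simp at hs2
      linarith
    · exact hsq ⟨x, hx, by rw [hx2]; ring⟩

end IsTriquadraticGenerator

namespace IsTriquadraticGenerator

variable {K : Type*} [Field K] [NumberField K] {r s t : K} {d : ℤ}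
  (h : IsTriquadraticGenerator r s t d)

include h

theorem exists_odd_torsionOrder_eq_eight_mul {e₂ e₁ e₃ : K} {N : ℤ}
    (h₂ : IsQuadraticUnit r e₂ (-1)) (h₁ : IsQuadraticUnit s e₁ N)
    (h₃ : IsQuadraticUnit (r * s) e₃ (-1)) (h₁0 : e₁ ≠ 0) :
    ∃ n : ℕ, Odd n ∧ Units.torsionOrder K = 8 * n := by
  have hζ := h.isPrimitiveRoot
  refine exists_odd_torsionOrder_eq K 3 (by norm_num; exact hζ) fun ξ hξ ↦ ?_
  have h8 : IsPrimitiveRoot (ξ ^ 2) 8 := hξ.pow (a := 2) (b := 8) (by norm_num) (by norm_num)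
  obtain ⟨i, -, hi, hiξ⟩ := hζ.isPrimitiveRoot_iff.mp h8
  have hodd : Odd i := by
    rw [← Nat.not_even_iff_odd, even_iff_two_dvd]
    intro h2
    have := Nat.dvd_gcd h2 (show 2 ∣ 8 by norm_num)
    rw [hi.gcd_eq_one] at this
    omega
  obtain ⟨j, rfl⟩ := hodd
  have hζ0 : (1 + t) / r ≠ 0 := hζ.ne_zero (by norm_num)
  refine h.sq_ne_zeta_mul h₂ h₁ h₃ h₁0 0 0 0 (ξ / ((1 + t) / r) ^ j) ?_
  rw [div_pow, ← hiξ, pow_succ, ← pow_mul, mul_comm 2 j, mul_div_cancel_left₀ _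
    (pow_ne_zero _ hζ0)]
  simp

end IsTriquadraticGenerator

theorem exists_sq_of_mem_torsion {K : Type*} [Field K] [NumberField K] {Z : (𝓞 K)ˣ}
    (hZ : Z ∈ Units.torsion K)
    (hZ' : ∀ v : (𝓞 K)ˣ, v ^ 2 ≠ Z) {ζ : (𝓞 K)ˣ} (hζ : ζ ∈ Units.torsion K) :
    ∃ η ∈ Units.torsion K, ζ = η ^ 2 ∨ ζ = Z * η ^ 2 := by
  obtain ⟨⟨g, hgt⟩, hg⟩ := IsCyclic.exists_generator (α := Units.torsion K)
  have hg' (y : (𝓞 K)ˣ) (hy : y ∈ Units.torsion K) : ∃ k : ℤ, g ^ k = y := by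
    obtain ⟨k, hk⟩ := Subgroup.mem_zpowers_iff.mp (hg ⟨y, hy⟩)
    exact ⟨k, by simpa using congrArg Subtype.val hk⟩
  obtain ⟨k, rfl⟩ := hg' Z hZ
  obtain ⟨n, rfl⟩ := hg' ζ hζ
  have hsq (j : ℤ) : (g ^ j) ^ 2 = g ^ (2 * j) := by
    rw [mul_comm, zpow_mul, ← zpow_natCast (g ^ j), Nat.cast_ofNat]
  rcases Int.even_or_odd' k with ⟨i, rfl | rfl⟩
  · exact absurd (hsq i) (hZ' _)
  rcases Int.even_or_odd' n with ⟨j, rfl | rfl⟩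
  · exact ⟨g ^ j, zpow_mem hgt j, .inl (hsq j).symm⟩
  · refine ⟨g ^ (j - i), zpow_mem hgt _, .inr ?_⟩
    rw [hsq, ← zpow_add]
    congr 1
    ring

theorem exists_sq_mul_of_mem_closure {G : Type*} [CommGroup G] (e₁ e₂ e₃ : G) {y : G}
    (hy : y ∈ Subgroup.closure (Set.range ![e₁, e₂, e₃])) :
    ∃ z ∈ Subgroup.closure (Set.range ![e₁, e₂, e₃]), ∃ a b c : ℕ, a < 2 ∧ b < 2 ∧ c < 2 ∧
      y = z ^ 2 * (e₁ ^ a * e₂ ^ b * e₃ ^ c) := by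
  have hmem (i : Fin 3) : ![e₁, e₂, e₃] i ∈ Subgroup.closure (Set.range ![e₁, e₂, e₃]) :=
    Subgroup.subset_closure ⟨i, rfl⟩
  obtain ⟨k, rfl⟩ := Subgroup.mem_closure_range_iff_of_fintype.mp hy
  have hsplit (g : G) (n : ℤ) : ∃ a : ℕ, a < 2 ∧ g ^ n = (g ^ (n / 2)) ^ 2 * g ^ a := by
    refine ⟨(n % 2).toNat, by omega, ?_⟩
    rw [← zpow_natCast, ← zpow_natCast, Int.toNat_of_nonneg (by omega), ← zpow_mul, ← zpow_add]
    congr 1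
    push_cast
    omega
  obtain ⟨a, ha, ha'⟩ := hsplit e₁ (k 0)
  obtain ⟨b, hb, hb'⟩ := hsplit e₂ (k 1)
  obtain ⟨c, hc, hc'⟩ := hsplit e₃ (k 2)
  refine ⟨e₁ ^ (k 0 / 2) * e₂ ^ (k 1 / 2) * e₃ ^ (k 2 / 2), ?_, a, b, c, ha, hb, hc, ?_⟩
  · exact mul_mem (mul_mem (zpow_mem (hmem 0) _) (zpow_mem (hmem 1) _)) (zpow_mem (hmem 2) _)
  · rw [Fin.prod_univ_three]
    simp only [Matrix.cons_val_zero, Matrix.cons_val_one, Matrix.cons_val]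
    rw [ha', hb', hc', mul_pow, mul_pow,
      mul_mul_mul_comm (_ ^ 2) (e₁ ^ a), mul_mul_mul_comm (_ * _) (e₁ ^ a * e₂ ^ b)]

namespace IsTriquadraticGenerator

variable {K : Type*} [Field K] [NumberField K] {r s t : K} {d : ℤ}
  (h : IsTriquadraticGenerator r s t d)

include h

theorem mem_closure_sup_torsion_of_sq_mem {D : ℕ} (hdD : d = D) {φ : K →+* ℂ}
    (hφr : φ r = (√2 : ℝ)) (hφs : φ s = (√D : ℝ)) {e₂ e₁ e₃ : (𝓞 K)ˣ} {N : ℤ}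
    (h₂ : IsQuadraticUnit r (algebraMap (𝓞 K) K e₂) (-1))
    (h₁ : IsQuadraticUnit s (algebraMap (𝓞 K) K e₁) N)
    (h₃ : IsQuadraticUnit (r * s) (algebraMap (𝓞 K) K e₃) (-1)) (hN : N = 1 ∨ N = -1)
    {ε₂ ε₁ ε₃ : ℝ} (h₂ε : φ (algebraMap (𝓞 K) K e₂) = ε₂) (h₁ε : φ (algebraMap (𝓞 K) K e₁) = ε₁)
    (h₃ε : φ (algebraMap (𝓞 K) K e₃) = ε₃) (h₂0 : 0 < ε₂)
    (h₃0 : 0 < ε₃) (hε : IsFundUnit D ε₁)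
    (hsq : ¬ ∃ t : ℝ, t ∈ ℚ⟮√2, √D⟯ ∧ t ^ 2 = ε₂ * ε₁ * ε₃) {v : (𝓞 K)ˣ}
    (hv : v ^ 2 ∈ Subgroup.closure (Set.range ![e₂, e₁, e₃]) ⊔ Units.torsion K) :
    v ∈ Subgroup.closure (Set.range ![e₂, e₁, e₃]) ⊔ Units.torsion K := by
  have h₁0 : algebraMap (𝓞 K) K e₁ ≠ 0 := Units.coe_ne_zero e₁
  have hζ8 := h.isPrimitiveRoot
  obtain ⟨Z, hZ⟩ : ∃ Z : (𝓞 K)ˣ, algebraMap (𝓞 K) K Z = (1 + t) / r := by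
    obtain ⟨z, hz⟩ : ∃ z : 𝓞 K, algebraMap (𝓞 K) K z = (1 + t) / r :=
      ⟨⟨_, hζ8.isIntegral (by norm_num)⟩, rfl⟩
    have hz8 : z ^ 8 = 1 := RingOfIntegers.coe_injective (by
      rw [map_pow, hz, map_one, hζ8.pow_eq_one])
    exact ⟨Units.ofPowEqOne z 8 hz8 (by norm_num), hz⟩
  have hZt : Z ∈ Units.torsion K := by
    refine (CommGroup.mem_torsion _).mpr (isOfFinOrder_iff_pow_eq_one.mpr ⟨8, by norm_num, ?_⟩)
    apply Units.ext
    apply RingOfIntegers.coe_injective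
    rw [Units.val_pow_eq_pow_val, map_pow, hZ, hζ8.pow_eq_one, Units.val_one, map_one]
  have hZsq (a b c : ℕ) (u : (𝓞 K)ˣ) : u ^ 2 ≠ Z * (e₂ ^ a * e₁ ^ b * e₃ ^ c) := by
    intro hu
    have := congrArg (fun y : (𝓞 K)ˣ ↦ algebraMap (𝓞 K) K y) hu
    simp only [Units.val_mul, Units.val_pow_eq_pow_val, map_mul, map_pow, hZ] at this
    exact h.sq_ne_zeta_mul h₂ h₁ h₃ h₁0 a b c _ this
  obtain ⟨y, hy, ζ, hζ, hyζ⟩ := Subgroup.mem_sup.mp hv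
  obtain ⟨z, hz, a, b, c, ha, hb, hc, rfl⟩ := exists_sq_mul_of_mem_closure e₂ e₁ e₃ hy
  obtain ⟨η, hη, hηζ⟩ := exists_sq_of_mem_torsion hZt
    (fun u hu ↦ hZsq 0 0 0 u (by simpa using hu)) hζ
  obtain ⟨u, rfl⟩ : ∃ u, v = z * η * u := ⟨(z * η)⁻¹ * v, (mul_inv_cancel_left _ _).symm⟩
  refine mul_mem (mul_mem (Subgroup.mem_sup_left hz) (Subgroup.mem_sup_right hη))
    (Subgroup.mem_sup_right ?_)
  rw [mul_pow, mul_pow] at hyζ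
  rcases hηζ with rfl | rfl
  · have hu : u ^ 2 = e₂ ^ a * e₁ ^ b * e₃ ^ c := by
      rw [mul_right_comm] at hyζ
      exact (mul_left_cancel hyζ).symm
    have huK := congrArg (fun y : (𝓞 K)ˣ ↦ algebraMap (𝓞 K) K y) hu
    simp only [Units.val_mul, Units.val_pow_eq_pow_val, map_mul, map_pow] at huK
    obtain ⟨rfl, rfl, rfl⟩ := h.sq_ne_mul hdD hφr hφs h₂ h₁ h₃ hN h₂ε h₁ε h₃ε h₂0 h₃0 hε hsq
      ha hb hc (RingOfIntegers.isIntegral_coe _) huK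
    exact (CommGroup.mem_torsion _).mpr (isOfFinOrder_iff_pow_eq_one.mpr
      ⟨2, by norm_num, by simpa using hu⟩)
  · refine absurd ?_ (hZsq a b c u)
    have : z ^ 2 * η ^ 2 * (Z * (e₂ ^ a * e₁ ^ b * e₃ ^ c)) = z ^ 2 * η ^ 2 * u ^ 2 := by
      rw [← hyζ]
      simp only [mul_assoc, mul_left_comm, mul_comm]
    exact (mul_left_cancel this).symm

end IsTriquadraticGenerator

theorem IsQuadraticUnit.log_norm_apply {K : Type*} [Field K] [NumberField K] {y e : K} {N : ℤ}
    (h : IsQuadraticUnit y e N) (hN : N = 1 ∨ N = -1) {φ : K →+* ℂ} {ε : ℝ} (hε : φ e = ε)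
    (h0 : 0 < ε) {σ : Gal(K/ℚ)} {b : Bool} (hσ : σ y = if b then y else -y) :
    Real.log ‖φ (σ e)‖ = (if b then 1 else -1) * Real.log ε := by
  cases b
  · have h1 : ‖φ e‖ * ‖φ (σ e)‖ = 1 := by
      rw [← norm_mul, ← map_mul, h.apply_mul_self (by simpa using hσ), map_intCast]
      rcases hN with rfl | rfl <;> simp
    rw [hε, Complex.norm_real, Real.norm_of_nonneg h0.le] at h1
    rw [eq_inv_of_mul_eq_one_right h1, Real.log_inv]
    simp
  · rw [h.apply_eq_of_apply_eq (by simpa using hσ), hε, Complex.norm_real,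
      Real.norm_of_nonneg h0.le]
    simp

namespace IsTriquadraticGenerator

variable {K : Type*} [Field K] [NumberField K] {r s t : K} {d : ℤ}
  (h : IsTriquadraticGenerator r s t d)

include h

theorem isTotallyComplex : IsTotallyComplex K :=
  isTotallyComplex_of_sq_eq (y := t) (n := -1) (by rw [h.t_sq]; simp) (by norm_num)

theorem card_infinitePlace : Fintype.card (InfinitePlace K) = 4 := by
  have := h.isTotallyComplex
  have h1 := IsTotallyComplex.finrank (K := K)
  rw [h.isGalois_finrank_discr.2.1] at h1
  have h2 := IsTotallyComplex.nrRealPlaces_eq_zero K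
  have h3 := InfinitePlace.card_eq_nrRealPlaces_add_nrComplexPlaces K
  omega

theorem rank_eq_three : Units.rank K = 3 := by
  rw [Units.rank, h.card_infinitePlace]

theorem exists_odd_mul_regulator_eq {D : ℕ} (hdD : d = D) {φ : K →+* ℂ}
    (hφr : φ r = (√2 : ℝ)) (hφs : φ s = (√D : ℝ)) {e₂ e₁ e₃ : (𝓞 K)ˣ} {N : ℤ}
    (h₂ : IsQuadraticUnit r (algebraMap (𝓞 K) K e₂) (-1))
    (h₁ : IsQuadraticUnit s (algebraMap (𝓞 K) K e₁) N)
    (h₃ : IsQuadraticUnit (r * s) (algebraMap (𝓞 K) K e₃) (-1)) (hN : N = 1 ∨ N = -1)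
    {ε₂ ε₁ ε₃ : ℝ} (h₂ε : φ (algebraMap (𝓞 K) K e₂) = ε₂) (h₁ε : φ (algebraMap (𝓞 K) K e₁) = ε₁)
    (h₃ε : φ (algebraMap (𝓞 K) K e₃) = ε₃) (h₂0 : 1 < ε₂) (h₃0 : 1 < ε₃) (hε : IsFundUnit D ε₁)
    (hsq : ¬ ∃ t : ℝ, t ∈ ℚ⟮√2, √D⟯ ∧ t ^ 2 = ε₂ * ε₁ * ε₃) :
    ∃ n : ℕ, Odd n ∧
      32 * (Real.log ε₂ * Real.log ε₁ * Real.log ε₃) = n * Units.regulator K := by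
  classical
  have hcard := h.card_infinitePlace
  have hrank := h.rank_eq_three
  have hlog₂ := Real.log_pos h₂0
  have hlog₁ := Real.log_pos hε.1
  have hlog₃ := Real.log_pos h₃0
  choose σ hσr hσs hσt using fun b c ↦ h.exists_galois b c true
  let f : Bool × Bool → InfinitePlace K := fun x ↦ InfinitePlace.mk (φ.comp (σ x.1 x.2 : K →+* K))
  have hf₂ (x) : Real.log (f x (algebraMap (𝓞 K) K e₂)) =
      (if x.1 then 1 else -1) * Real.log ε₂ :=
    h₂.log_norm_apply (.inr rfl) h₂ε (by linarith) (hσr x.1 x.2)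
  have hf₁ (x) : Real.log (f x (algebraMap (𝓞 K) K e₁)) =
      (if x.2 then 1 else -1) * Real.log ε₁ :=
    h₁.log_norm_apply hN h₁ε (by linarith [hε.1]) (hσs x.1 x.2)
  have hf₃ (x) : Real.log (f x (algebraMap (𝓞 K) K e₃)) =
      (if x.1 == x.2 then 1 else -1) * Real.log ε₃ := by
    refine h₃.log_norm_apply (.inr rfl) h₃ε (by linarith) (σ := σ x.1 x.2) ?_
    rw [map_mul, hσr, hσs]
    obtain ⟨_ | _, _ | _⟩ := x <;> simp
  have hf : Function.Injective f := fun x y hxy ↦ by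
    have h2 := hf₂ x
    have h1 := hf₁ x
    rw [hxy, hf₂ y] at h2
    rw [hxy, hf₁ y] at h1
    have h2' := mul_right_cancel₀ hlog₂.ne' h2
    have h1' := mul_right_cancel₀ hlog₁.ne' h1
    have hb {b b' : Bool} (hbb : (if b then (1 : ℝ) else -1) = if b' then 1 else -1) : b = b' := by
      cases b <;> cases b' <;> first | rfl | norm_num at hbb
    exact Prod.ext (hb h2'.symm) (hb h1'.symm)
  let p : Fin 3 → Bool × Bool := ![(false, true), (true, false), (false, false)]
  have hp : Function.Injective p := by decide
  let g₀ : Fin 3 → {w // w ≠ f (true, true)} :=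
    fun i ↦ ⟨f (p i), hf.ne (by revert i; decide)⟩
  have hg₀ : Function.Bijective g₀ := by
    refine (Fintype.bijective_iff_injective_and_card g₀).mpr ⟨fun i j hij ↦ ?_, ?_⟩
    · exact hp (hf (congrArg Subtype.val hij))
    · rw [Fintype.card_subtype_compl, Fintype.card_subtype_eq, hcard, Fintype.card_fin]
  let g := Equiv.ofBijective g₀ hg₀
  let u : Fin (Units.rank K) → (𝓞 K)ˣ := ![e₂, e₁, e₃] ∘ finCongr hrank
  have hu : Set.range u = Set.range ![e₂, e₁, e₃] := (finCongr hrank).surjective.range_comp _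
  have hreg : Units.regOfFamily u = 32 * (Real.log ε₂ * Real.log ε₁ * Real.log ε₃) := by
    rw [Units.regOfFamily_eq_det u (f (true, true)) (g.symm.trans (finCongr hrank.symm)),
      ← Matrix.det_submatrix_equiv_self g, Matrix.det_fin_three]
    have hmult (w : InfinitePlace K) : w.mult = 2 := by
      have := h.isTotallyComplex
      exact InfinitePlace.mult_isComplex ⟨w, IsTotallyComplex.isComplex w⟩
    have hg (i : Fin 3) : (g i).val = f (p i) := rfl
    simp only [Matrix.submatrix_apply, Matrix.of_apply, hmult, hg, u, Function.comp_apply,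
      Equiv.trans_apply, Equiv.symm_apply_apply, finCongr_apply, Fin.cast_cast, Fin.cast_eq_self,
      Matrix.cons_val_zero, Matrix.cons_val_one, Matrix.cons_val, hf₂, hf₁, hf₃, p]
    rw [← abs_of_pos (show 0 < 32 * (Real.log ε₂ * Real.log ε₁ * Real.log ε₃) by positivity)]
    congr 1
    norm_num
    ring
  have h0 : Units.regOfFamily u ≠ 0 := by
    rw [hreg]
    positivity
  obtain ⟨n, hn, hn'⟩ := exists_odd_mul_regulator_eq_regOfFamily K u h0 fun v hv ↦ by
    rw [hu] at hv ⊢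
    exact h.mem_closure_sup_torsion_of_sq_mem hdD hφr hφs h₂ h₁ h₃ hN h₂ε h₁ε h₃ε (by linarith)
      (by linarith) hε hsq hv
  exact ⟨n, hn, hreg ▸ hn'⟩

theorem dedekindZeta_residue_mul_eq {D : ℕ} (hdD : d = D) {φ : K →+* ℂ}
    (hφr : φ r = (√2 : ℝ)) (hφs : φ s = (√D : ℝ)) {e₂ e₁ e₃ : (𝓞 K)ˣ} {N : ℤ}
    (h₂ : IsQuadraticUnit r (algebraMap (𝓞 K) K e₂) (-1))
    (h₁ : IsQuadraticUnit s (algebraMap (𝓞 K) K e₁) N)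
    (h₃ : IsQuadraticUnit (r * s) (algebraMap (𝓞 K) K e₃) (-1)) (hN : N = 1 ∨ N = -1)
    {ε₂ ε₁ ε₃ : ℝ} (h₂ε : φ (algebraMap (𝓞 K) K e₂) = ε₂) (h₁ε : φ (algebraMap (𝓞 K) K e₁) = ε₁)
    (h₃ε : φ (algebraMap (𝓞 K) K e₃) = ε₃) (h₂0 : 1 < ε₂) (h₃0 : 1 < ε₃) (hε : IsFundUnit D ε₁)
    (hsq : ¬ ∃ t : ℝ, t ∈ ℚ⟮√2, √D⟯ ∧ t ^ 2 = ε₂ * ε₁ * ε₃) :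
    ∃ a b : ℕ, Odd a ∧ Odd b ∧ dedekindZeta_residue K * a * b =
      Real.pi ^ 4 * (Real.log ε₂ * Real.log ε₁ * Real.log ε₃) * classNumber K /
        (4 * D ^ 2) := by
  obtain ⟨n, hn, hn'⟩ := h.exists_odd_mul_regulator_eq hdD hφr hφs h₂ h₁ h₃ hN h₂ε h₁ε h₃ε h₂0 h₃0
    hε hsq
  obtain ⟨m, hm, hm'⟩ := h.exists_odd_torsionOrder_eq_eight_mul h₂ h₁ h₃ (Units.coe_ne_zero e₁)
  have hD0 : (D : ℝ) ≠ 0 := by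
    have := h.squarefree.ne_zero
    rw [hdD] at this
    exact_mod_cast this
  refine ⟨n, m, hn, hm, ?_⟩
  have hm0 : (m : ℝ) ≠ 0 := by exact_mod_cast hm.pos.ne'
  have := h.isTotallyComplex
  have h1 := IsTotallyComplex.nrRealPlaces_eq_zero K
  have h2 := InfinitePlace.card_eq_nrRealPlaces_add_nrComplexPlaces K
  rw [h.card_infinitePlace, h1, zero_add] at h2
  have hdisc : √|(discr K : ℝ)| = 256 * D ^ 2 := by
    have h3 : |(discr K : ℝ)| = (256 * (D : ℝ) ^ 2) ^ 2 := by
      rw [← Int.cast_abs, Int.abs_eq_natAbs, h.isGalois_finrank_discr.2.2, hdD]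
      push_cast [Int.natAbs_natCast]
      ring
    rw [h3, Real.sqrt_sq (by positivity)]
  rw [dedekindZeta_residue_def, h1, ← h2, hdisc, hm']
  push_cast
  field_simp
  linear_combination (-64 * classNumber K : ℝ) * hn'

end IsTriquadraticGenerator

section TernaryForms

theorem dvd_of_mul_sq_eq_sq_add {p : ℕ} [Fact p.Prime] {a b : ℤ} (ha : ¬ IsSquare (a : ZMod p))
    (hb : ¬ (p : ℤ) ∣ b) {X Y Z : ℤ} (h : a * X ^ 2 = Y ^ 2 + b * p * Z ^ 2) :
    (p : ℤ) ∣ X ∧ (p : ℤ) ∣ Y ∧ (p : ℤ) ∣ Z := by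
  have hp : Prime (p : ℤ) := Nat.prime_iff_prime_int.mp Fact.out
  have h1 := congrArg (Int.cast : ℤ → ZMod p) h
  push_cast at h1
  rw [ZMod.natCast_self, mul_zero, zero_mul, add_zero] at h1
  have hX : (X : ZMod p) = 0 := by
    by_contra hX
    refine ha ⟨Y / X, ?_⟩
    field_simp
    exact h1
  have hY : (Y : ZMod p) = 0 := by
    rw [hX] at h1
    simpa using h1.symm
  rw [ZMod.intCast_zmod_eq_zero_iff_dvd] at hX hY
  refine ⟨hX, hY, ?_⟩
  obtain ⟨X, rfl⟩ := hX
  obtain ⟨Y, rfl⟩ := hY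
  have h2 : b * Z ^ 2 = p * (a * X ^ 2 - Y ^ 2) := by
    apply mul_left_cancel₀ hp.ne_zero
    linear_combination -h
  exact hp.dvd_of_dvd_pow ((hp.dvd_or_dvd ⟨_, h2⟩).resolve_left hb)

theorem eq_zero_of_mul_sq_eq_sq_add {p : ℕ} [Fact p.Prime] {a b : ℤ}
    (ha : ¬ IsSquare (a : ZMod p)) (hb : ¬ (p : ℤ) ∣ b) {X Y Z : ℤ}
    (h : a * X ^ 2 = Y ^ 2 + b * p * Z ^ 2) : X = 0 ∧ Y = 0 := by
  have hp : Prime (p : ℤ) := Nat.prime_iff_prime_int.mp Fact.out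
  have key (k : ℕ) : ∀ X Y Z : ℤ, a * X ^ 2 = Y ^ 2 + b * p * Z ^ 2 →
      (p : ℤ) ^ k ∣ X ∧ (p : ℤ) ^ k ∣ Y := by
    induction k with
    | zero => exact fun X Y Z _ ↦ by simp
    | succ k ih =>
      intro X Y Z h
      obtain ⟨⟨X, rfl⟩, ⟨Y, rfl⟩, ⟨Z, rfl⟩⟩ := dvd_of_mul_sq_eq_sq_add ha hb h
      obtain ⟨h1, h2⟩ := ih X Y Z (by
        apply mul_left_cancel₀ (pow_ne_zero 2 hp.ne_zero)
        linear_combination h)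
      rw [pow_succ']
      exact ⟨mul_dvd_mul_left _ h1, mul_dvd_mul_left _ h2⟩
  have hzero (W : ℤ) (hW : ∀ k : ℕ, (p : ℤ) ^ k ∣ W) : W = 0 := by
    by_contra h0
    exact (FiniteMultiplicity.of_prime_left hp h0).not_pow_dvd_of_multiplicity_lt
      (Nat.lt_succ_self _) (hW _)
  exact ⟨hzero X fun k ↦ (key k X Y Z h).1, hzero Y fun k ↦ (key k X Y Z h).2⟩

theorem legendreSym_eq_one_of_mod_eight {p : ℕ} [Fact p.Prime] (hp : p % 8 = 5) {δ : ℤ}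
    (hδ : δ = 1 ∨ δ = -1) : legendreSym p δ = 1 := by
  rcases hδ with rfl | rfl
  · exact legendreSym.at_one p
  · rw [legendreSym.at_neg_one (by omega)]
    exact ZMod.χ₄_nat_one_mod_four (by omega)

theorem legendreSym_two_of_mod_eight {p : ℕ} [Fact p.Prime] (hp : p % 8 = 5) :
    legendreSym p 2 = -1 := by
  rw [legendreSym.eq_neg_one_iff]
  push_cast
  rw [ZMod.exists_sq_eq_two_iff (by omega)]
  omega

theorem eq_zero_of_mul_sq_eq_sub {p₁ p₂ : ℕ} (hp₁ : p₁.Prime) (hp₂ : p₂.Prime) (hne : p₁ ≠ p₂)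
    (hm₁ : p₁ % 8 = 5) (hm₂ : p₂ % 8 = 5) {m e δ η : ℤ} (hη : η = 1 ∨ η = -1)
    (hm : m = η * 2 * p₁ * p₂) (he : e = 2 ∨ e = p₁ ∨ e = p₂) (hδ : δ = 1 ∨ δ = -1) {x y n : ℤ}
    (h : e * n ^ 2 = δ * (x ^ 2 - m * y ^ 2)) : n = 0 := by
  subst hm
  have hδ2 : δ * δ = 1 := by rcases hδ with rfl | rfl <;> rfl
  have hη2 : η * η = 1 := by rcases hη with rfl | rfl <;> rfl
  wlog h12 : e = 2 ∨ e = p₁ generalizing p₁ p₂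
  · have he₂ : e = p₂ := by tauto
    exact this hp₂ hp₁ hne.symm hm₂ hm₁ (by tauto) (by rw [h]; ring) (.inr he₂)
  have : Fact p₁.Prime := ⟨hp₁⟩
  have : Fact p₂.Prime := ⟨hp₂⟩
  have hP₁ : Prime (p₁ : ℤ) := Nat.prime_iff_prime_int.mp hp₁
  have hP₂ : Prime (p₂ : ℤ) := Nat.prime_iff_prime_int.mp hp₂
  have hu {p : ℤ} (hp : Prime p) {u : ℤ} (hu : u = 1 ∨ u = -1) : ¬ p ∣ u := fun hd ↦
    hp.not_isUnit (isUnit_of_dvd_unit hd (Int.isUnit_iff.mpr hu))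
  have h2 {p : ℕ} (hp : p.Prime) (hm : p % 8 = 5) : ¬ (p : ℤ) ∣ 2 := fun hd ↦ by
    have := Nat.le_of_dvd (by norm_num) (Int.natCast_dvd_natCast.mp hd)
    interval_cases p <;> omega
  have hdvd₁ : ¬ (p₁ : ℤ) ∣ p₂ := fun hd ↦
    hne ((Nat.prime_dvd_prime_iff_eq hp₁ hp₂).mp (Int.natCast_dvd_natCast.mp hd))
  have hdvd₂ : ¬ (p₂ : ℤ) ∣ p₁ := fun hd ↦
    hne.symm ((Nat.prime_dvd_prime_iff_eq hp₂ hp₁).mp (Int.natCast_dvd_natCast.mp hd))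
  rcases h12 with rfl | rfl
  · refine (eq_zero_of_mul_sq_eq_sq_add (p := p₁) (a := δ * 2) (b := -(η * 2 * p₂)) (X := n)
      (Y := x) (Z := y) ?_ ?_ ?_).1
    · rw [← legendreSym.eq_neg_one_iff, legendreSym.mul, legendreSym_eq_one_of_mod_eight hm₁ hδ,
        legendreSym_two_of_mod_eight hm₁, one_mul]
    · rw [dvd_neg, hP₁.dvd_mul, hP₁.dvd_mul]
      exact not_or_intro (not_or_intro (hu hP₁ hη) (h2 hp₁ hm₁)) hdvd₁
    · linear_combination δ * h + (x ^ 2 - η * 2 * p₁ * p₂ * y ^ 2) * hδ2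
  · obtain ⟨x, rfl⟩ : (p₁ : ℤ) ∣ x := by
      refine hP₁.dvd_of_dvd_pow (n := 2) ⟨δ * n ^ 2 + η * 2 * p₂ * y ^ 2, ?_⟩
      linear_combination -δ * h - (x ^ 2 - η * 2 * p₁ * p₂ * y ^ 2) * hδ2
    have h' : n ^ 2 = δ * (p₁ * x ^ 2 - η * 2 * p₂ * y ^ 2) := by
      apply mul_left_cancel₀ hP₁.ne_zero
      linear_combination h
    have hne2 : legendreSym p₂ p₁ = legendreSym p₁ p₂ :=
      legendreSym.quadratic_reciprocity_one_mod_four (by omega) (by omega)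
    have hp₁0 : ((p₁ : ℤ) : ZMod p₂) ≠ 0 := by
      rwa [Ne, ZMod.intCast_zmod_eq_zero_iff_dvd]
    rcases legendreSym.eq_one_or_neg_one p₂ hp₁0 with hl | hl
    · refine (eq_zero_of_mul_sq_eq_sq_add (p := p₁) (a := -δ * η * 2 * p₂) (b := -δ) (X := y)
        (Y := n) (Z := x) ?_ ?_ ?_).2
      · rw [← legendreSym.eq_neg_one_iff, legendreSym.mul, legendreSym.mul, legendreSym.mul,
          legendreSym_eq_one_of_mod_eight hm₁ hη, legendreSym_two_of_mod_eight hm₁,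
          legendreSym_eq_one_of_mod_eight hm₁ (by omega), ← hne2, hl]
        rfl
      · exact hu hP₁ (by omega)
      · linear_combination -h'
    · refine (eq_zero_of_mul_sq_eq_sq_add (p := p₂) (a := δ * p₁) (b := δ * η * 2) (X := x)
        (Y := n) (Z := y) ?_ ?_ ?_).2
      · rw [← legendreSym.eq_neg_one_iff, legendreSym.mul,
          legendreSym_eq_one_of_mod_eight hm₂ hδ, hl, one_mul]
      · rw [hP₂.dvd_mul, hP₂.dvd_mul]
        exact not_or_intro (not_or_intro (hu hP₂ hδ) (hu hP₂ hη)) (h2 hp₂ hm₂)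
      · linear_combination -h'

end TernaryForms

section FundamentalUnits

theorem exists_sq_of_coprime_mul_eq {k l D z : ℕ} (hD : D ≠ 0) (hkl : k.Coprime l)
    (h : k * l = D * z ^ 2) : ∃ a b u v : ℕ, a * b = D ∧ k = a * u ^ 2 ∧ l = b * v ^ 2 := by
  have hab : D.gcd k * D.gcd l = D := by
    rw [← hkl.gcd_mul, h, Nat.gcd_mul_right_right]
  obtain ⟨k', hk'⟩ := D.gcd_dvd_right k
  obtain ⟨l', hl'⟩ := D.gcd_dvd_right l
  set a := D.gcd k
  set b := D.gcd l
  have hcop : k'.Coprime l' := Nat.Coprime.of_dvd ⟨a, by rw [hk', mul_comm]⟩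
    ⟨b, by rw [hl', mul_comm]⟩ hkl
  have hsq : k' * l' = z ^ 2 := by
    apply Nat.eq_of_mul_eq_mul_left (Nat.pos_of_ne_zero hD)
    rw [← h, hk', hl', ← hab]
    ring
  obtain ⟨u, rfl⟩ := exists_eq_pow_of_mul_eq_pow (Nat.isUnit_iff.mpr hcop) hsq
  obtain ⟨v, rfl⟩ := exists_eq_pow_of_mul_eq_pow (Nat.isUnit_iff.mpr hcop.symm)
    ((mul_comm _ _).trans hsq)
  exact ⟨a, b, u, v, hab, hk', hl'⟩

theorem sq_add_one_eq_of_norm {D : ℕ} {ε : ℝ} {X Y : ℤ} (hε : ε = (X + Y * √D) / 2)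
    (hN : X ^ 2 - D * Y ^ 2 = 4) :
    ε ^ 2 + 1 = X * ε := by
  have hN' : (X : ℝ) ^ 2 - D * Y ^ 2 = 4 := by exact_mod_cast hN
  have hD := Real.sq_sqrt (Nat.cast_nonneg (α := ℝ) D)
  rw [hε]
  linear_combination (1 / 4 : ℝ) * Y ^ 2 * hD - (1 / 4 : ℝ) * hN'

namespace IsFundUnit

variable {D : ℕ} {ε : ℝ} (h : IsFundUnit D ε)

include h

theorem ne_sq {u v : ℕ} (hD : 0 < D) (hu : 0 < u) (hv : 0 < v)
    (hN : (u : ℤ) ^ 2 - D * v ^ 2 = 1 ∨ (u : ℤ) ^ 2 - D * v ^ 2 = -1) :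
    ε ≠ (u + v * √D) ^ 2 := by
  intro hε
  have hu' : (1 : ℝ) ≤ u := by exact_mod_cast hu
  have hv' : (0 : ℝ) < v := by exact_mod_cast hv
  have hD' : 0 < √(D : ℝ) := Real.sqrt_pos.mpr (by exact_mod_cast hD)
  have h1 : 1 < u + v * √D := by nlinarith [mul_pos hv' hD']
  have h2 := h.2.2 (2 * u) (2 * v) (by
    rcases hN with hN | hN
    · left; linear_combination 4 * hN
    · right; linear_combination 4 * hN) (by push_cast; linarith)
  push_cast at h2
  nlinarith

end IsFundUnit

theorem IsFundUnit.exists_norm_neg_one_of_two {ε : ℝ} (h : IsFundUnit 2 ε) :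
    ∃ X Y : ℤ, ε = (X + Y * √2) / 2 ∧ X ^ 2 - 2 * Y ^ 2 = -4 := by
  obtain ⟨X, Y, hε, hN | hN⟩ := h.2.1
  · exfalso
    have h1 := sq_add_one_eq_of_norm hε hN
    have h2 := h.1
    have h3 := h.2.2 2 2 (by norm_num) (by
      push_cast
      linarith [Real.sqrt_pos.mpr (show (0 : ℝ) < 2 by norm_num)])
    have h4 : √2 < 1.42 := by
      rw [Real.sqrt_lt' (by norm_num)]; norm_num
    push_cast at h3
    have hX2 : (2 : ℝ) < X := by nlinarith
    have hX3 : (X : ℝ) < 3 := by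
      by_contra hX
      push Not at hX
      nlinarith
    norm_cast at hX2 hX3
    omega
  · exact ⟨X, Y, by simpa using hε, by simpa using hN⟩

theorem IsFundUnit.exists_norm_neg_one {p₁ p₂ : ℕ} (hp₁ : p₁.Prime) (hp₂ : p₂.Prime)
    (hne : p₁ ≠ p₂) (hm₁ : p₁ % 8 = 5) (hm₂ : p₂ % 8 = 5) {ε : ℝ}
    (h : IsFundUnit (2 * p₁ * p₂) ε) :
    ∃ X Y : ℤ, ε = (X + Y * √((2 * p₁ * p₂ : ℕ) : ℝ)) / 2 ∧
      X ^ 2 - (2 * p₁ * p₂ : ℕ) * Y ^ 2 = -4 := by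
  obtain ⟨X, Y, hε, hN | hN⟩ := h.2.1
  swap
  · exact ⟨X, Y, hε, hN⟩
  exfalso
  have h1 := sq_add_one_eq_of_norm hε hN
  have h2 := h.1
  have hX2 : (2 : ℝ) < X := by nlinarith
  have hD0 : 0 < 2 * p₁ * p₂ := by have := hp₁.pos; have := hp₂.pos; positivity
  have hY0 : (0 : ℝ) < Y := by
    by_contra hY
    push Not at hY
    have hYD := mul_nonpos_of_nonpos_of_nonneg hY (Real.sqrt_nonneg ((2 * p₁ * p₂ : ℕ) : ℝ))
    have hX : 2 * ε ≤ X := by linarith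
    nlinarith
  norm_cast at hX2 hY0
  have hodd : Odd ((p₁ * p₂ : ℕ) : ℤ) := by
    rw [Int.odd_coe_nat]
    exact (Nat.odd_iff.mpr (by omega)).mul (Nat.odd_iff.mpr (by omega))
  have heven {w : ℤ} (hw : 2 ∣ (p₁ * p₂ : ℕ) * w ^ 2) : 2 ∣ w := by
    rw [← even_iff_two_dvd] at hw ⊢
    exact (Int.even_pow.mp ((Int.even_mul.mp hw).resolve_left (Int.not_even_iff_odd.mpr hodd))).1
  obtain ⟨x, rfl⟩ : 2 ∣ X := Int.prime_two.dvd_of_dvd_pow (n := 2)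
    ⟨2 + (p₁ * p₂ : ℕ) * Y ^ 2, by push_cast at hN ⊢; linear_combination hN⟩
  obtain ⟨y, rfl⟩ : 2 ∣ Y := heven ⟨x ^ 2 - 1, by push_cast at hN ⊢; linarith⟩
  obtain ⟨k, hk⟩ : Odd x := by
    rw [← Int.not_even_iff_odd]
    rintro ⟨k, rfl⟩
    push_cast at hN
    have : 2 * (2 * k ^ 2 - p₁ * p₂ * y ^ 2) = 1 := by linarith
    omega
  obtain ⟨z, rfl⟩ : 2 ∣ y := heven ⟨k ^ 2 + k, by subst hk; push_cast at hN ⊢; linarith⟩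
  subst hk
  lift k to ℕ using by omega
  lift z to ℕ using by omega
  have hkz : k * (k + 1) = 2 * p₁ * p₂ * z ^ 2 := by
    zify
    push_cast at hN
    linarith
  obtain ⟨a, b, u, v, hab, hk, hk'⟩ := exists_sq_of_coprime_mul_eq hD0.ne' (by simp) hkz
  have hz : z = u * v := by
    have : z ^ 2 = (u * v) ^ 2 := by
      apply Nat.eq_of_mul_eq_mul_left hD0
      rw [← hkz, hk', hk, ← hab]
      ring
    exact Nat.pow_left_injective two_ne_zero this
  have hv : 0 < v := Nat.pos_of_ne_zero fun hv ↦ by simp [hv] at hk'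
  have hu : 0 < u := Nat.pos_of_ne_zero fun hu ↦ by
    simp [hu] at hk
    omega
  have hba : (b : ℤ) * v ^ 2 - a * u ^ 2 = 1 := by
    zify at hk hk'
    linarith
  have habZ : (a : ℤ) * b = 2 * p₁ * p₂ := by exact_mod_cast hab
  have hεk : ε = 2 * k + 1 + 2 * z * √((2 * p₁ * p₂ : ℕ) : ℝ) := by
    rw [hε]; push_cast; ring
  have hDsq := Real.sq_sqrt (Nat.cast_nonneg (α := ℝ) (2 * p₁ * p₂))
  have hne1 : a ≠ 1 := by
    rintro rfl
    refine h.ne_sq hD0 hu hv (.inr ?_) ?_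
    · rw [one_mul] at hab
      rw [← hab]
      linarith
    · rw [one_mul] at hab hk
      have : (k : ℝ) + 1 = (2 * p₁ * p₂ : ℕ) * v ^ 2 := by rw [← hab]; exact_mod_cast hk'
      have hk : (k : ℝ) = u ^ 2 := by exact_mod_cast hk
      rw [hεk, hz]
      push_cast at this hDsq ⊢
      linear_combination hk + this - v ^ 2 * hDsq
  have hne2 : b ≠ 1 := by
    rintro rfl
    refine h.ne_sq hD0 hv hu (.inl ?_) ?_
    · rw [mul_one] at hab
      rw [← hab]
      linarith
    · rw [mul_one] at hab
      have : (k : ℝ) = (2 * p₁ * p₂ : ℕ) * u ^ 2 := by rw [← hab]; exact_mod_cast hk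
      have hk' : (k : ℝ) + 1 = v ^ 2 := by rw [one_mul] at hk'; exact_mod_cast hk'
      rw [hεk, hz]
      push_cast at this hDsq ⊢
      linear_combination hk' + this - u ^ 2 * hDsq
  have hcase : (a = 2 ∨ a = p₁ ∨ a = p₂) ∨ b = 2 ∨ b = p₁ ∨ b = p₂ := by
    obtain ⟨c, a₃, hc, ha₃, rfl⟩ := Nat.dvd_mul.mp (Dvd.intro _ hab)
    obtain ⟨a₁, a₂, ha₁, ha₂, rfl⟩ := Nat.dvd_mul.mp hc
    have h0₁ := hp₁.pos
    have h0₂ := hp₂.pos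
    rcases (Nat.dvd_prime Nat.prime_two).mp ha₁ with rfl | rfl <;>
      rcases (Nat.dvd_prime hp₁).mp ha₂ with rfl | rfl <;>
      rcases (Nat.dvd_prime hp₂).mp ha₃ with rfl | rfl
    · simp at hne1
    · simp
    · simp
    · right; left
      apply Nat.eq_of_mul_eq_mul_left (Nat.mul_pos h0₁ h0₂)
      linarith
    · simp
    · right; right; left
      apply Nat.eq_of_mul_eq_mul_left (Nat.mul_pos two_pos h0₂)
      linarith
    · right; right; right
      apply Nat.eq_of_mul_eq_mul_left (Nat.mul_pos two_pos h0₁)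
      linarith
    · refine absurd ?_ hne2
      apply Nat.eq_of_mul_eq_mul_left hD0
      linarith
  rcases hcase with he | he
  · refine one_ne_zero (α := ℤ) (eq_zero_of_mul_sq_eq_sub hp₁ hp₂ hne hm₁ hm₂ (.inl rfl) rfl
      (e := a) (δ := -1) (by exact_mod_cast he) (.inr rfl) (x := a * u) (y := v) ?_)
    linear_combination (-a : ℤ) * hba + v ^ 2 * habZ
  · refine one_ne_zero (α := ℤ) (eq_zero_of_mul_sq_eq_sub hp₁ hp₂ hne hm₁ hm₂ (.inl rfl) rfl
      (e := b) (δ := 1) (by exact_mod_cast he) (.inl rfl) (x := b * v) (y := u) ?_)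
    linear_combination (-b : ℤ) * hba - u ^ 2 * habZ

end FundamentalUnits

section SqrtRing

open Ideal

theorem dvd_of_sq_sub_mul_add_eq_zero {O : Type*} [CommRing O] [IsDomain O] [IsIntegrallyClosed O]
    {g γ t n : O} (hg : g ≠ 0) (h : γ ^ 2 - g * t * γ + g ^ 2 * n = 0) : g ∣ γ := by
  have hg' : algebraMap O (FractionRing O) g ≠ 0 := by simpa using hg
  have hInt : IsIntegral O (algebraMap O (FractionRing O) γ / algebraMap O (FractionRing O) g) := by
    refine ⟨Polynomial.X ^ 2 - Polynomial.C t * Polynomial.X + Polynomial.C n, ?_, ?_⟩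
    · monicity!
    · have h' := congrArg (algebraMap O (FractionRing O)) h
      simp only [map_add, map_sub, map_mul, map_pow, map_zero] at h'
      simp only [Polynomial.eval₂_add, Polynomial.eval₂_sub, Polynomial.eval₂_mul,
        Polynomial.eval₂_C, Polynomial.eval₂_pow, Polynomial.eval₂_X]
      field_simp
      linear_combination h'
  obtain ⟨δ, hδ⟩ := IsIntegrallyClosed.isIntegral_iff.mp hInt
  refine ⟨δ, IsFractionRing.injective O (FractionRing O) ?_⟩
  rw [map_mul, hδ]
  field_simp

theorem dvd_of_sq_dvd_sq' {O : Type*} [CommRing O] [IsDomain O] [IsIntegrallyClosed O]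
    {a b : O} (h : a ^ 2 ∣ b ^ 2) : a ∣ b := by
  obtain ⟨n, hn⟩ := h
  rcases eq_or_ne a 0 with rfl | ha
  · simp_all
  · exact dvd_of_sq_sub_mul_add_eq_zero (t := 0) (n := -n) ha (by linear_combination hn)

/-- `O = ℤ[r]` with `r² = m`, and `σ` is the conjugation `r ↦ -r`. -/
structure IsSqrtRing {O : Type*} [CommRing O] (σ : O ≃+* O) (r : O) (m : ℤ) : Prop where
  sq_eq : r ^ 2 = m
  exists_eq : ∀ α : O, ∃ u v : ℤ, α = u + v * r
  eq_zero : ∀ u v : ℤ, (u : O) + v * r = 0 → u = 0 ∧ v = 0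
  apply_eq : σ r = -r

namespace IsSqrtRing

variable {O : Type*} [CommRing O] {σ : O ≃+* O} {r : O} {m : ℤ}
  (h : IsSqrtRing σ r m)

include h

theorem apply_add (u v : ℤ) : σ (u + v * r) = u - v * r := by
  rw [map_add, map_mul, map_intCast, map_intCast, h.apply_eq]; ring

theorem apply_apply (α : O) : σ (σ α) = α := by
  obtain ⟨u, v, rfl⟩ := h.exists_eq α
  rw [h.apply_add, map_sub, map_mul, map_intCast, map_intCast, h.apply_eq]; ring

theorem mul_apply (u v : ℤ) : (u + v * r) * σ (u + v * r) = ((u ^ 2 - m * v ^ 2 : ℤ) : O) := by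
  rw [h.apply_add]
  push_cast
  linear_combination (-v ^ 2 : O) * h.sq_eq

theorem exists_mul_apply_eq (α : O) : ∃ n : ℤ, α * σ α = n := by
  obtain ⟨u, v, rfl⟩ := h.exists_eq α
  exact ⟨_, h.mul_apply u v⟩

theorem eq_of_add_eq {u v u' v' : ℤ} (he : (u : O) + v * r = u' + v' * r) : u = u' ∧ v = v' := by
  have := h.eq_zero (u - u') (v - v') (by push_cast; linear_combination he)
  omega

theorem intCast_injective : Function.Injective (Int.cast : ℤ → O) := fun a b hab ↦
  (h.eq_of_add_eq (u := a) (v := 0) (u' := b) (v' := 0) (by simpa using hab)).1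

theorem intCast_dvd_add {n u v : ℤ} : (n : O) ∣ u + v * r ↔ n ∣ u ∧ n ∣ v := by
  constructor
  · rintro ⟨α, hα⟩
    obtain ⟨a, b, rfl⟩ := h.exists_eq α
    have := h.eq_of_add_eq (u' := n * a) (v' := n * b) (hα.trans (by push_cast; ring))
    exact ⟨⟨a, this.1⟩, ⟨b, this.2⟩⟩
  · rintro ⟨⟨a, rfl⟩, ⟨b, rfl⟩⟩
    exact ⟨a + b * r, by push_cast; ring⟩

theorem intCast_dvd_intCast {a b : ℤ} : (a : O) ∣ b ↔ a ∣ b := by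
  have := h.intCast_dvd_add (n := a) (u := b) (v := 0)
  simpa using this

variable [IsDomain O]

theorem eq_or_eq_neg_of_span_eq {a b : ℤ} (hab : span {(a : O)} = span {(b : O)}) :
    a = b ∨ a = -b := by
  rw [span_singleton_eq_span_singleton] at hab
  exact Int.associated_iff.mp (associated_of_dvd_dvd (h.intCast_dvd_intCast.mp hab.dvd)
    (h.intCast_dvd_intCast.mp hab.symm.dvd))

theorem exists_mul_map_eq_span [IsIntegrallyClosed O] {a : Ideal O} (ha : a ≠ ⊥) :
    ∃ g : ℤ, g ≠ 0 ∧ a * a.map σ = span {(g : O)} := by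
  set J : Ideal ℤ := span {n | ∃ α ∈ a, (n : O) = α * σ α} with hJ
  obtain ⟨g, hg⟩ := (IsPrincipalIdealRing.principal J).principal
  replace hg : J = span {g} := hg
  have hmem {n : ℤ} {α : O} (hα : α ∈ a) (hn : α * σ α = n) : g ∣ n := by
    rw [← mem_span_singleton, ← hg]
    exact subset_span ⟨α, hα, hn.symm⟩
  have hg0 : g ≠ 0 := by
    rintro rfl
    obtain ⟨α, hα, hα0⟩ := Submodule.exists_mem_ne_zero_of_ne_bot ha
    obtain ⟨n, hn⟩ := h.exists_mul_apply_eq α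
    have := hmem hα hn
    rw [zero_dvd_iff] at this
    rw [this, Int.cast_zero, mul_eq_zero] at hn
    rcases hn with hn | hn
    · exact hα0 hn
    · exact hα0 (by simpa using hn)
  refine ⟨g, hg0, le_antisymm ?_ ?_⟩
  · rw [Ideal.mul_le]
    intro α hα β hβ
    obtain ⟨β, hβ', rfl⟩ := (Ideal.mem_map_iff_of_surjective _ σ.surjective).mp hβ
    rw [mem_span_singleton]
    obtain ⟨n₁, h₁⟩ := h.exists_mul_apply_eq α
    obtain ⟨n₂, h₂⟩ := h.exists_mul_apply_eq β
    obtain ⟨n₃, h₃⟩ := h.exists_mul_apply_eq (α + β)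
    obtain ⟨k₁, rfl⟩ := hmem hα h₁
    obtain ⟨k₂, rfl⟩ := hmem hβ' h₂
    obtain ⟨k₃, rfl⟩ := hmem (a.add_mem hα hβ') h₃
    refine dvd_of_sq_sub_mul_add_eq_zero (t := ((k₃ - k₁ - k₂ : ℤ) : O))
      (n := ((k₁ * k₂ : ℤ) : O)) (fun h0 ↦ hg0 (h.intCast_injective (by simpa using h0))) ?_
    rw [map_add] at h₃
    push_cast at h₁ h₂ h₃ ⊢
    linear_combination (α * σ β) * h₃ - α * σ β * h₁ - g * k₁ * h₂ - h₁ * (β * σ β) -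
      α * σ β * h₂
  · rw [span_singleton_le_iff_mem]
    have hle : J ≤ (a * a.map σ).comap (Int.castRingHom O) := by
      rw [hJ, Ideal.span_le]
      rintro n ⟨α, hα, hn⟩
      rw [SetLike.mem_coe, mem_comap, eq_intCast, hn]
      exact Ideal.mul_mem_mul hα (Ideal.mem_map_of_mem _ hα)
    have : g ∈ J := by rw [hg]; exact mem_span_singleton_self g
    exact hle this

omit [IsDomain O] in
theorem span_pair_mul_span_pair {e f : ℤ} (hc : IsCoprime e f) (hd : e * f ∣ m) :
    span {(e : O), r} * span {(f : O), r} = span {((e * f : ℤ) : O), r} := by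
  obtain ⟨x, y, hxy⟩ := hc
  obtain ⟨k, rfl⟩ := hd
  have hxy' := congrArg (Int.cast : ℤ → O) hxy
  push_cast at hxy'
  have hr := h.sq_eq
  push_cast at hr
  refine le_antisymm ?_ ?_
  · rw [Ideal.mul_le]
    intro α hα β hβ
    obtain ⟨a, b, rfl⟩ := mem_span_pair.mp hα
    obtain ⟨c, d, rfl⟩ := mem_span_pair.mp hβ
    rw [mem_span_pair]
    refine ⟨a * c + b * d * k, a * d * e + b * c * f, ?_⟩
    push_cast
    linear_combination (-b * d) * hr
  · rw [Ideal.span_le]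
    have he : (e : O) ∈ span {(e : O), r} := subset_span (by simp)
    have hf : (f : O) ∈ span {(f : O), r} := subset_span (by simp)
    have hre : r ∈ span {(e : O), r} := subset_span (by simp)
    have hrf : r ∈ span {(f : O), r} := subset_span (by simp)
    rw [Set.insert_subset_iff, Set.singleton_subset_iff]
    constructor
    · push_cast
      exact Ideal.mul_mem_mul he hf
    · have : r = x * (e * r) + y * (r * f) := by linear_combination -r * hxy'
      refine Set.mem_of_eq_of_mem this ?_
      exact add_mem (Ideal.mul_mem_left _ _ (Ideal.mul_mem_mul he hrf))
        (Ideal.mul_mem_left _ _ (Ideal.mul_mem_mul hre hf))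

omit [IsDomain O] in
theorem span_pair_sq (hm : Squarefree m) {e : ℤ} (he : e ∣ m) :
    span {(e : O), r} ^ 2 = span {(e : O)} := by
  obtain ⟨f, rfl⟩ := he
  obtain ⟨x, y, hxy⟩ := (squarefree_mul_iff.mp hm).1.isCoprime
  have hxy' := congrArg (Int.cast : ℤ → O) hxy
  push_cast at hxy'
  have hr := h.sq_eq
  push_cast at hr
  rw [sq]
  refine le_antisymm ?_ ?_
  · rw [Ideal.mul_le]
    intro α hα β hβ
    obtain ⟨a, b, rfl⟩ := mem_span_pair.mp hα
    obtain ⟨c, d, rfl⟩ := mem_span_pair.mp hβ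
    rw [mem_span_singleton]
    refine ⟨a * c * e + a * d * r + b * c * r + b * d * f, ?_⟩
    linear_combination (b * d) * hr
  · rw [span_singleton_le_iff_mem]
    have he : (e : O) ∈ span {(e : O), r} := subset_span (by simp)
    have hre : r ∈ span {(e : O), r} := subset_span (by simp)
    have : (e : O) = x * (e * e) + y * (r * r) := by linear_combination (-e : O) * hxy' - y * hr
    refine Set.mem_of_eq_of_mem this ?_
    exact add_mem (Ideal.mul_mem_left _ _ (Ideal.mul_mem_mul he he))
      (Ideal.mul_mem_left _ _ (Ideal.mul_mem_mul hre hre))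

omit [IsDomain O] in
theorem map_span_pair (e : ℤ) : (span {(e : O), r}).map σ = span {(e : O), r} := by
  rw [Ideal.map_span, Set.image_pair, map_intCast, h.apply_eq, span_pair_neg]

omit [IsDomain O] in
theorem span_pair_self : span {(m : O), r} = span {r} := by
  rw [← h.sq_eq, Ideal.span_pair_eq_span_right_iff_dvd.mpr (dvd_pow_self r two_ne_zero)]

theorem mul_sq_eq_of_sq_mul_eq_span [IsIntegrallyClosed O] (hm : Squarefree m) {e : ℤ}
    (he : e ∣ m) {a : Ideal O} (ha : a ≠ ⊥) {γ : O} (hγ : a ^ 2 * span {(e : O), r} = span {γ}) :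
    ∃ (δ : ℤ) (u v n : ℤ), (δ = 1 ∨ δ = -1) ∧ n ≠ 0 ∧ e * n ^ 2 = δ * (u ^ 2 - m * v ^ 2) := by
  obtain ⟨g, hg0, hg⟩ := h.exists_mul_map_eq_span ha
  obtain ⟨u, v, rfl⟩ := h.exists_eq γ
  have h1 := congrArg (Ideal.map σ) hγ
  rw [Ideal.map_mul, Ideal.map_pow, h.map_span_pair, Ideal.map_span, Set.image_singleton] at h1
  have h2 : span {((e * g ^ 2 : ℤ) : O)} = span {((u ^ 2 - m * v ^ 2 : ℤ) : O)} := by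
    rw [← h.mul_apply, ← span_singleton_mul_span_singleton, ← h1, ← hγ]
    push_cast
    rw [← span_singleton_mul_span_singleton, ← span_singleton_pow, ← hg, ← h.span_pair_sq hm he]
    ring
  rcases h.eq_or_eq_neg_of_span_eq h2 with h3 | h3
  · exact ⟨1, u, v, g, Or.inl rfl, hg0, by linarith⟩
  · exact ⟨-1, u, v, g, Or.inr rfl, hg0, by linarith⟩

end IsSqrtRing
end SqrtRing

section SqrtRingInvariants

open Ideal

namespace IsSqrtRing

variable {O : Type*} [CommRing O] [IsDedekindDomain O] {σ : O ≃+* O} {r : O} {m : ℤ}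
  (h : IsSqrtRing σ r m)

include h

theorem eq_span_pair_of_sq_eq_span (hm : Squarefree m) (hm2 : 2 ∣ m) {e : ℕ} (he : Squarefree e)
    {b : Ideal O} (hb : b ^ 2 = span {(e : O)}) : (e : ℤ) ∣ m ∧ b = span {((e : ℤ) : O), r} := by
  have hcoord {u v : ℤ} (huv : u + v * r ∈ b) :
      (e : ℤ) ∣ u ^ 2 + m * v ^ 2 ∧ (e : ℤ) ∣ 2 * u * v := by
    rw [← h.intCast_dvd_add, Int.cast_natCast, ← mem_span_singleton, ← hb]
    convert Ideal.pow_mem_pow huv 2 using 1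
    push_cast
    linear_combination -v ^ 2 * h.sq_eq
  have hem : (e : ℤ) ∣ m := by
    rw [Int.natCast_dvd]
    rw [← Nat.prod_primeFactors_of_squarefree he]
    refine Finset.prod_primes_dvd _ (fun p hp ↦ (Nat.prime_of_mem_primeFactors hp).prime) ?_
    intro p hp
    have hpe : (p : ℤ) ∣ e := Int.natCast_dvd_natCast.mpr (Nat.dvd_of_mem_primeFactors hp)
    have hp' : Prime (p : ℤ) := Nat.prime_iff_prime_int.mp (Nat.prime_of_mem_primeFactors hp)
    rw [← Int.natCast_dvd]
    by_contra hpm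
    have hp2 : ¬ (p : ℤ) ∣ 2 := fun h2 ↦ hpm (h2.trans hm2)
    have hle : b ≤ span {((p : ℤ) : O)} := by
      intro β hβ
      obtain ⟨u, v, rfl⟩ := h.exists_eq β
      obtain ⟨h1, h2⟩ := hcoord hβ
      replace h1 := hpe.trans h1
      have huv : (p : ℤ) ∣ u * v :=
        (hp'.dvd_or_dvd (by simpa [mul_assoc] using hpe.trans h2)).resolve_left hp2
      rw [mem_span_singleton, h.intCast_dvd_add]
      rcases hp'.dvd_or_dvd huv with hu | hv
      · refine ⟨hu, hp'.dvd_of_dvd_pow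
          ((hp'.dvd_or_dvd ((Int.dvd_add_right ?_).mp h1)).resolve_left hpm)⟩
        exact dvd_pow hu two_ne_zero
      · refine ⟨hp'.dvd_of_dvd_pow ((Int.dvd_add_left ?_).mp h1), hv⟩
        exact (dvd_pow hv two_ne_zero).mul_left _
    have h3 : span {(e : O)} ≤ span {(((p : ℤ) ^ 2 : ℤ) : O)} := by
      rw [← hb, Int.cast_pow, ← span_singleton_pow]
      exact Ideal.pow_right_mono hle 2
    rw [span_singleton_le_span_singleton, ← Int.cast_natCast e, h.intCast_dvd_intCast] at h3
    exact hp'.not_isUnit ((Int.squarefree_natCast.mpr he) _ (by rwa [← sq]))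
  have hsq := h.span_pair_sq hm hem
  have hle : b ≤ span {((e : ℤ) : O), r} := by
    intro β hβ
    obtain ⟨u, v, rfl⟩ := h.exists_eq β
    have hu : (e : ℤ) ∣ u ^ 2 := (Int.dvd_add_left (hem.mul_right _)).mp (hcoord hβ).1
    obtain ⟨w, rfl⟩ := ((Int.squarefree_natCast.mpr he).dvd_pow_iff_dvd two_ne_zero).mp hu
    exact mem_span_pair.mpr ⟨w, v, by push_cast; ring⟩
  refine ⟨hem, ?_⟩
  obtain ⟨c, rfl⟩ := Ideal.dvd_iff_le.mpr hle
  rw [mul_pow, hsq, Int.cast_natCast] at hb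
  have he0 : span {(e : O)} ≠ ⊥ := by
    rw [Ne, span_singleton_eq_bot]
    intro h0
    exact he.ne_zero (by exact_mod_cast h.intCast_injective (a₁ := e) (a₂ := 0) (by simpa using h0))
  have hc : c ^ 2 = 1 := mul_left_cancel₀ he0 (hb.trans (mul_one _).symm)
  have hc1 : c = 1 := by
    have : IsUnit c := IsUnit.of_mul_eq_one c (by rw [← sq, hc])
    rwa [Ideal.isUnit_iff, ← Ideal.one_eq_top] at this
  rw [hc1, mul_one]

theorem exists_generator_mul_apply_eq_sq [CharZero O] {a : Ideal O} {α : O} {g : ℤ} (hg0 : g ≠ 0)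
    (hm : m < 0 ∨ ∃ u v : ℤ, u ^ 2 - m * v ^ 2 = -1) (ha : a ^ 2 = span {α})
    (hg : a * a.map σ = span {(g : O)}) :
    ∃ β, a ^ 2 = span {β} ∧ β * σ β = (g : O) ^ 2 ∧ β + g ≠ 0 := by
  have key : ∃ β, a ^ 2 = span {β} ∧ β * σ β = (g : O) ^ 2 := by
    obtain ⟨u, v, rfl⟩ := h.exists_eq α
    have h1 := congrArg (Ideal.map σ) ha
    rw [Ideal.map_pow, Ideal.map_span, Set.image_singleton] at h1
    have h2 : span {((g ^ 2 : ℤ) : O)} = span {((u ^ 2 - m * v ^ 2 : ℤ) : O)} := by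
      rw [← h.mul_apply, ← span_singleton_mul_span_singleton, ← h1, ← ha, ← mul_pow, hg,
        span_singleton_pow, Int.cast_pow]
    rcases h.eq_or_eq_neg_of_span_eq h2 with h3 | h3
    · refine ⟨_, ha, ?_⟩
      rw [h.mul_apply, ← h3, Int.cast_pow]
    · rcases hm with hm | ⟨x, y, hxy⟩
      · exfalso
        have : 0 < g ^ 2 := by positivity
        nlinarith [sq_nonneg u, sq_nonneg v, mul_nonneg_of_nonpos_of_nonpos hm.le
          (neg_nonpos.mpr (sq_nonneg v))]
      · have hu : (x + y * r) * σ (x + y * r) = -1 := by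
          rw [h.mul_apply, hxy, Int.cast_neg, Int.cast_one]
        refine ⟨(u + v * r) * (x + y * r), ?_, ?_⟩
        · have hu' : IsUnit (x + y * r) :=
            IsUnit.of_mul_eq_one (-σ (x + y * r)) (by linear_combination -hu)
          rw [ha, ← span_singleton_mul_span_singleton, span_singleton_eq_top.mpr hu', Ideal.mul_top]
        · rw [map_mul, mul_mul_mul_comm, hu, h.mul_apply]
          have := congrArg (Int.cast : ℤ → O) h3
          push_cast at this ⊢
          linear_combination -this
  obtain ⟨β, hβ, hβg⟩ := key
  by_cases h0 : β + g = 0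
  · refine ⟨-β, by rw [hβ, span_singleton_neg], by rw [map_neg, neg_mul_neg, hβg], ?_⟩
    rw [show -β + g = ((2 * g : ℤ) : O) by push_cast; linear_combination -h0]
    exact_mod_cast mul_ne_zero two_ne_zero hg0
  · exact ⟨β, hβ, hβg, h0⟩

theorem exists_mul_eq_mul_span_pair [CharZero O] (hm : Squarefree m) (hm2 : 2 ∣ m)
    (hm' : m < 0 ∨ ∃ u v : ℤ, u ^ 2 - m * v ^ 2 = -1) {a : Ideal O} {α : O} (ha0 : a ≠ ⊥)
    (ha : a ^ 2 = span {α}) : ∃ (e : ℕ) (x y : O), (e : ℤ) ∣ m ∧ x ≠ 0 ∧ y ≠ 0 ∧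
      span {x} * a = span {y} * span {((e : ℤ) : O), r} := by
  obtain ⟨g, hg0, hg⟩ := h.exists_mul_map_eq_span ha0
  obtain ⟨α, ha, hα, hβ0⟩ := h.exists_generator_mul_apply_eq_sq hg0 hm' ha hg
  set β := α + g with hβ
  have hg0' : (g : O) ≠ 0 := by exact_mod_cast hg0
  have hσβ0 : σ β ≠ 0 := by simpa using hβ0
  have hσβ : α * σ β = g * β := by
    rw [hβ, map_add, map_intCast]
    linear_combination hα
  set b := span {σ β} * a with hb
  have hinv : b.map σ = b := by
    apply mul_left_cancel₀ (a := span {(g : O)}) (by simpa [span_singleton_eq_bot] using hg0')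
    rw [hb, Ideal.map_mul, Ideal.map_span, Set.image_singleton, h.apply_apply, ← mul_assoc,
      span_singleton_mul_span_singleton, ← hσβ, ← span_singleton_mul_span_singleton, ← ha, ← hg]
    ring
  obtain ⟨n, hn⟩ := h.exists_mul_apply_eq β
  have hsq : b ^ 2 = span {(((n * g).natAbs : ℤ) : O)} := by
    have : span {(((n * g).natAbs : ℤ) : O)} = span {((n * g : ℤ) : O)} := by
      rcases Int.natAbs_eq (n * g) with h1 | h1
      · rw [← h1]
      · conv_rhs => rw [h1]
        rw [Int.cast_neg, span_singleton_neg]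
    rw [this, sq]
    nth_rw 2 [← hinv]
    rw [hb, Ideal.map_mul, mul_mul_mul_comm, hg, Ideal.map_span, Set.image_singleton,
      span_singleton_mul_span_singleton, h.apply_apply, mul_comm (σ β), hn,
      span_singleton_mul_span_singleton, Int.cast_mul]
  obtain ⟨e, s, hes, he⟩ := Nat.sq_mul_squarefree (n * g).natAbs
  rw [← hes] at hsq
  have hb0 : b ≠ ⊥ := mul_ne_zero (by simpa [span_singleton_eq_bot] using hσβ0) ha0
  have hs0 : (s : O) ≠ 0 := by
    intro hs0
    apply hb0
    have : b ^ 2 = ⊥ := by rw [hsq]; simp [hs0]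
    exact pow_eq_zero_iff two_ne_zero |>.mp this
  have hle : b ≤ span {(s : O)} := by
    intro γ hγ
    have h2 := Ideal.pow_mem_pow hγ 2
    rw [hsq, mem_span_singleton] at h2
    rw [mem_span_singleton]
    refine dvd_of_sq_dvd_sq' (dvd_trans ⟨(e : O), ?_⟩ h2)
    push_cast
    ring
  obtain ⟨c, hc⟩ := Ideal.dvd_iff_le.mpr hle
  have hc2 : c ^ 2 = span {(e : O)} := by
    apply mul_left_cancel₀ (a := span {(s : O)} ^ 2)
      (pow_ne_zero 2 (by simpa [span_singleton_eq_bot] using hs0))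
    rw [← mul_pow, ← hc, hsq, span_singleton_pow, span_singleton_mul_span_singleton]
    push_cast
    rfl
  obtain ⟨hem, hce⟩ := h.eq_span_pair_of_sq_eq_span hm hm2 he hc2
  exact ⟨e, σ β, s, hem, hσβ0, hs0, by rw [← hce, ← hc]⟩

end IsSqrtRing
end SqrtRingInvariants

section FourTorsion

theorem exists_odd_card_eq_four_mul {C : Type*} [CommGroup C] [Finite C] {x y : C}
    (hx : x ^ 2 = 1) (hy : y ^ 2 = 1)
    (hT : ∀ c : C, c ^ 2 = 1 → c = 1 ∨ c = x ∨ c = y ∨ c = x * y)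
    (hx' : ∀ c, x ≠ c ^ 2) (hy' : ∀ c, y ≠ c ^ 2) (hxy' : ∀ c, x * y ≠ c ^ 2) :
    ∃ n, Odd n ∧ Nat.card C = 4 * n := by
  classical
  set f : C →* C := powMonoidHom 2 with hf
  have hker : (f.ker : Set C) = ({1, x, y, x * y} : Finset C) := by
    ext c
    simp only [SetLike.mem_coe, MonoidHom.mem_ker, hf, powMonoidHom_apply, Finset.coe_insert,
      Finset.coe_singleton, Set.mem_insert_iff, Set.mem_singleton_iff]
    refine ⟨hT c, ?_⟩
    rintro (rfl | rfl | rfl | rfl)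
    · exact one_pow 2
    · exact hx
    · exact hy
    · rw [mul_pow, hx, hy, one_mul]
  have hx1 : x ≠ 1 := fun h ↦ hx' 1 (by simpa using h)
  have hy1 : y ≠ 1 := fun h ↦ hy' 1 (by simpa using h)
  have hxy1 : x * y ≠ 1 := fun h ↦ hxy' 1 (by simpa using h)
  have hxy : x ≠ y := by
    rintro rfl
    exact hxy' 1 (by rw [← sq, hx, one_pow])
  have hcard : Nat.card f.ker = 4 := by
    rw [← SetLike.coe_sort_coe, hker, Nat.card_coe_set_eq, Set.ncard_coe_finset]
    have h3 : x ≠ x * y := by simpa using hy1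
    have h4 : y ≠ x * y := by simpa using hx1
    simp [Finset.card_insert_of_notMem, hx1.symm, hy1.symm, hxy1.symm, hxy, h3, h4]
  refine ⟨Nat.card f.range, ?_, ?_⟩
  · rw [← Nat.not_even_iff_odd, even_iff_two_dvd]
    intro h2
    have : Fact (Nat.Prime 2) := ⟨Nat.prime_two⟩
    obtain ⟨⟨_, ⟨s, rfl⟩⟩, hs⟩ := exists_prime_orderOf_dvd_card' 2 h2
    have hs2 : (f s) ^ 2 = 1 := by
      have := pow_orderOf_eq_one (⟨f s, ⟨s, rfl⟩⟩ : f.range)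
      rw [hs] at this
      exact congrArg Subtype.val this
    have hs1 : f s ≠ 1 := by
      intro h1
      have : (⟨f s, ⟨s, rfl⟩⟩ : f.range) = 1 := Subtype.ext h1
      rw [this, orderOf_one] at hs
      omega
    rcases hT _ hs2 with h | h | h | h
    · exact hs1 h
    · exact hx' s h.symm
    · exact hy' s h.symm
    · exact hxy' s h.symm
  · rw [← hcard, ← Subgroup.card_mul_index f.ker, Subgroup.index_ker]

open Ideal
open scoped nonZeroDivisors

namespace IsSqrtRing

variable {O : Type*} [CommRing O] [IsDedekindDomain O] {σ : O ≃+* O} {r : O} {m : ℤ}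
  (h : IsSqrtRing σ r m)

include h

omit [IsDedekindDomain O] in
theorem span_pair_ne_bot (hm : m ≠ 0) (e : ℤ) : span {(e : O), r} ≠ ⊥ := by
  intro h0
  have hr : r ∈ span {(e : O), r} := subset_span (by simp)
  rw [h0, Ideal.mem_bot] at hr
  have := h.sq_eq
  rw [hr] at this
  exact hm (h.intCast_injective (by simpa using this.symm))

/-- The class of the ideal `(e, r)` of `ℤ[r]`. -/
noncomputable def spanPairClass (hm : m ≠ 0) (e : ℤ) : ClassGroup O :=
  ClassGroup.mk0 ⟨span {(e : O), r}, mem_nonZeroDivisors_of_ne_zero (h.span_pair_ne_bot hm e)⟩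

theorem spanPairClass_mul (hm : m ≠ 0) {e f : ℤ} (hc : IsCoprime e f) (hd : e * f ∣ m) :
    h.spanPairClass hm e * h.spanPairClass hm f = h.spanPairClass hm (e * f) := by
  rw [spanPairClass, spanPairClass, spanPairClass, ← map_mul]
  congr 1
  exact Subtype.ext (h.span_pair_mul_span_pair hc hd)

theorem spanPairClass_self (hm : m ≠ 0) : h.spanPairClass hm m = 1 := by
  rw [spanPairClass, ClassGroup.mk0_eq_one_iff, h.span_pair_self]
  exact ⟨⟨r, rfl⟩⟩

theorem spanPairClass_one (hm : m ≠ 0) : h.spanPairClass hm 1 = 1 := by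
  rw [spanPairClass, ClassGroup.mk0_eq_one_iff]
  refine ⟨⟨1, ?_⟩⟩
  rw [Int.cast_one]
  exact Ideal.span_pair_eq_span_left_iff_dvd.mpr (one_dvd r)

theorem spanPairClass_neg (hm : m ≠ 0) (e : ℤ) :
    h.spanPairClass hm (-e) = h.spanPairClass hm e := by
  rw [spanPairClass, spanPairClass]
  congr 2
  rw [Int.cast_neg, span_insert_neg]

theorem spanPairClass_sq (hm : Squarefree m) {e : ℤ} (he : e ∣ m) :
    h.spanPairClass hm.ne_zero e ^ 2 = 1 := by
  rw [spanPairClass, ← map_pow, ClassGroup.mk0_eq_one_iff (Subtype.prop _)]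
  refine ⟨⟨(e : O), ?_⟩⟩
  exact h.span_pair_sq hm he

theorem exists_eq_of_spanPairClass_eq_sq (hm : Squarefree m) {e : ℤ} (he : e ∣ m)
    {c : ClassGroup O} (hc : h.spanPairClass hm.ne_zero e = c ^ 2) :
    ∃ (δ : ℤ) (u v n : ℤ), (δ = 1 ∨ δ = -1) ∧ n ≠ 0 ∧ e * n ^ 2 = δ * (u ^ 2 - m * v ^ 2) := by
  obtain ⟨⟨a, ha⟩, ha'⟩ := ClassGroup.mk0_surjective c⁻¹
  have h1 : ClassGroup.mk0 ⟨a, ha⟩ ^ 2 * h.spanPairClass hm.ne_zero e = 1 := by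
    rw [ha', hc, inv_pow, inv_mul_cancel]
  rw [spanPairClass, ← map_pow, ← map_mul, ClassGroup.mk0_eq_one_iff (Subtype.prop _)] at h1
  obtain ⟨⟨γ, hγ⟩⟩ := h1
  exact h.mul_sq_eq_of_sq_mul_eq_span hm he (nonZeroDivisors.ne_zero ha) hγ

theorem exists_eq_spanPairClass [CharZero O] (hm : Squarefree m) (hm2 : 2 ∣ m)
    (hm' : m < 0 ∨ ∃ u v : ℤ, u ^ 2 - m * v ^ 2 = -1) {c : ClassGroup O} (hc : c ^ 2 = 1) :
    ∃ e : ℕ, (e : ℤ) ∣ m ∧ c = h.spanPairClass hm.ne_zero e := by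
  obtain ⟨⟨a, ha⟩, rfl⟩ := ClassGroup.mk0_surjective c
  rw [← map_pow, ClassGroup.mk0_eq_one_iff (Subtype.prop _)] at hc
  obtain ⟨⟨α, hα⟩⟩ := hc
  obtain ⟨e, x, y, hem, hx, hy, hxy⟩ :=
    h.exists_mul_eq_mul_span_pair hm hm2 hm' (nonZeroDivisors.ne_zero ha) hα
  refine ⟨e, hem, ?_⟩
  rw [spanPairClass, ClassGroup.mk0_eq_mk0_iff]
  exact ⟨x, y, hx, hy, hxy⟩

end IsSqrtRing
end FourTorsion

section ClassNumberFourOdd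

theorem squarefree_two_mul_mul {p₁ p₂ : ℕ} (hp₁ : p₁.Prime) (hp₂ : p₂.Prime) (hne : p₁ ≠ p₂)
    (h₁ : p₁ ≠ 2) (h₂ : p₂ ≠ 2) : Squarefree (2 * p₁ * p₂) := by
  have c1 : Nat.Coprime 2 p₁ := (Nat.coprime_primes Nat.prime_two hp₁).mpr h₁.symm
  have c2 : Nat.Coprime 2 p₂ := (Nat.coprime_primes Nat.prime_two hp₂).mpr h₂.symm
  have c3 : Nat.Coprime p₁ p₂ := (Nat.coprime_primes hp₁ hp₂).mpr hne
  rw [Nat.squarefree_mul (c2.mul_left c3), Nat.squarefree_mul c1]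
  exact ⟨⟨Nat.prime_two.prime.squarefree, hp₁.prime.squarefree⟩, hp₂.prime.squarefree⟩

theorem IsSqrtRing.exists_odd_card_classGroup_eq {O : Type*} [CommRing O] [IsDedekindDomain O]
    [CharZero O] [Finite (ClassGroup O)] {σ : O ≃+* O} {r : O} {m : ℤ} (h : IsSqrtRing σ r m)
    {p₁ p₂ : ℕ} (hp₁ : p₁.Prime) (hp₂ : p₂.Prime) (hne : p₁ ≠ p₂) (hm₁ : p₁ % 8 = 5)
    (hm₂ : p₂ % 8 = 5) {η : ℤ} (hη : η = 1 ∨ η = -1) (hm : m = η * 2 * p₁ * p₂)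
    (hm' : m < 0 ∨ ∃ u v : ℤ, u ^ 2 - m * v ^ 2 = -1) :
    ∃ n, Odd n ∧ Nat.card (ClassGroup O) = 4 * n := by
  have hsqf := squarefree_two_mul_mul hp₁ hp₂ hne (by omega) (by omega)
  have hassoc : Associated m ((2 * p₁ * p₂ : ℕ) : ℤ) := by
    rw [Int.associated_iff, hm]
    rcases hη with rfl | rfl
    · left; push_cast; ring
    · right; push_cast; ring
  have hms : Squarefree m := hassoc.squarefree_iff.mpr (Int.squarefree_natCast.mpr hsqf)
  have hm0 := hms.ne_zero
  have hdvd {e : ℕ} : (e : ℤ) ∣ m ↔ e ∣ 2 * p₁ * p₂ := by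
    rw [hassoc.dvd_iff_dvd_right, Int.natCast_dvd_natCast]
  have c1 : Nat.Coprime 2 p₁ := (Nat.coprime_primes Nat.prime_two hp₁).mpr (by omega)
  have c2 : Nat.Coprime 2 p₂ := (Nat.coprime_primes Nat.prime_two hp₂).mpr (by omega)
  have c3 : Nat.Coprime p₁ p₂ := (Nat.coprime_primes hp₁ hp₂).mpr hne
  have hmul {a b : ℕ} (hab : a.Coprime b) (hd : a * b ∣ 2 * p₁ * p₂) :
      h.spanPairClass hm0 (a * b : ℕ) = h.spanPairClass hm0 a * h.spanPairClass hm0 b := by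
    rw [Nat.cast_mul, h.spanPairClass_mul hm0 (Nat.isCoprime_iff_coprime.mpr hab)]
    rw [← Nat.cast_mul, hdvd]
    exact hd
  have hfull : h.spanPairClass hm0 (2 * p₁ * p₂ : ℕ) = 1 := by
    rcases Int.associated_iff.mp hassoc with h1 | h1
    · rw [← h1, h.spanPairClass_self]
    · rw [← h.spanPairClass_neg, ← h1, h.spanPairClass_self]
  have hone : h.spanPairClass hm0 (1 : ℕ) = 1 := by
    rw [Nat.cast_one, h.spanPairClass_one]
  have hxd : p₁ ∣ 2 * p₁ * p₂ := ⟨2 * p₂, by ring⟩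
  have hyd : p₂ ∣ 2 * p₁ * p₂ := ⟨2 * p₁, by ring⟩
  have hzd : 2 ∣ 2 * p₁ * p₂ := ⟨p₁ * p₂, by ring⟩
  set x := h.spanPairClass hm0 p₁ with hx
  set y := h.spanPairClass hm0 p₂ with hy
  set z := h.spanPairClass hm0 (2 : ℕ) with hz
  have hx2 : x ^ 2 = 1 := h.spanPairClass_sq hms (hdvd.mpr hxd)
  have hy2 : y ^ 2 = 1 := h.spanPairClass_sq hms (hdvd.mpr hyd)
  have hz2 : z ^ 2 = 1 := h.spanPairClass_sq hms (hdvd.mpr hzd)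
  have hzxy : z * x * y = 1 := by
    rw [← hfull, hmul (c2.mul_left c3) dvd_rfl, hmul c1 (Dvd.intro _ rfl)]
  have hxy : x * y = z := by
    rw [mul_assoc] at hzxy
    rw [eq_inv_of_mul_eq_one_right hzxy, inv_eq_of_mul_eq_one_right (by rw [← sq, hz2])]
  have hN {e : ℕ} (hed : e ∣ 2 * p₁ * p₂) (he : (e : ℤ) = 2 ∨ (e : ℤ) = p₁ ∨ (e : ℤ) = p₂)
      (c : ClassGroup O) : h.spanPairClass hm0 e ≠ c ^ 2 := by
    intro hc
    obtain ⟨δ, u, v, n, hδ, hn, hE⟩ := h.exists_eq_of_spanPairClass_eq_sq hms (hdvd.mpr hed) hc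
    exact hn (eq_zero_of_mul_sq_eq_sub hp₁ hp₂ hne hm₁ hm₂ hη hm he hδ hE)
  refine exists_odd_card_eq_four_mul hx2 hy2 ?_ (hN hxd (by simp)) (hN hyd (by simp))
    (fun c ↦ hxy ▸ hN hzd (by simp) c)
  intro c hc
  obtain ⟨e, hem, rfl⟩ := h.exists_eq_spanPairClass hms
    ((by norm_num : (2 : ℤ) = (2 : ℕ)) ▸ hdvd.mpr hzd) hm' hc
  have hyx : z * y = x := by rw [← hxy, mul_assoc, ← sq, hy2, mul_one]
  have hzx : z * x = y := by rw [← hxy, mul_right_comm, ← sq, hx2, one_mul]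
  rw [hdvd, Nat.dvd_mul] at hem
  obtain ⟨a, b, ha, hb, rfl⟩ := hem
  rw [Nat.dvd_mul] at ha
  obtain ⟨a, a', ha, ha', rfl⟩ := ha
  rw [Nat.dvd_prime Nat.prime_two] at ha
  rw [Nat.dvd_prime hp₁] at ha'
  rw [Nat.dvd_prime hp₂] at hb
  rw [hxy]
  rcases ha with rfl | rfl <;> rcases ha' with rfl | rfl <;> rcases hb with rfl | rfl <;>
    try simp only [one_mul, mul_one]
  · exact Or.inl hone
  · simp [← hy]
  · simp [← hx]
  · rw [hmul c3 ⟨2, by ring⟩, ← hx, ← hy, hxy]; simp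
  · exact Or.inr (Or.inr (Or.inr hz.symm))
  · rw [hmul c2 ⟨p₁, by ring⟩, ← hz, ← hy, hyx]; simp
  · rw [hmul c1 ⟨p₂, by ring⟩, ← hz, ← hx, hzx]; simp
  · exact Or.inl hfull

end ClassNumberFourOdd

section QuadraticClassNumbers

namespace IsQuadraticGenerator

variable {K : Type*} [Field K] [NumberField K] {x : K} {m : ℤ} (h : IsQuadraticGenerator x m)

include h

theorem exists_isSqrtRing (hm : Squarefree m) (h4 : m % 4 = 2) :
    ∃ (σ : 𝓞 K ≃+* 𝓞 K) (r : 𝓞 K), IsSqrtRing σ r m := by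
  obtain ⟨w, hwx, hw2⟩ := h.exists_integer
  have hwx' : algebraMap (𝓞 K) K w = x := hwx
  obtain ⟨τ, hτ, -⟩ := h.exists_conj
  refine ⟨RingOfIntegers.mapRingEquiv τ.toRingEquiv, w, hw2, ?_, ?_, ?_⟩
  · intro y
    obtain ⟨A, B, hy, h4d⟩ := h.exists_int_of_isIntegral hm (RingOfIntegers.isIntegral_coe y)
    have hAB : A % 2 = 0 ∧ B % 2 = 0 := by
      have e1 : (A ^ 2 - m * B ^ 2) % 4 = 0 := by omega
      have hA : A % 4 = 0 ∨ A % 4 = 1 ∨ A % 4 = 2 ∨ A % 4 = 3 := by omega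
      have hB : B % 4 = 0 ∨ B % 4 = 1 ∨ B % 4 = 2 ∨ B % 4 = 3 := by omega
      rcases hA with hA | hA | hA | hA <;>
        rcases hB with hB | hB | hB | hB <;>
        simp [Int.sub_emod, Int.mul_emod, pow_two, h4, hA, hB] at e1 <;> omega
    obtain ⟨a, rfl⟩ : ∃ a, A = 2 * a := ⟨A / 2, by omega⟩
    obtain ⟨b, rfl⟩ : ∃ b, B = 2 * b := ⟨B / 2, by omega⟩
    refine ⟨a, b, RingOfIntegers.coe_injective ?_⟩
    rw [map_add, map_mul, map_intCast, map_intCast, hwx']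
    apply mul_left_cancel₀ (two_ne_zero (α := K))
    push_cast at hy
    rw [hy]; ring
  · intro u v huv
    have h1 := congrArg (algebraMap (𝓞 K) K) huv
    rw [map_add, map_mul, map_intCast, map_intCast, hwx', map_zero] at h1
    have h2 : u ^ 2 = m * v ^ 2 := by
      have : (u : K) ^ 2 = m * v ^ 2 := by
        rw [← h.sq_eq]
        linear_combination (u - v * x) * h1
      exact_mod_cast this
    have hv : v = 0 := by
      by_contra hv
      obtain ⟨k, rfl⟩ := (Int.pow_dvd_pow_iff two_ne_zero).mp ⟨m, h2.trans (mul_comm _ _)⟩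
      refine h.not_isSquare ⟨k, ?_⟩
      apply mul_left_cancel₀ (pow_ne_zero 2 hv)
      linear_combination -h2
    subst hv
    exact ⟨by simpa using h2, rfl⟩
  · apply RingOfIntegers.coe_injective
    rw [map_neg, hwx', ← hτ, ← hwx']
    rfl

theorem exists_odd_classNumber_eq {p₁ p₂ : ℕ} (hp₁ : p₁.Prime) (hp₂ : p₂.Prime) (hne : p₁ ≠ p₂)
    (hm₁ : p₁ % 8 = 5) (hm₂ : p₂ % 8 = 5) {η : ℤ} (hη : η = 1 ∨ η = -1)
    (hm : m = η * 2 * p₁ * p₂) (hm' : m < 0 ∨ ∃ u v : ℤ, u ^ 2 - m * v ^ 2 = -1) :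
    ∃ n, Odd n ∧ classNumber K = 4 * n := by
  have hsqf := squarefree_two_mul_mul hp₁ hp₂ hne (by omega) (by omega)
  have hassoc : Associated m ((2 * p₁ * p₂ : ℕ) : ℤ) := by
    rw [Int.associated_iff, hm]
    rcases hη with rfl | rfl
    · left; push_cast; ring
    · right; push_cast; ring
  have h4 : m % 4 = 2 := by
    have : (p₁ : ℤ) * p₂ % 2 = 1 := by
      rw [Int.mul_emod, show (p₁ : ℤ) % 2 = 1 by omega, show (p₂ : ℤ) % 2 = 1 by omega]
      rfl
    rcases hη with rfl | rfl
    · rw [hm, one_mul, mul_assoc]; omega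
    · rw [hm, mul_assoc]; omega
  obtain ⟨σ, r, hr⟩ := h.exists_isSqrtRing
    (hassoc.squarefree_iff.mpr (Int.squarefree_natCast.mpr hsqf)) h4
  obtain ⟨n, hn, hcard⟩ := hr.exists_odd_card_classGroup_eq hp₁ hp₂ hne hm₁ hm₂ hη hm hm'
  exact ⟨n, hn, by rw [classNumber, ← Nat.card_eq_fintype_card, hcard]⟩

theorem classNumber_eq_one (hm : m = -1 ∨ m = 2 ∨ m = -2) : classNumber K = 1 := by
  have hsq : Squarefree m := by
    rcases hm with rfl | rfl | rfl
    · exact isUnit_one.neg.squarefree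
    · exact Int.prime_two.squarefree
    · exact Int.prime_two.neg.squarefree
  rw [classNumber_eq_one_iff]
  apply RingOfIntegers.isPrincipalIdealRing_of_abs_discr_lt
  rw [h.finrank_eq, h.discr_of_mod_four_ne_one hsq (by omega)]
  have hpi := Real.pi_gt_three
  rcases lt_or_gt_of_ne (show m ≠ 0 by omega) with h0 | h0
  · have : IsTotallyComplex K := isTotallyComplex_of_sq_eq h.sq_eq h0
    have h1 := IsTotallyComplex.finrank K
    rw [h.finrank_eq] at h1
    rw [show InfinitePlace.nrComplexPlaces K = 1 by omega]
    have h2 : |4 * m| ≤ 8 := by rw [abs_le]; omega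
    have h3 : ((|4 * m| : ℤ) : ℝ) ≤ 8 := by exact_mod_cast h2
    refine h3.trans_lt ?_
    norm_num [Nat.factorial]
    nlinarith
  · have : IsTotallyReal K := h.isTotallyReal h0
    rw [IsTotallyReal.nrComplexPlaces_eq_zero K]
    have h2 : |4 * m| ≤ 8 := by rw [abs_le]; omega
    have h3 : ((|4 * m| : ℤ) : ℝ) ≤ 8 := by exact_mod_cast h2
    refine h3.trans_lt ?_
    norm_num [Nat.factorial]

end IsQuadraticGenerator
end QuadraticClassNumbers

section ClassNumberProduct

theorem IsQuadraticUnit.exists_of_sq_sub_eq {K : Type*} [Field K] [NumberField K] {y : K}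
    {m N X Y : ℤ} (hy : y ^ 2 = m) (hN : N = 1 ∨ N = -1) (h : X ^ 2 - m * Y ^ 2 = 4 * N)
    {φ : K →+* ℂ} {a : ℝ} (hφ : φ y = a) :
    ∃ e : (𝓞 K)ˣ, IsQuadraticUnit y (algebraMap (𝓞 K) K e) N ∧
      φ (algebraMap (𝓞 K) K e) = ((X + Y * a) / 2 : ℝ) := by
  obtain ⟨e, he⟩ := exists_unit_of_sq_sub_eq_four hy (X := X) (Y := Y) (by
    rcases hN with rfl | rfl
    · exact Or.inl h
    · exact Or.inr h)
  refine ⟨e, ⟨X, Y, he, ?_⟩, ?_⟩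
  · rw [hy]
    have := congrArg (Int.cast : ℤ → K) h
    push_cast at this ⊢
    linear_combination this
  · rw [he]
    simp only [map_div₀, map_add, map_mul, map_intCast, map_ofNat, hφ]
    push_cast
    rfl

variable {K : Type*} [Field K] [NumberField K] {r s t : K} {d : ℤ}
  {k : Fin 7 → Type*} [∀ i, Field (k i)] [∀ i, NumberField (k i)] {x : ∀ i, k i}

theorem IsTriquadraticGenerator.exists_odd_classNumber_mul_eq (h : IsTriquadraticGenerator r s t d)
    (hk : ∀ i, IsQuadraticGenerator (x i) (quadraticRadicand d i)) {p₁ p₂ : ℕ} (hp₁ : p₁.Prime)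
    (hp₂ : p₂.Prime) (hne : p₁ ≠ p₂) (hm₁ : p₁ % 8 = 5) (hm₂ : p₂ % 8 = 5)
    (hd : d = (p₁ * p₂ : ℕ)) {φ : K →+* ℂ} (hφr : φ r = (√2 : ℝ))
    (hφs : φ s = (√(p₁ * p₂ : ℕ) : ℝ)) {φ₂ : k 1 →+* ℂ} (hφ₂ : φ₂ (x 1) = (√(2 : ℕ) : ℝ))
    {φ₁ : k 3 →+* ℂ} (hφ₁ : φ₁ (x 3) = (√(p₁ * p₂ : ℕ) : ℝ))
    {φ₃ : k 4 →+* ℂ} (hφ₃ : φ₃ (x 4) = (√(2 * p₁ * p₂ : ℕ) : ℝ)) {ε₂ ε₁ ε₃ : ℝ}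
    (hε₂ : IsFundUnit 2 ε₂) (hε₁ : IsFundUnit (p₁ * p₂) ε₁) (hε₃ : IsFundUnit (2 * p₁ * p₂) ε₃)
    (hsq : ¬ ∃ t : ℝ, t ∈ ℚ⟮√2, √(p₁ * p₂ : ℕ)⟯ ∧ t ^ 2 = ε₂ * ε₁ * ε₃) :
    ∃ a b : ℕ, Odd a ∧ Odd b ∧ classNumber K * a = classNumber (k 3) * classNumber (k 5) * b := by
  have hsqf := squarefree_two_mul_mul hp₁ hp₂ hne (by omega) (by omega)
  have hds : Squarefree d := h.squarefree
  have h2ds : Squarefree ((2 * p₁ * p₂ : ℕ) : ℤ) := Int.squarefree_natCast.mpr hsqf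
  have hd0 : 0 < d := by
    rw [hd]
    exact_mod_cast Nat.mul_pos hp₁.pos hp₂.pos
  have hd8 := h.mod_eight
  -- the seven quadratic subfields
  have k₀ : IsQuadraticGenerator (x 0) (-1) := hk 0
  have k₁ : IsQuadraticGenerator (x 1) (2 : ℕ) := hk 1
  have k₂ : IsQuadraticGenerator (x 2) (-2) := hk 2
  have k₃ : IsQuadraticGenerator (x 3) (p₁ * p₂ : ℕ) := hd ▸ hk 3
  have k₄ : IsQuadraticGenerator (x 4) (2 * p₁ * p₂ : ℕ) := by
    convert hk 4 using 1
    change _ = 2 * d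
    rw [hd]; push_cast; ring
  have k₅ : IsQuadraticGenerator (x 5) (-d) := hk 5
  have k₆ : IsQuadraticGenerator (x 6) (-2 * d) := hk 6
  have hd1 : d ≠ 1 := fun h1 ↦ h.not_isSquare (h1 ▸ IsSquare.one)
  have hs₅ : Squarefree (-d) := (Associated.neg_left (Associated.refl d)).squarefree_iff.mpr hds
  have hs₆ : Squarefree (-2 * d) := by
    rw [show -2 * d = -((2 * p₁ * p₂ : ℕ) : ℤ) by rw [hd]; push_cast; ring]
    exact (Associated.neg_left (Associated.refl _)).squarefree_iff.mpr h2ds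
  obtain ⟨n₀, hn₀, e₀⟩ := k₀.dedekindZeta_residue_mul_of_eq_neg_one rfl
  obtain ⟨a₁, b₁, ha₁, hb₁, e₁⟩ :=
    k₁.dedekindZeta_residue_mul_of_isFundUnit Int.prime_two.squarefree hφ₂ hε₂
  obtain ⟨n₂, hn₂, e₂⟩ :=
    k₂.dedekindZeta_residue_mul_of_neg Int.prime_two.neg.squarefree (by norm_num) (by norm_num)
  obtain ⟨a₃, b₃, ha₃, hb₃, e₃⟩ :=
    k₃.dedekindZeta_residue_mul_of_isFundUnit (hd ▸ hds) hφ₁ hε₁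
  obtain ⟨a₄, b₄, ha₄, hb₄, e₄⟩ :=
    k₄.dedekindZeta_residue_mul_of_isFundUnit h2ds hφ₃ hε₃
  obtain ⟨n₅, hn₅, e₅⟩ := k₅.dedekindZeta_residue_mul_of_neg hs₅ (by omega) (by omega)
  obtain ⟨n₆, hn₆, e₆⟩ := k₆.dedekindZeta_residue_mul_of_neg hs₆ (by omega) (by omega)
  rw [k₀.discr_of_mod_four_ne_one isUnit_one.neg.squarefree (by norm_num),
    k₀.classNumber_eq_one (by norm_num)] at e₀
  rw [k₁.discr_of_mod_four_ne_one Int.prime_two.squarefree (by norm_num),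
    k₁.classNumber_eq_one (by norm_num)] at e₁
  rw [k₂.discr_of_mod_four_ne_one Int.prime_two.neg.squarefree (by norm_num),
    k₂.classNumber_eq_one (by norm_num)] at e₂
  rw [k₃.discr_of_mod_four_eq_one (hd ▸ hds) (by omega), ← hd] at e₃
  rw [k₄.discr_of_mod_four_ne_one h2ds (by push_cast; rw [mul_assoc]; omega)] at e₄
  rw [k₅.discr_of_mod_four_ne_one hs₅ (by omega)] at e₅
  rw [k₆.discr_of_mod_four_ne_one hs₆ (by omega)] at e₆
  -- class numbers of `ℚ(√±2d)`
  obtain ⟨X₂, Y₂, hX₂, hN₂⟩ := hε₂.exists_norm_neg_one_of_two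
  obtain ⟨X₃, Y₃, hX₃, hN₃⟩ := hε₃.exists_norm_neg_one hp₁ hp₂ hne hm₁ hm₂
  obtain ⟨N, hN, X₁, Y₁, hX₁, hN₁⟩ : ∃ N : ℤ, (N = 1 ∨ N = -1) ∧ ∃ X Y : ℤ,
      ε₁ = (X + Y * √(p₁ * p₂ : ℕ)) / 2 ∧ X ^ 2 - d * Y ^ 2 = 4 * N := by
    obtain ⟨X, Y, hX, hN | hN⟩ := hε₁.2.1
    · exact ⟨1, Or.inl rfl, X, Y, hX, hd ▸ hN⟩
    · exact ⟨-1, Or.inr rfl, X, Y, hX, hd ▸ hN⟩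
  have hodd : (p₁ : ℤ) * p₂ % 2 = 1 := by
    rw [hd] at hd8
    push_cast at hd8
    omega
  have hunit : ∃ u v : ℤ, u ^ 2 - (2 * p₁ * p₂ : ℕ) * v ^ 2 = -1 := by
    have hX : Even X₃ := by
      have : Even (X₃ ^ 2) := ⟨(p₁ * p₂) * Y₃ ^ 2 - 2, by push_cast at hN₃; linarith⟩
      exact (Int.even_pow.mp this).1
    obtain ⟨u, rfl⟩ := hX
    have hY : Even Y₃ := by
      have : Even ((p₁ * p₂) * Y₃ ^ 2) := ⟨u ^ 2 + 1, by push_cast at hN₃; linarith⟩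
      rw [Int.even_mul, Int.even_iff, hodd] at this
      exact (Int.even_pow.mp (this.resolve_left (by norm_num))).1
    obtain ⟨v, rfl⟩ := hY
    exact ⟨u, v, by linarith⟩
  obtain ⟨h₄, hh₄, eh₄⟩ := k₄.exists_odd_classNumber_eq hp₁ hp₂ hne hm₁ hm₂ (η := 1) (Or.inl rfl)
    (by push_cast; ring) (Or.inr hunit)
  obtain ⟨h₆, hh₆, eh₆⟩ := k₆.exists_odd_classNumber_eq hp₁ hp₂ hne hm₁ hm₂ (η := -1)
    (Or.inr rfl) (by rw [hd]; push_cast; ring) (Or.inl (by omega))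
  -- the field `K`
  have hφrs : φ (r * s) = (√(2 * p₁ * p₂ : ℕ) : ℝ) := by
    rw [map_mul, hφr, hφs, ← Complex.ofReal_mul, ← Real.sqrt_mul (by norm_num)]
    push_cast
    rw [mul_assoc]
  obtain ⟨u₂, hu₂, hu₂φ⟩ := IsQuadraticUnit.exists_of_sq_sub_eq (m := 2) (N := -1)
    (by rw [h.r_sq]; norm_num) (Or.inr rfl) hN₂ hφr
  obtain ⟨u₁, hu₁, hu₁φ⟩ := IsQuadraticUnit.exists_of_sq_sub_eq h.s_sq hN hN₁ hφs
  obtain ⟨u₃, hu₃, hu₃φ⟩ := IsQuadraticUnit.exists_of_sq_sub_eq (y := r * s) (N := -1)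
    (m := (2 * p₁ * p₂ : ℕ)) (by rw [mul_pow, h.r_sq, h.s_sq, hd]; push_cast; ring) (Or.inr rfl)
    hN₃ hφrs
  rw [← hX₂] at hu₂φ
  rw [← hX₁] at hu₁φ
  rw [← hX₃] at hu₃φ
  obtain ⟨a, b, ha, hb, e⟩ := h.dedekindZeta_residue_mul_eq hd hφr hφs hu₂ hu₁ hu₃ hN hu₂φ hu₁φ
    hu₃φ hε₂.1 hε₃.1 hε₁ hsq
  have hprod := h.dedekindZeta_residue_eq hk (fun p hp hpd ↦ by
    rw [hd, Int.natCast_dvd_natCast, hp.dvd_mul, Nat.prime_dvd_prime_iff_eq hp hp₁,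
      Nat.prime_dvd_prime_iff_eq hp hp₂] at hpd
    rcases hpd with rfl | rfl <;> assumption)
  rw [Fin.prod_univ_seven] at hprod
  have hd0' : (0 : ℝ) < d := by exact_mod_cast hd0
  have hdR : ((2 * p₁ * p₂ : ℕ) : ℝ) = 2 * d := by rw [hd]; push_cast; ring
  have hdR' : ((p₁ * p₂ : ℕ) : ℝ) = d := by rw [hd]; push_cast; ring
  refine ⟨n₀ * (a₁ * b₁) * n₂ * (a₃ * b₃) * (a₄ * b₄) * n₅ * n₆, h₄ * h₆ * (a * b),
    (((((hn₀.mul (ha₁.mul hb₁)).mul hn₂).mul (ha₃.mul hb₃)).mul (ha₄.mul hb₄)).mul hn₅).mul hn₆,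
    (hh₄.mul hh₆).mul (ha.mul hb), ?_⟩
  set q : ℝ := √d with hq
  set S : ℝ := √8 with hS
  have hq2 : q ^ 2 = d := Real.sq_sqrt hd0'.le
  have hS2 : S ^ 2 = 8 := Real.sq_sqrt (by norm_num)
  have hq0 : 0 < q := Real.sqrt_pos.mpr hd0'
  have hS0 : 0 < S := Real.sqrt_pos.mpr (by norm_num)
  have r₀ : √|((4 * -1 : ℤ) : ℝ)| = 2 := by
    rw [show |((4 * -1 : ℤ) : ℝ)| = 2 ^ 2 by norm_num]
    exact Real.sqrt_sq (by norm_num)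
  have r₁ : √|((4 * (2 : ℕ) : ℤ) : ℝ)| = S := by
    rw [show |((4 * (2 : ℕ) : ℤ) : ℝ)| = 8 by norm_num]
  have r₂ : √|((4 * -2 : ℤ) : ℝ)| = S := by
    rw [show |((4 * -2 : ℤ) : ℝ)| = 8 by norm_num]
  have r₃ : √|(d : ℝ)| = q := by rw [abs_of_pos hd0']
  have r₄ : √|((4 * (2 * p₁ * p₂ : ℕ) : ℤ) : ℝ)| = S * q := by
    rw [Int.cast_mul, Int.cast_natCast, hdR, abs_of_pos (by push_cast; positivity),
      ← Real.sqrt_mul (by norm_num)]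
    push_cast
    ring_nf
  have r₅ : √|((4 * -d : ℤ) : ℝ)| = 2 * q := by
    rw [show |((4 * -d : ℤ) : ℝ)| = (2 * q) ^ 2 by
      push_cast; rw [mul_neg, abs_neg, abs_of_pos (by positivity), mul_pow, hq2]; norm_num]
    exact Real.sqrt_sq (by positivity)
  have r₆ : √|((4 * (-2 * d) : ℤ) : ℝ)| = S * q := by
    rw [← r₄, Int.cast_mul, Int.cast_mul, Int.cast_mul, Int.cast_natCast, hdR]
    congr 1
    push_cast
    rw [neg_mul, mul_neg, abs_neg]
  rw [r₀, Nat.cast_one] at e₀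
  rw [r₁, Nat.cast_one] at e₁
  rw [r₂, Nat.cast_one] at e₂
  rw [r₃] at e₃
  rw [r₄, eh₄] at e₄
  rw [r₅] at e₅
  rw [r₆, eh₆] at e₆
  rw [hprod, hdR', ← hq2] at e
  have hL₂ := Real.log_pos hε₂.1
  have hL₁ := Real.log_pos hε₁.1
  have hL₃ := Real.log_pos hε₃.1
  have hpi := Real.pi_pos
  have key : (classNumber K : ℝ) *
      (n₀ * (a₁ * b₁) * n₂ * (a₃ * b₃) * (a₄ * b₄) * n₅ * n₆) =
      classNumber (k 3) * classNumber (k 5) * (h₄ * h₆ * (a * b)) := by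
    set C := Real.pi ^ 4 * (Real.log ε₂ * Real.log ε₁ * Real.log ε₃) / (4 * (q ^ 2) ^ 2) with hC
    have hC0 : C ≠ 0 := by positivity
    have hS4 : S⁻¹ ^ 4 = 1 / 64 := by
      rw [inv_pow, show S ^ 4 = (S ^ 2) ^ 2 by ring, hS2]; norm_num
    apply mul_left_cancel₀ hC0
    calc _ = Real.pi ^ 4 * (Real.log ε₂ * Real.log ε₁ * Real.log ε₃) * classNumber K /
          (4 * (q ^ 2) ^ 2) *
          (n₀ * (a₁ * b₁) * n₂ * (a₃ * b₃) * (a₄ * b₄) * n₅ * n₆) := by rw [hC]; ring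
      _ = dedekindZeta_residue (k 0) * n₀ * (dedekindZeta_residue (k 1) * a₁ * b₁) *
          (dedekindZeta_residue (k 2) * n₂) * (dedekindZeta_residue (k 3) * a₃ * b₃) *
          (dedekindZeta_residue (k 4) * a₄ * b₄) * (dedekindZeta_residue (k 5) * n₅) *
          (dedekindZeta_residue (k 6) * n₆) * (a * b) := by rw [← e]; ring
      _ = _ := by
        rw [e₀, e₁, e₂, e₃, e₄, e₅, e₆, hC]
        push_cast
        simp only [div_eq_mul_inv, mul_inv]
        linear_combination 16 * Real.pi ^ 4 * Real.log ε₂ * Real.log ε₁ * Real.log ε₃ *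
          classNumber (k 3) * classNumber (k 5) * h₄ * h₆ * a * b * q⁻¹ ^ 4 * hS4
  exact_mod_cast key

end ClassNumberProduct

section QuadraticRoot

/-- A complex square root of the integer `m`. -/
noncomputable def quadraticRoot (m : ℤ) : ℂ :=
  if 0 ≤ m then (√(m : ℝ) : ℂ) else (√(-m : ℝ) : ℂ) * Complex.I

theorem quadraticRoot_sq (m : ℤ) : quadraticRoot m ^ 2 = m := by
  unfold quadraticRoot
  split_ifs with hm
  · have h0 : (0 : ℝ) ≤ m := by exact_mod_cast hm
    rw [← Complex.ofReal_pow, Real.sq_sqrt h0, Complex.ofReal_intCast]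
  · have h0 : (0 : ℝ) ≤ -m := by
      have : 0 ≤ -m := by omega
      exact_mod_cast this
    rw [mul_pow, ← Complex.ofReal_pow, Real.sq_sqrt h0, Complex.I_sq]
    push_cast
    ring

theorem quadraticRoot_natCast (n : ℕ) : quadraticRoot n = ((√(n : ℝ) : ℝ) : ℂ) := by
  simp [quadraticRoot]

theorem quadraticRoot_neg_natCast {n : ℕ} (hn : n ≠ 0) :
    quadraticRoot (-n) = ((√(n : ℝ) : ℝ) : ℂ) * Complex.I := by
  rw [quadraticRoot, if_neg (by have := Nat.pos_of_ne_zero hn; omega)]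
  simp

instance (m : ℤ) : NumberField ℚ⟮quadraticRoot m⟯ where
  to_finiteDimensional := by
    have h : IsIntegral ℚ (quadraticRoot m) := by
      refine IsIntegral.of_pow two_pos ?_
      rw [quadraticRoot_sq]
      exact (isIntegral_algebraMap (R := ℤ) (x := m)).tower_top
    convert adjoin.finiteDimensional h

theorem isTriquadraticGenerator_of_eq_adjoin {L : Type*} [Field L] [CharZero L] {r s t : L} {d : ℤ}
    {K : IntermediateField ℚ L} [NumberField K] (hK : K = ℚ⟮r, s, t⟯) (hr : r ^ 2 = 2)
    (hs : s ^ 2 = d) (ht : t ^ 2 = -1) (hd : Squarefree d) (hmod : d % 8 = 1)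
    (hsq : ¬ IsSquare d) :
    ∃ (r' s' t' : K), (r' : L) = r ∧ (s' : L) = s ∧ (t' : L) = t ∧
      IsTriquadraticGenerator r' s' t' d := by
  subst hK
  have hr' : r ∈ ℚ⟮r, s, t⟯ := subset_adjoin _ _ (by simp)
  have hs' : s ∈ ℚ⟮r, s, t⟯ := subset_adjoin _ _ (by simp)
  have ht' : t ∈ ℚ⟮r, s, t⟯ := subset_adjoin _ _ (by simp)
  refine ⟨⟨r, hr'⟩, ⟨s, hs'⟩, ⟨t, ht'⟩, rfl, rfl, rfl, Subtype.ext (by push_cast; exact hr),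
    Subtype.ext (by simpa using hs), Subtype.ext (by simpa using ht), ?_, hd, hmod, hsq⟩
  have key : @adjoin ℚ _ ℚ⟮r, s, t⟯ _ (IntermediateField.algebra' _)
      {⟨r, hr'⟩, ⟨s, hs'⟩, ⟨t, ht'⟩} = ⊤ := by
    apply IntermediateField.lift_injective
    rw [lift_top, lift, adjoin_map]
    congr 1
    simp [Set.image_insert_eq]
  convert key <;> exact Subsingleton.elim _ _

theorem card_sylow_two_eq_mul {A B C : Type*} [Group A] [Group B] [Group C] [Finite A] [Finite B]
    [Finite C] {a b : ℕ} (ha : Odd a) (hb : Odd b)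
    (h : Nat.card A * a = Nat.card B * Nat.card C * b) (P : Sylow 2 A) (Q : Sylow 2 B)
    (R : Sylow 2 C) : Nat.card P = Nat.card Q * Nat.card R := by
  rw [P.card_eq_multiplicity, Q.card_eq_multiplicity, R.card_eq_multiplicity, ← pow_add]
  have ha0 : a ≠ 0 := ha.pos.ne'
  have hb0 : b ≠ 0 := hb.pos.ne'
  have hA : Nat.card A ≠ 0 := Nat.card_pos.ne'
  have hB : Nat.card B ≠ 0 := Nat.card_pos.ne'
  have hC : Nat.card C ≠ 0 := Nat.card_pos.ne'
  have h2 := congrArg (fun n ↦ n.factorization 2) h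
  simp only [Nat.factorization_mul hA ha0, Nat.factorization_mul (mul_ne_zero hB hC) hb0,
    Nat.factorization_mul hB hC, Finsupp.add_apply,
    Nat.factorization_eq_zero_of_not_dvd ha.not_two_dvd_nat,
    Nat.factorization_eq_zero_of_not_dvd hb.not_two_dvd_nat, add_zero] at h2
  rw [h2]

theorem quadraticRadicand_not_isSquare {d : ℤ} (h1 : 1 < d) (hd : Squarefree d) (hodd : Odd d)
    (i : Fin 7) : ¬ IsSquare (quadraticRadicand d i) := by
  have key (m : ℤ) (hm : Squarefree m) (hm1 : m ≠ 1) : ¬ IsSquare m := by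
    rintro ⟨k, hk⟩
    have := Int.isUnit_iff.mp (hm k (hk ▸ dvd_rfl))
    rcases this with rfl | rfl <;> simp_all
  have h2 : Squarefree (2 * d) := by
    refine (squarefree_mul_iff).mpr ⟨?_, Int.prime_two.squarefree, hd⟩
    exact IsCoprime.isRelPrime ⟨-(d / 2), 1, by have := Int.odd_iff.mp hodd; omega⟩
  fin_cases i
  all_goals simp only [quadraticRadicand]
  · exact fun h ↦ absurd h.nonneg (by norm_num)
  · exact key 2 Int.prime_two.squarefree (by norm_num)
  · exact fun h ↦ absurd h.nonneg (by norm_num)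
  · exact key d hd h1.ne'
  · exact key (2 * d) h2 (by omega)
  · exact fun h ↦ absurd h.nonneg (by simp; omega)
  · exact fun h ↦ absurd h.nonneg (by simp; omega)

end QuadraticRoot

/-- If `ε₂·ε_{p₁p₂}·ε_{2p₁p₂}` is not a square in `K₃⁺ = ℚ(√2, √(p₁p₂))`,
then the order of `Cl₂(K₃)` equals `h₂(p₁p₂)·h₂(-p₁p₂)`, where `K₃ = ℚ(√2, √(p₁p₂), i)`. -/
theorem stmt_10 (p₁ p₂ : ℕ) (hp₁ : p₁.Prime) (hp₂ : p₂.Prime) (hne : p₁ ≠ p₂)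
    (hm₁ : p₁ % 8 = 5) (hm₂ : p₂ % 8 = 5)
    (Fp Fm K₃ : IntermediateField ℚ ℂ)
    (hFp : Fp = ℚ⟮((Real.sqrt ((p₁ : ℝ) * p₂) : ℝ) : ℂ)⟯)
    (hFm : Fm = ℚ⟮((Real.sqrt ((p₁ : ℝ) * p₂) : ℝ) : ℂ) * Complex.I⟯)
    (hK₃ : K₃ = ℚ⟮((Real.sqrt 2 : ℝ) : ℂ), ((Real.sqrt ((p₁ : ℝ) * p₂) : ℝ) : ℂ), Complex.I⟯)
    [NumberField Fp] [NumberField Fm] [NumberField K₃]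
    (ε₂ εp εd : ℝ)
    (hε₂ : IsFundUnit 2 ε₂) (hεp : IsFundUnit (p₁ * p₂) εp) (hεd : IsFundUnit (2 * p₁ * p₂) εd)
    (hsq : ¬ ∃ t : ℝ, t ∈ ℚ⟮Real.sqrt 2, Real.sqrt ((p₁ : ℝ) * p₂)⟯ ∧ t ^ 2 = ε₂ * εp * εd) :
    ∀ (P : Sylow 2 (ClassGroup (RingOfIntegers K₃)))
      (Q : Sylow 2 (ClassGroup (RingOfIntegers Fp)))
      (R : Sylow 2 (ClassGroup (RingOfIntegers Fm))),
      Nat.card P = Nat.card Q * Nat.card R := by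
  intro P Q R
  rw [← Nat.cast_mul] at hFp hFm hK₃ hsq
  have hpos : 1 < p₁ * p₂ := Nat.one_lt_mul_iff.mpr ⟨hp₁.pos, hp₂.pos, .inl hp₁.one_lt⟩
  have hmod : p₁ * p₂ % 8 = 1 := by rw [Nat.mul_mod, hm₁, hm₂]
  have hsqf : Squarefree ((p₁ * p₂ : ℕ) : ℤ) := by
    rw [Int.squarefree_natCast, Nat.squarefree_mul ((Nat.coprime_primes hp₁ hp₂).mpr hne)]
    exact ⟨hp₁.prime.squarefree, hp₂.prime.squarefree⟩
  have hns := quadraticRadicand_not_isSquare (by exact_mod_cast hpos) hsqf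
    (Int.odd_iff.mpr (by omega))
  have hroot (n : ℕ) : (((√(n : ℝ) : ℝ) : ℂ)) ^ 2 = n := by
    rw [← quadraticRoot_natCast, quadraticRoot_sq, Int.cast_natCast]
  obtain ⟨r, s, t, hr, hs, -, h⟩ := isTriquadraticGenerator_of_eq_adjoin hK₃
    (by simpa using hroot 2) (d := (p₁ * p₂ : ℕ)) (by rw [hroot, Int.cast_natCast])
    Complex.I_sq hsqf (by omega) (hns 3)
  rw [← quadraticRoot_natCast] at hFp
  rw [← quadraticRoot_neg_natCast (by omega)] at hFm
  subst hFp hFm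
  have hroot₃ : quadraticRoot (2 * (p₁ * p₂ : ℕ)) = ((√(2 * p₁ * p₂ : ℕ) : ℝ) : ℂ) := by
    rw [← quadraticRoot_natCast, mul_assoc, Nat.cast_mul 2, Nat.cast_two]
  obtain ⟨a, b, ha, hb, hab⟩ := h.exists_odd_classNumber_mul_eq
    (k := fun i ↦ ℚ⟮quadraticRoot (quadraticRadicand (p₁ * p₂ : ℕ) i)⟯)
    (fun i ↦ isQuadraticGenerator_adjoinSimple (quadraticRoot_sq _) (hns i))
    hp₁ hp₂ hne hm₁ hm₂ rfl (φ := algebraMap K₃ ℂ) (by simpa using hr) (by simpa using hs)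
    (φ₂ := algebraMap _ ℂ) (quadraticRoot_natCast 2)
    (φ₁ := algebraMap _ ℂ) (quadraticRoot_natCast (p₁ * p₂))
    (φ₃ := algebraMap _ ℂ) hroot₃
    hε₂ hεp hεd hsq
  refine card_sylow_two_eq_mul ha hb ?_ P Q R
  rw [Nat.card_eq_fintype_card, Nat.card_eq_fintype_card, Nat.card_eq_fintype_card]
  exact hab
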